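/- arXiv:1503.02227 — 8 statements merged into one kernel-verified Lean document; each statement's English description precedes it below -/
import Mathlib

section
/- Let n ≥ 2. The algebra 𝒜_n is a finite-dimensional ℂ-algebra of dimension n!. -/
/-!
STATEMENT 9: for `n ≥ 2`, the algebra `𝒜ₙ` — the quotient of the free
ℂ-algebra on generators `ς₁, …, ς_{n−1}` by the two-sided ideal generated by
`ςᵢ² + 1`, `(ςᵢςⱼ)² + 1` (`|i−j| ≥ 2`) and `(ςᵢς_{i+1})³ + 1` — is a
finite-dimensional ℂ-algebra of dimension `n!`.
(The quotient is realized as `RingQuot` of the relation identifying each of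
these defining expressions `ςᵢ²`, `(ςᵢςⱼ)²`, `(ςᵢς_{i+1})³` with `−1`.)
-/

namespace SpinSymAlgebra

/-- The defining relations of `𝒜ₙ`. -/
inductive ARel (n : ℕ) : FreeAlgebra ℂ (Fin (n - 1)) → FreeAlgebra ℂ (Fin (n - 1)) → Prop
  | sq (i : Fin (n - 1)) : ARel n (FreeAlgebra.ι ℂ i ^ 2) (-1)
  | far (i j : Fin (n - 1)) (h : (i : ℕ) + 2 ≤ (j : ℕ) ∨ (j : ℕ) + 2 ≤ (i : ℕ)) :
      ARel n ((FreeAlgebra.ι ℂ i * FreeAlgebra.ι ℂ j) ^ 2) (-1)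
  | adj (i j : Fin (n - 1)) (h : (j : ℕ) = (i : ℕ) + 1) :
      ARel n ((FreeAlgebra.ι ℂ i * FreeAlgebra.ι ℂ j) ^ 3) (-1)

/-- The algebra `𝒜ₙ`. -/
abbrev AAlg (n : ℕ) := RingQuot (ARel n)

section DescendingWords

variable {A : Type*} [Ring A]

/-- The relations of `𝒜_{m+1}`, solved for the braid form, for the first `m` terms of a sequence. -/
structure IsSpinBraid (m : ℕ) (s : ℕ → A) : Prop where
  sq : ∀ i < m, s i * s i = -1
  anticomm : ∀ i j, i + 2 ≤ j → j < m → s j * s i = -(s i * s j)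
  braid : ∀ i, i + 1 < m → s i * s (i + 1) * s i = s (i + 1) * s i * s (i + 1)

/-- The descending word `s (k - 1) * s (k - 2) * ⋯ * s (k - l)`, for `l ≤ k`. -/
def descWord (s : ℕ → A) : ℕ → ℕ → A
  | _, 0 => 1
  | 0, _ + 1 => 1
  | k + 1, l + 1 => s k * descWord s k l

@[simp]
theorem descWord_zero (s : ℕ → A) (k : ℕ) : descWord s k 0 = 1 := by
  cases k <;> rfl

theorem descWord_succ (s : ℕ → A) (k l : ℕ) :
    descWord s (k + 1) (l + 1) = s k * descWord s k l := rfl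

open scoped Pointwise

open Classical in
/-- Products of descending words: the normal forms of words in the first `k` generators. -/
noncomputable def normalWords (s : ℕ → A) : ℕ → Finset A
  | 0 => {1}
  | k + 1 => normalWords s k * (Finset.range (k + 2)).image (descWord s (k + 1))

theorem card_normalWords_le (s : ℕ → A) : ∀ k, (normalWords s k).card ≤ (k + 1).factorial
  | 0 => by simp [normalWords]
  | k + 1 => by
    classical
    rw [Nat.factorial_succ, mul_comm, normalWords]
    refine Finset.card_mul_le.trans (Nat.mul_le_mul (card_normalWords_le s k) ?_)
    exact Finset.card_image_le.trans (by simp)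

end DescendingWords

section SpanningWords

open scoped Pointwise

variable {A : Type*} [Ring A] [Algebra ℂ A] {m : ℕ} {s : ℕ → A}

theorem IsSpinBraid.descWord_mul_far (h : IsSpinBraid m s) {j : ℕ} (hj : j < m) :
    ∀ k l, k < j → ∃ c : ℂ, descWord s k l * s j = c • (s j * descWord s k l)
  | k, 0, _ => ⟨1, by simp⟩
  | 0, l + 1, _ => ⟨1, by simp [descWord]⟩
  | k + 1, l + 1, hk => by
    obtain ⟨c, hc⟩ := h.descWord_mul_far hj k l (by omega)
    refine ⟨-c, ?_⟩
    have h1 : s k * s j = -(s j * s k) := by rw [h.anticomm k j (by omega) hj, neg_neg]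
    rw [descWord_succ, mul_assoc, hc, mul_smul_comm, ← mul_assoc, h1, ← mul_assoc]
    simp

/-- Multiplying a descending word by a generator on the right either gives a descending word again,
or moves a smaller generator to the left of it. -/
theorem IsSpinBraid.descWord_mul (h : IsSpinBraid m s) :
    ∀ k l j, k ≤ m → l ≤ k → j < k →
      (∃ i, i + 1 < k ∧ ∃ c : ℂ, descWord s k l * s j = c • (s i * descWord s k l)) ∨
      (∃ l' ≤ k, ∃ c : ℂ, descWord s k l * s j = c • descWord s k l')
  | k + 1, 0, j, hk, _, hj => by
    rcases Nat.lt_succ_iff_lt_or_eq.1 hj with hj | rfl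
    · exact .inl ⟨j, by omega, 1, by simp⟩
    · exact .inr ⟨1, by omega, 1, by simp [descWord]⟩
  | k + 1, l + 1, j, hk, hl, hj => by
    rcases Nat.lt_succ_iff_lt_or_eq.1 hj with hj | rfl
    · rcases h.descWord_mul k l j (by omega) (by omega) hj with
        ⟨i, hi, c, hc⟩ | ⟨l', hl', c, hc⟩
      · refine .inl ⟨i, by omega, -c, ?_⟩
        rw [descWord_succ, mul_assoc, hc, mul_smul_comm, ← mul_assoc,
          h.anticomm i k (by omega) (by omega), ← mul_assoc]
        simp
      · exact .inr ⟨l' + 1, by omega, c, by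
          rw [descWord_succ, mul_assoc, hc, mul_smul_comm, descWord_succ]⟩
    · obtain _ | l := l
      · exact .inr ⟨0, by omega, -1, by simp [descWord, h.sq j (by omega)]⟩
      · obtain _ | k := j
        · omega
        · obtain ⟨c, hc⟩ := h.descWord_mul_far (j := k + 1) (by omega) k l (by omega)
          refine .inl ⟨k, by omega, c, ?_⟩
          rw [descWord_succ, descWord_succ, mul_assoc, mul_assoc, hc]
          simp only [mul_smul_comm, ← mul_assoc]
          rw [h.braid k (by omega)]

theorem mul_descWord_mem {k l : ℕ} (hl : l ≤ k + 1) {u : A}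
    (hu : u ∈ Submodule.span ℂ (normalWords s k : Set A)) :
    u * descWord s (k + 1) l ∈ Submodule.span ℂ (normalWords s (k + 1) : Set A) := by
  classical
  rw [normalWords, Finset.coe_mul, ← Submodule.span_mul_span]
  refine Submodule.mul_mem_mul hu (Submodule.subset_span ?_)
  exact Finset.mem_coe.2 (Finset.mem_image_of_mem _ (by simp; omega))

theorem one_mem_span_normalWords : ∀ k, (1 : A) ∈ Submodule.span ℂ (normalWords s k : Set A)
  | 0 => Submodule.subset_span (by simp [normalWords])
  | k + 1 => by
    simpa using mul_descWord_mem (Nat.zero_le _) (one_mem_span_normalWords k)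

theorem IsSpinBraid.span_mul_mem (h : IsSpinBraid m s) :
    ∀ k, k ≤ m → ∀ j < k, ∀ u ∈ Submodule.span ℂ (normalWords s k : Set A),
      u * s j ∈ Submodule.span ℂ (normalWords s k : Set A)
  | k + 1, hk, j, hj, u, hu => by
    classical
    induction hu using Submodule.span_induction with
    | zero => simp
    | add x y _ _ hx hy => rw [add_mul]; exact add_mem hx hy
    | smul c x _ hx => rw [smul_mul_assoc]; exact Submodule.smul_mem _ _ hx
    | mem x hx =>
      rw [normalWords, Finset.coe_mul] at hx
      obtain ⟨v, hv, w, hw, rfl⟩ := Set.mem_mul.1 hx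
      have hv' := Submodule.subset_span (R := ℂ) hv
      obtain ⟨l, hl, rfl⟩ := Finset.mem_image.1 (Finset.mem_coe.1 hw)
      rw [Finset.mem_range] at hl
      rw [mul_assoc]
      rcases h.descWord_mul (k + 1) l j hk (by omega) hj with
        ⟨i, hi, c, hc⟩ | ⟨l', hl', c, hc⟩
      · rw [hc, mul_smul_comm, ← mul_assoc]
        exact Submodule.smul_mem _ _ <| mul_descWord_mem (by omega) <|
          h.span_mul_mem k (by omega) i (by omega) v hv'
      · rw [hc, mul_smul_comm]
        exact Submodule.smul_mem _ _ (mul_descWord_mem hl' hv')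

theorem IsSpinBraid.span_normalWords_eq_top (h : IsSpinBraid m s)
    (hs : Algebra.adjoin ℂ (s '' Set.Iio m) = ⊤) :
    Submodule.span ℂ (normalWords s m : Set A) = ⊤ := by
  refine Submodule.eq_top_iff'.2 fun x ↦ ?_
  suffices ∀ u ∈ Submodule.span ℂ (normalWords s m : Set A),
      u * x ∈ Submodule.span ℂ (normalWords s m : Set A) by
    simpa using this 1 (one_mem_span_normalWords m)
  have hx : x ∈ Algebra.adjoin ℂ (s '' Set.Iio m) := hs ▸ Algebra.mem_top
  induction hx using Algebra.adjoin_induction with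
  | mem x hx =>
    obtain ⟨j, hj, rfl⟩ := hx
    exact h.span_mul_mem m le_rfl j hj
  | algebraMap r =>
    intro u hu
    rw [← Algebra.commutes, ← Algebra.smul_def]
    exact Submodule.smul_mem _ _ hu
  | add x y _ _ hx hy => exact fun u hu ↦ by rw [mul_add]; exact add_mem (hx u hu) (hy u hu)
  | mul x y _ _ hx hy => exact fun u hu ↦ by rw [← mul_assoc]; exact hy _ (hx u hu)

end SpanningWords

section Relations

variable {A : Type*} [Ring A]

theorem mul_eq_neg_mul_of_sq {a b : A} (ha : a * a = -1) (hb : b * b = -1)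
    (hab : (a * b) ^ 2 = -1) : b * a = -(a * b) := by
  have h : a * ((a * b) ^ 2) * b = (a * a) * (b * a) * (b * b) := by noncomm_ring
  rw [hab, ha, hb] at h
  simpa using h.symm

theorem braid_of_sq {a b : A} (ha : a * a = -1) (hb : b * b = -1)
    (hab : (a * b) ^ 3 = -1) : a * b * a = b * a * b := by
  have h : (a * b) ^ 3 * (b * a * b) = a * b * a * (b * (a * (b * b) * a) * b) := by
    noncomm_ring
  rw [hab, hb] at h
  simp only [mul_neg, mul_one, neg_mul, one_mul, ha, hb, neg_neg] at h
  exact (neg_injective h).symm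

theorem isUnit_of_mul_self_eq_neg_one {a : A} (ha : a * a = -1) : IsUnit a :=
  isUnit_iff_exists.2 ⟨-a, by rw [mul_neg, ha, neg_neg], by rw [neg_mul, ha, neg_neg]⟩

end Relations

section Generators

variable (n : ℕ)

/-- The generator `ςᵢ` of `𝒜ₙ`. -/
noncomputable def gen (i : Fin (n - 1)) : AAlg n :=
  RingQuot.mkAlgHom ℂ (ARel n) (FreeAlgebra.ι ℂ i)

variable {n}

theorem gen_mul_self (i : Fin (n - 1)) : gen n i * gen n i = -1 := by
  simpa [gen, sq] using RingQuot.mkAlgHom_rel ℂ (ARel.sq i)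

theorem gen_mul_gen_sq (i j : Fin (n - 1)) (h : (i : ℕ) + 2 ≤ j ∨ (j : ℕ) + 2 ≤ i) :
    (gen n i * gen n j) ^ 2 = -1 := by
  simpa [gen] using RingQuot.mkAlgHom_rel ℂ (ARel.far i j h)

theorem gen_mul_gen_cube (i j : Fin (n - 1)) (h : (j : ℕ) = i + 1) :
    (gen n i * gen n j) ^ 3 = -1 := by
  simpa [gen] using RingQuot.mkAlgHom_rel ℂ (ARel.adj i j h)

theorem adjoin_range_gen : Algebra.adjoin ℂ (Set.range (gen n)) = ⊤ := by
  have : Set.range (gen n) =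
      RingQuot.mkAlgHom ℂ (ARel n) '' Set.range (FreeAlgebra.ι ℂ) := by
    rw [← Set.range_comp]; rfl
  rw [this, ← AlgHom.map_adjoin, FreeAlgebra.adjoin_range_ι, Algebra.map_top,
    AlgHom.range_eq_top]
  exact RingQuot.mkAlgHom_surjective ℂ _

/-- The universal property of `𝒜ₙ`. -/
theorem exists_algHom {B : Type*} [Ring B] [Algebra ℂ B] (f : Fin (n - 1) → B)
    (hsq : ∀ i, f i ^ 2 = -1)
    (hfar : ∀ i j : Fin (n - 1), (i : ℕ) + 2 ≤ j ∨ (j : ℕ) + 2 ≤ i → (f i * f j) ^ 2 = -1)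
    (hadj : ∀ i j : Fin (n - 1), (j : ℕ) = i + 1 → (f i * f j) ^ 3 = -1) :
    ∃ φ : AAlg n →ₐ[ℂ] B, ∀ i, φ (gen n i) = f i := by
  refine ⟨RingQuot.liftAlgHom ℂ ⟨FreeAlgebra.lift ℂ f, ?_⟩, fun i ↦ ?_⟩
  · rintro _ _ (i | ⟨i, j, h⟩ | ⟨i, j, h⟩)
    · simpa using hsq i
    · simpa using hfar i j h
    · simpa using hadj i j h
  · simp [gen]

variable (n) in
/-- The generators of `𝒜ₙ` as a sequence, extended by zero. -/
noncomputable def genSeq (i : ℕ) : AAlg n :=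
  if h : i < n - 1 then gen n ⟨i, h⟩ else 0

theorem genSeq_of_lt {i : ℕ} (h : i < n - 1) : genSeq n i = gen n ⟨i, h⟩ := dif_pos h

variable (n) in
theorem isSpinBraid_genSeq : IsSpinBraid (n - 1) (genSeq n) where
  sq i hi := by rw [genSeq_of_lt hi, gen_mul_self]
  anticomm i j hij hj := by
    rw [genSeq_of_lt hj, genSeq_of_lt (by omega : i < n - 1)]
    exact mul_eq_neg_mul_of_sq (gen_mul_self _) (gen_mul_self _) (gen_mul_gen_sq _ _ (.inl hij))
  braid i hi := by
    rw [genSeq_of_lt hi, genSeq_of_lt (by omega : i < n - 1)]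
    exact braid_of_sq (gen_mul_self _) (gen_mul_self _) (gen_mul_gen_cube _ _ rfl)

variable (n) in
theorem span_normalWords_genSeq :
    Submodule.span ℂ (normalWords (genSeq n) (n - 1) : Set (AAlg n)) = ⊤ := by
  refine (isSpinBraid_genSeq n).span_normalWords_eq_top ?_
  rw [← adjoin_range_gen]
  congr 1
  ext x
  constructor
  · rintro ⟨i, hi, rfl⟩
    exact ⟨⟨i, hi⟩, (genSeq_of_lt hi).symm⟩
  · rintro ⟨i, rfl⟩
    exact ⟨i, i.2, genSeq_of_lt i.2⟩

end Generators

section Nontrivial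

/-- A bilinear form whose symmetrization is minus the Cartan matrix of type `A`. -/
noncomputable def cartanForm (m : ℕ) : LinearMap.BilinForm ℂ (Fin m → ℂ) :=
  Matrix.toBilin' (Matrix.of fun i j : Fin m ↦
    if i = j then -1 else if (j : ℕ) = i + 1 then 1 else 0)

theorem cartanForm_single (m : ℕ) (i j : Fin m) :
    cartanForm m (Pi.single i 1) (Pi.single j 1) =
      if i = j then -1 else if (j : ℕ) = i + 1 then 1 else 0 := by
  rw [cartanForm, Matrix.toBilin'_single, Matrix.of_apply]

/-- `𝒜ₙ` has a Clifford algebra as a nonzero quotient. -/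
instance nontrivial_aAlg (n : ℕ) : Nontrivial (AAlg n) := by
  let Q : QuadraticForm ℂ (Fin (n - 1) → ℂ) := (cartanForm (n - 1)).toQuadraticMap
  let c (i : Fin (n - 1)) : CliffordAlgebra Q := CliffordAlgebra.ι Q (Pi.single i 1)
  have hsq (i) : c i * c i = -1 := by
    simp [c, Q, CliffordAlgebra.ι_sq_scalar, LinearMap.BilinMap.toQuadraticMap_apply,
      cartanForm_single]
  have hpolar (i j) : c j * c i = algebraMap ℂ _ (cartanForm _ (Pi.single i 1) (Pi.single j 1) +
      cartanForm _ (Pi.single j 1) (Pi.single i 1)) - c i * c j := by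
    rw [eq_sub_iff_add_eq', CliffordAlgebra.ι_mul_ι_add_swap,
      LinearMap.BilinMap.polar_toQuadraticMap]
  have : Nontrivial (CliffordAlgebra Q) := inferInstance
  suffices ∃ φ : AAlg n →ₐ[ℂ] CliffordAlgebra Q, ∀ i, φ (gen n i) = c i by
    obtain ⟨φ, -⟩ := this
    exact φ.toRingHom.domain_nontrivial
  refine exists_algHom c (fun i ↦ by rw [sq, hsq]) (fun i j hij ↦ ?_) (fun i j hij ↦ ?_)
  · have h : c j * c i = -(c i * c j) := by
      rw [hpolar, cartanForm_single, cartanForm_single, if_neg (by omega), if_neg (by omega),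
        if_neg (by omega), if_neg (by omega)]
      simp
    calc (c i * c j) ^ 2 = c i * (c j * c i) * c j := by noncomm_ring
      _ = -((c i * c i) * (c j * c j)) := by rw [h]; noncomm_ring
      _ = -1 := by simp [hsq]
  · have h : c j * c i = 1 - c i * c j := by
      rw [hpolar, cartanForm_single, cartanForm_single, if_neg (by omega), if_pos hij,
        if_neg (by omega), if_neg (by omega)]
      simp
    have h2 : (c i * c j) ^ 2 = c i * c j - 1 := by
      calc (c i * c j) ^ 2 = c i * (c j * c i) * c j := by noncomm_ring
        _ = c i * c j - (c i * c i) * (c j * c j) := by rw [h]; noncomm_ring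
        _ = c i * c j - 1 := by simp [hsq]
    rw [pow_succ, h2, sub_mul, ← sq, h2]
    noncomm_ring

end Nontrivial

section LowerBound

open Equiv

/-- The twisted diagonal embedding of `𝒜_{m+1}` into the group algebra of the symmetric group with
coefficients in `𝒜_{m+1}`. -/
theorem exists_twistedDiagonal (m : ℕ) :
    ∃ φ : AAlg (m + 1) →ₐ[ℂ] MonoidAlgebra (AAlg (m + 1)) (Perm (Fin (m + 1))),
      ∀ i : Fin m, φ (gen (m + 1) i) =
        MonoidAlgebra.single (swap i.castSucc i.succ) (gen (m + 1) i) := by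
  have hneg : (MonoidAlgebra.single 1 (-1) :
      MonoidAlgebra (AAlg (m + 1)) (Perm (Fin (m + 1)))) = -1 := by
    rw [MonoidAlgebra.single_neg, MonoidAlgebra.one_def]
  refine exists_algHom (n := m + 1)
    (fun i : Fin m ↦ MonoidAlgebra.single (swap i.castSucc i.succ) (gen (m + 1) i))
    (fun i ↦ ?_) (fun i j hij ↦ ?_) (fun i j hij ↦ ?_)
  · rw [MonoidAlgebra.single_pow, sq, sq, swap_mul_self, gen_mul_self, hneg]
  · rw [MonoidAlgebra.single_mul_single, MonoidAlgebra.single_pow, gen_mul_gen_sq i j hij, ← hneg]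
    congr 1
    rw [(Perm.disjoint_swap_swap (by simp [Fin.ext_iff]; omega)).commute.mul_pow, sq, sq,
      swap_mul_self, swap_mul_self, one_mul]
  · rw [MonoidAlgebra.single_mul_single, MonoidAlgebra.single_pow, gen_mul_gen_cube i j hij,
      ← hneg]
    congr 1
    have hj : Fin.castSucc j = Fin.succ i := Fin.ext hij
    have h3 : (swap (Fin.castSucc i) (Fin.succ i) *
        swap (Fin.castSucc j) (Fin.succ j)).IsThreeCycle := by
      rw [hj, swap_comm (Fin.castSucc i)]
      apply Perm.isThreeCycle_swap_mul_swap_same <;> simp [Fin.ext_iff] <;> omega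
    rw [← h3.orderOf, pow_orderOf_eq_one]

theorem exists_isUnit_of_perm {m : ℕ}
    (φ : AAlg (m + 1) →ₐ[ℂ] MonoidAlgebra (AAlg (m + 1)) (Perm (Fin (m + 1))))
    (hφ : ∀ i : Fin m, φ (gen (m + 1) i) =
      MonoidAlgebra.single (swap i.castSucc i.succ) (gen (m + 1) i))
    (w : Perm (Fin (m + 1))) :
    ∃ b u : AAlg (m + 1), IsUnit u ∧ φ b = MonoidAlgebra.single w u := by
  have hw : w ∈ Submonoid.closure (Set.range fun i : Fin m ↦ swap i.castSucc i.succ) := by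
    rw [Perm.mclosure_swap_castSucc_succ]; trivial
  induction hw using Submonoid.closure_induction with
  | mem w hw =>
    obtain ⟨i, rfl⟩ := hw
    exact ⟨gen (m + 1) i, gen (m + 1) i,
      isUnit_of_mul_self_eq_neg_one (gen_mul_self (n := m + 1) i), hφ i⟩
  | one => exact ⟨1, 1, isUnit_one, by rw [map_one, MonoidAlgebra.one_def]⟩
  | mul w v _ _ hw hv =>
    obtain ⟨b, u, hu, hb⟩ := hw
    obtain ⟨b', u', hu', hb'⟩ := hv
    exact ⟨b * b', u * u', hu.mul hu', by
      rw [map_mul, hb, hb', MonoidAlgebra.single_mul_single]⟩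

theorem factorial_le_finrank (m : ℕ) [FiniteDimensional ℂ (AAlg (m + 1))] :
    (m + 1).factorial ≤ Module.finrank ℂ (AAlg (m + 1)) := by
  obtain ⟨φ, hφ⟩ := exists_twistedDiagonal m
  choose b u hu hb using exists_isUnit_of_perm φ hφ
  have hli : LinearIndependent ℂ b := by
    rw [Fintype.linearIndependent_iff]
    intro g hg w
    have h := congrArg (fun x ↦ (φ x).coeff w) hg
    simp [hb, Finsupp.single_apply] at h
    exact h.resolve_right (hu w).ne_zero
  simpa [Fintype.card_perm] using hli.fintype_card_le_finrank

end LowerBound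

theorem aAlg_finrank (n : ℕ) (hn : 2 ≤ n) :
    FiniteDimensional ℂ (AAlg n) ∧ Module.finrank ℂ (AAlg n) = n.factorial := by
  obtain ⟨m, rfl⟩ : ∃ m, n = m + 1 := ⟨n - 1, by omega⟩
  have htop := span_normalWords_genSeq (m + 1)
  have hfin : FiniteDimensional ℂ (AAlg (m + 1)) :=
    Module.finite_def.2 ⟨_, htop⟩
  refine ⟨hfin, le_antisymm ?_ (factorial_le_finrank m)⟩
  rw [← finrank_top ℂ (AAlg (m + 1)), ← htop]
  exact (finrank_span_finset_le_card _).trans (card_normalWords_le _ _)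

end SpinSymAlgebra
end

section
/- Let n ≥ 2. The algebra ℬ_n is a finite-dimensional ℂ-algebra of dimension 2^n·n!. -/
/-!
STATEMENT 10: for `n ≥ 2`, the algebra `ℬₙ` — the quotient of the free
ℂ-algebra on generators `ω₀, ω₁, …, ω_{n−1}` by the two-sided ideal generated
by `ωᵢ² − 1` (`0 ≤ i ≤ n−1`), `(ωᵢω_{i+1})³ − 1` (`1 ≤ i ≤ n−2`),
`(ωᵢωⱼ)² − 1` (`|i−j| ≥ 2`) and `(ω₀ω₁)⁴ + 1` — is a finite-dimensional
ℂ-algebra of dimension `2ⁿ·n!`.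
(The quotient is realized as `RingQuot` of the relation identifying each of
the defining expressions with `1`, resp. `−1`.)
-/

namespace HyperoctahedralAlgebra

/-- The defining relations of `ℬₙ`; the generator `ωᵢ` is indexed by
`i : Fin n` (so `ω₀` corresponds to `i = 0`). -/
inductive BRel (n : ℕ) : FreeAlgebra ℂ (Fin n) → FreeAlgebra ℂ (Fin n) → Prop
  | sq (i : Fin n) : BRel n (FreeAlgebra.ι ℂ i ^ 2) 1
  | braid (i j : Fin n) (h1 : 1 ≤ (i : ℕ)) (h2 : (j : ℕ) = (i : ℕ) + 1) :
      BRel n ((FreeAlgebra.ι ℂ i * FreeAlgebra.ι ℂ j) ^ 3) 1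
  | far (i j : Fin n) (h : (i : ℕ) + 2 ≤ (j : ℕ) ∨ (j : ℕ) + 2 ≤ (i : ℕ)) :
      BRel n ((FreeAlgebra.ι ℂ i * FreeAlgebra.ι ℂ j) ^ 2) 1
  | quat (h : 2 ≤ n) :
      BRel n ((FreeAlgebra.ι ℂ (⟨0, by omega⟩ : Fin n) *
        FreeAlgebra.ι ℂ (⟨1, by omega⟩ : Fin n)) ^ 4) (-1)

/-- The algebra `ℬₙ`. -/
abbrev BAlg (n : ℕ) := RingQuot (BRel n)

section NormalForm

/-- The relations of `ℬₙ`, in braid form, for a family of elements of a ring. -/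
structure SatisfiesRel {B : Type*} [Ring B] (n : ℕ) (w : ℕ → B) : Prop where
  sq : ∀ i, i < n → w i * w i = 1
  braid : ∀ i, 1 ≤ i → i + 1 < n → w i * w (i + 1) * w i = w (i + 1) * w i * w (i + 1)
  far : ∀ i j, i + 2 ≤ j → j < n → w j * w i = w i * w j
  quat : 2 ≤ n → w 0 * w 1 * w 0 * w 1 = -(w 1 * w 0 * w 1 * w 0)

variable {B : Type*} [Ring B]

/-- The ascending product `w (i + 1) * w (i + 2) * ⋯ * w (i + m)`. -/
def ascProd (w : ℕ → B) : ℕ → ℕ → B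
  | _, 0 => 1
  | i, m + 1 => w (i + 1) * ascProd w (i + 1) m

/-- The conjugate `w i * ⋯ * w 1 * w 0 * w 1 * ⋯ * w i`. -/
def conjGen (w : ℕ → B) : ℕ → B
  | 0 => w 0
  | i + 1 => w (i + 1) * conjGen w i * w (i + 1)

namespace SatisfiesRel

variable {n : ℕ} {w : ℕ → B}

theorem mul_self_mul (h : SatisfiesRel n w) {i : ℕ} (hi : i < n) (x : B) :
    w i * (w i * x) = x := by
  rw [← mul_assoc, h.sq i hi, one_mul]

theorem far_mul (h : SatisfiesRel n w) {i j : ℕ} (hij : i + 2 ≤ j) (hj : j < n) (x : B) :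
    w j * (w i * x) = w i * (w j * x) := by
  rw [← mul_assoc, h.far i j hij hj, mul_assoc]

theorem braid_mul (h : SatisfiesRel n w) {i : ℕ} (hi : 1 ≤ i) (hn : i + 1 < n) (x : B) :
    w i * (w (i + 1) * (w i * x)) = w (i + 1) * (w i * (w (i + 1) * x)) := by
  simpa only [mul_assoc] using congrArg (· * x) (h.braid i hi hn)

theorem ascProd_comm_of_lt (h : SatisfiesRel n w) {j : ℕ} :
    ∀ (m i : ℕ), j < i → i + m < n → w j * ascProd w i m = ascProd w i m * w j
  | 0, i, _, _ => by simp [ascProd]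
  | m + 1, i, hj, hn => by
    simp only [ascProd]
    rw [← h.far_mul (by omega) (by omega), h.ascProd_comm_of_lt m (i + 1) (by omega) (by omega),
      mul_assoc]

theorem ascProd_shift (h : SatisfiesRel n w) {j : ℕ} :
    ∀ (m i : ℕ), i + 1 ≤ j → j + 1 ≤ i + m → i + m < n →
      w (j + 1) * ascProd w i m = ascProd w i m * w j
  | 0, i, _, _, _ => by omega
  | m + 1, i, h1, h2, hn => by
    rcases h1.eq_or_lt with rfl | h1
    · obtain ⟨m, rfl⟩ : ∃ l, m = l + 1 := ⟨m - 1, by omega⟩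
      simp only [ascProd]
      rw [← h.braid_mul (by omega) (by omega), h.ascProd_comm_of_lt m _ (by omega) (by omega)]
      simp only [mul_assoc]
    · simp only [ascProd]
      rw [h.far_mul (by omega) (by omega), h.ascProd_shift m (i + 1) (by omega) (by omega) (by omega),
        mul_assoc]

theorem conjGen_comm_of_gt (h : SatisfiesRel n w) {j : ℕ} (hj : j < n) :
    ∀ i : ℕ, i + 2 ≤ j → w j * conjGen w i = conjGen w i * w j
  | 0, hi => h.far 0 j hi hj
  | i + 1, hi => by
    simp only [conjGen, mul_assoc]
    rw [h.far_mul (by omega) hj, ← h.far (i + 1) j (by omega) hj, ← mul_assoc (w j),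
      h.conjGen_comm_of_gt hj i (by omega), mul_assoc]

theorem conjGen_comm_of_lt (h : SatisfiesRel n w) {j : ℕ} (hj : 1 ≤ j) :
    ∀ i : ℕ, j < i → i < n → w j * conjGen w i = conjGen w i * w j
  | 0, hi, _ => by omega
  | i + 1, hi, hn => by
    rcases (Nat.lt_succ_iff.1 hi).eq_or_lt with rfl | hi
    · obtain ⟨j, rfl⟩ : ∃ l, j = l + 1 := ⟨j - 1, by omega⟩
      have hb := h.braid (j + 1) hj hn
      have hc := h.conjGen_comm_of_gt hn j (by omega)
      simp only [conjGen, mul_assoc] at hb ⊢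
      rw [h.braid_mul hj hn, ← mul_assoc (w (j + 1 + 1)) (conjGen w j), hc, hb]
      simp only [mul_assoc]
    · simp only [conjGen, mul_assoc]
      rw [← h.far_mul (by omega) hn, h.far j (i + 1) (by omega) hn, ← mul_assoc (w j),
        h.conjGen_comm_of_lt hj i hi (by omega), mul_assoc]

theorem conjGen_anticomm (h : SatisfiesRel n w) :
    ∀ i : ℕ, i + 1 < n → w 0 * conjGen w (i + 1) = -(conjGen w (i + 1) * w 0)
  | 0, hn => by
    simpa only [conjGen, mul_assoc] using h.quat (by omega)
  | i + 1, hn => by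
    rw [conjGen, mul_assoc, ← h.far_mul (by omega) hn, ← mul_assoc (w 0),
      h.conjGen_anticomm i (by omega)]
    simp only [mul_assoc, neg_mul, mul_neg]
    rw [h.far 0 (i + 1 + 1) (by omega) hn]

theorem exists_mul_eq (h : SatisfiesRel n w) {j i m : ℕ} (hj : 1 ≤ j) (hjm : j ≤ i + m)
    (hn : i + m < n) :
    ∃ i' m' a, i' + m' = i + m ∧ w j * conjGen w i = conjGen w i' * w j ∧
      w j * ascProd w i m = ascProd w i' m' * a ∧ (a = 1 ∨ ∃ l, l < i + m ∧ a = w l) := by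
  rcases lt_trichotomy j i with hji | rfl | hji
  · exact ⟨i, m, w j, rfl, h.conjGen_comm_of_lt hj i hji (by omega),
      h.ascProd_comm_of_lt m i hji hn, .inr ⟨j, by omega, rfl⟩⟩
  · obtain ⟨j, rfl⟩ : ∃ l, j = l + 1 := ⟨j - 1, by omega⟩
    refine ⟨j, m + 1, 1, by omega, ?_, by simp [ascProd], .inl rfl⟩
    simp only [conjGen, mul_assoc]
    rw [h.mul_self_mul (by omega)]
  · obtain ⟨m, rfl⟩ : ∃ l, m = l + 1 := ⟨m - 1, by omega⟩
    rcases (Nat.succ_le_iff.2 hji).eq_or_lt with rfl | hji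
    · refine ⟨i + 1, m, 1, by omega, ?_, ?_, .inl rfl⟩
      · simp only [conjGen, mul_assoc, Nat.succ_eq_add_one]
        rw [h.sq _ (by omega), mul_one]
      · rw [ascProd, h.mul_self_mul (by omega), mul_one]
    · obtain ⟨j, rfl⟩ : ∃ l, j = l + 1 := ⟨j - 1, by omega⟩
      exact ⟨i, m + 1, w j, rfl, h.conjGen_comm_of_gt (by omega) i (by omega),
        h.ascProd_shift _ i (by omega) hjm hn, .inr ⟨j, by omega, rfl⟩⟩

/-- The span of the normal forms in the first `k` generators is stable under left
multiplication by these generators. -/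
theorem exists_finset (K : Type*) [Field K] [Algebra K B] (h : SatisfiesRel n w) :
    ∀ k ≤ n, ∃ s : Finset B, s.card ≤ 2 ^ k * k.factorial ∧ 1 ∈ Submodule.span K (s : Set B) ∧
      ∀ j < k, ∀ x ∈ Submodule.span K (s : Set B), w j * x ∈ Submodule.span K (s : Set B)
  | 0, _ => ⟨{1}, by simp, Submodule.subset_span (by simp), by simp⟩
  | k + 1, hk => by
    classical
    obtain ⟨s, hcard, h1, hs⟩ := h.exists_finset K k (by omega)
    let rep : Fin (k + 1) × Bool → B := fun p =>
      (if p.2 then conjGen w p.1 else 1) * ascProd w p.1 (k - p.1)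
    let s' : Finset B := (Finset.univ ×ˢ s).image fun q => rep q.1 * q.2
    have hrep : ∀ p, ∀ y ∈ Submodule.span K (s : Set B),
        rep p * y ∈ Submodule.span K (s' : Set B) := by
      intro p y hy
      induction hy using Submodule.span_induction with
      | mem y hy =>
        refine Submodule.subset_span (Finset.mem_coe.2 (Finset.mem_image.2 ⟨(p, y), ?_, rfl⟩))
        simpa using hy
      | zero => simp
      | add a b _ _ ha hb => rw [mul_add]; exact add_mem ha hb
      | smul c a _ ha => rw [mul_smul_comm]; exact Submodule.smul_mem _ _ ha
    have hasc : ∀ i m, i + m = k → ∀ y ∈ Submodule.span K (s : Set B),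
        ascProd w i m * y ∈ Submodule.span K (s' : Set B) := by
      rintro i m rfl y hy
      simpa [rep] using hrep (⟨i, by omega⟩, false) y hy
    have hconj : ∀ i m, i + m = k → ∀ y ∈ Submodule.span K (s : Set B),
        conjGen w i * (ascProd w i m * y) ∈ Submodule.span K (s' : Set B) := by
      rintro i m rfl y hy
      simpa [rep, mul_assoc] using hrep (⟨i, by omega⟩, true) y hy
    refine ⟨s', ?_, ?_, ?_⟩
    · calc s'.card ≤ (Finset.univ ×ˢ s : Finset ((Fin (k + 1) × Bool) × B)).card :=
            Finset.card_image_le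
        _ = (k + 1) * 2 * s.card := by simp [Finset.card_product]
        _ ≤ (k + 1) * 2 * (2 ^ k * k.factorial) := Nat.mul_le_mul_left _ hcard
        _ = 2 ^ (k + 1) * (k + 1).factorial := by rw [Nat.factorial_succ]; ring
    · simpa [ascProd] using hasc k 0 rfl 1 h1
    · intro j hj x hx
      induction hx using Submodule.span_induction with
      | zero => simp
      | add a b _ _ ha hb => rw [mul_add]; exact add_mem ha hb
      | smul c a _ ha => rw [mul_smul_comm]; exact Submodule.smul_mem _ _ ha
      | mem x hx =>
        obtain ⟨⟨⟨⟨i, hi⟩, b⟩, y⟩, hy, rfl⟩ := Finset.mem_image.1 (Finset.mem_coe.1 hx)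
        replace hy : y ∈ Submodule.span K (s : Set B) :=
          Submodule.subset_span (Finset.mem_coe.2 (Finset.mem_product.1 hy).2)
        obtain ⟨m, rfl⟩ : ∃ m, k = i + m := ⟨k - i, by omega⟩
        rcases Nat.eq_zero_or_pos j with rfl | hj0
        · rcases Nat.eq_zero_or_pos i with rfl | hi0
          · cases b
            · simpa [rep, mul_assoc, conjGen] using hconj 0 m rfl y hy
            · have := hasc 0 m rfl y hy
              simpa [rep, mul_assoc, conjGen, h.mul_self_mul (show 0 < n by omega)] using this
          · have hc := h.ascProd_comm_of_lt m i hi0 (by omega)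
            have hy' := hs 0 (by omega) y hy
            cases b
            · have := hasc i m rfl _ hy'
              rw [← mul_assoc, ← hc] at this
              simpa [rep, mul_assoc] using this
            · have := hconj i m rfl _ hy'
              rw [← mul_assoc (ascProd w i m), ← hc] at this
              obtain ⟨i, rfl⟩ : ∃ l, i = l + 1 := ⟨i - 1, by omega⟩
              have ha := h.conjGen_anticomm i (by omega)
              simp only [rep, if_true, Nat.add_sub_cancel_left, ← mul_assoc] at this ⊢
              rw [ha]
              simpa using this
        · obtain ⟨i', m', a, him, hT, hP, ha⟩ :=
            h.exists_mul_eq (i := i) (m := m) hj0 (by omega) (by omega)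
          have hay : a * y ∈ Submodule.span K (s : Set B) := by
            rcases ha with rfl | ⟨l, hl, rfl⟩
            · simpa using hy
            · exact hs l hl y hy
          cases b
          · have := hasc i' m' him _ hay
            rw [← mul_assoc, ← hP] at this
            simpa [rep, mul_assoc] using this
          · have := hconj i' m' him _ hay
            rw [← mul_assoc (ascProd w i' m'), ← hP] at this
            simp only [rep, if_true, Nat.add_sub_cancel_left, ← mul_assoc] at this ⊢
            rwa [hT]

end SatisfiesRel

end NormalForm

section Generators

/-- The generators of `ℬₙ`, extended by `0` to all of `ℕ`. -/
def gen (n : ℕ) (i : ℕ) : BAlg n :=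
  if h : i < n then RingQuot.mkAlgHom ℂ (BRel n) (FreeAlgebra.ι ℂ ⟨i, h⟩) else 0

theorem quat_of_pow_eq {B : Type*} [Ring B] {s t : B} (hs : s * s = 1) (ht : t * t = 1)
    (hst : (s * t) ^ 4 = -1) : s * t * s * t = -(t * s * t * s) := by
  have hs' : ∀ x, s * (s * x) = x := fun x => by rw [← mul_assoc, hs, one_mul]
  have ht' : ∀ x, t * (t * x) = x := fun x => by rw [← mul_assoc, ht, one_mul]
  have := congrArg (· * (t * s * t * s)) hst
  simpa [pow_succ, mul_assoc, hs', ht', hs, ht] using this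

theorem gen_satisfiesRel (n : ℕ) : SatisfiesRel n (gen n) := by
  have hsq : ∀ i, i < n → gen n i * gen n i = 1 := fun i hi => by
    simpa [gen, hi, pow_two] using RingQuot.mkAlgHom_rel ℂ (BRel.sq (n := n) ⟨i, hi⟩)
  have hsq' : ∀ i, i < n → ∀ x, gen n i * (gen n i * x) = x := fun i hi x => by
    rw [← mul_assoc, hsq i hi, one_mul]
  refine ⟨hsq, fun i h1 hi => ?_, fun i j hij hj => ?_, fun hn => ?_⟩
  · have hr : (gen n i * gen n (i + 1)) ^ 3 = 1 := by
      simpa [gen, hi, show i < n by omega] using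
        RingQuot.mkAlgHom_rel ℂ (BRel.braid (n := n) ⟨i, by omega⟩ ⟨i + 1, hi⟩ h1 rfl)
    have := congrArg (· * (gen n (i + 1) * (gen n i * gen n (i + 1)))) hr
    simpa [pow_succ, mul_assoc, hsq' _ hi, hsq' i (by omega), hsq _ hi, hsq i (by omega)] using this
  · have hr : (gen n i * gen n j) ^ 2 = 1 := by
      simpa [gen, hj, show i < n by omega] using
        RingQuot.mkAlgHom_rel ℂ (BRel.far (n := n) ⟨i, by omega⟩ ⟨j, hj⟩ (.inl hij))
    have := congrArg (· * (gen n j * gen n i)) hr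
    simpa [pow_succ, mul_assoc, hsq' _ hj, hsq' i (by omega), hsq _ hj, hsq i (by omega)]
      using this.symm
  · have hr : (gen n 0 * gen n 1) ^ 4 = -1 := by
      simpa [gen, show 0 < n by omega, show 1 < n by omega] using
        RingQuot.mkAlgHom_rel ℂ (BRel.quat (n := n) hn)
    exact quat_of_pow_eq (hsq 0 (by omega)) (hsq 1 (by omega)) hr

theorem eq_top_of_gen_mul_mem {n : ℕ} (N : Submodule ℂ (BAlg n)) (h1 : 1 ∈ N)
    (hN : ∀ j < n, ∀ x ∈ N, gen n j * x ∈ N) : N = ⊤ := by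
  have key : ∀ a : FreeAlgebra ℂ (Fin n), ∀ x ∈ N, RingQuot.mkAlgHom ℂ (BRel n) a * x ∈ N := by
    intro a
    induction a using FreeAlgebra.induction with
    | grade0 r =>
      intro x hx
      rw [AlgHom.commutes, ← Algebra.smul_def]
      exact N.smul_mem _ hx
    | grade1 i => intro x hx; simpa [gen] using hN i i.2 x hx
    | mul a b ha hb => intro x hx; rw [map_mul, mul_assoc]; exact ha _ (hb _ hx)
    | add a b ha hb => intro x hx; rw [map_add, add_mul]; exact add_mem (ha _ hx) (hb _ hx)
  refine eq_top_iff.2 fun x _ => ?_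
  obtain ⟨a, rfl⟩ := RingQuot.mkAlgHom_surjective ℂ (BRel n) x
  simpa using key a 1 h1

theorem finite_and_finrank_le (n : ℕ) :
    FiniteDimensional ℂ (BAlg n) ∧ Module.finrank ℂ (BAlg n) ≤ 2 ^ n * n.factorial := by
  obtain ⟨s, hcard, h1, hs⟩ := (gen_satisfiesRel n).exists_finset ℂ n le_rfl
  have htop := eq_top_of_gen_mul_mem _ h1 hs
  refine ⟨⟨⟨s, htop⟩⟩, ?_⟩
  rw [← finrank_top, ← htop]
  exact (finrank_span_finset_le_card s).trans hcard

end Generators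

section Representation

variable {n : ℕ}

/-- Signed permutations: the index set of a basis of the regular representation. -/
abbrev SignedPerm (n : ℕ) := (Fin n → Bool) × Equiv.Perm (Fin n)

/-- The action of the Clifford generator with index `a` on a basis vector, up to sign. -/
def flipAct (a : Fin n) (x : SignedPerm n) : SignedPerm n :=
  (Function.update x.1 a (!x.1 a), x.2)

/-- The action of the transposition of `a` and `b` on a basis vector, up to sign. -/
def swapAct (a b : Fin n) (x : SignedPerm n) : SignedPerm n :=
  (x.1 ∘ Equiv.swap a b, Equiv.swap a b * x.2)

/-- The sign that comes from reordering the product of the Clifford generators `a` and `b`. -/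
def swapSign (a b : Fin n) (x : SignedPerm n) : ℂ :=
  if x.1 a && x.1 b then -1 else 1

/-- The operator through which `ω₀` acts, for `a = 0`. -/
def flipOp (a : Fin n) : Module.End ℂ (SignedPerm n → ℂ) where
  toFun f x := f (flipAct a x)
  map_add' _ _ := rfl
  map_smul' _ _ := rfl

/-- The operator through which `ω_b` acts, for `b = a + 1`. -/
def swapOp (a b : Fin n) : Module.End ℂ (SignedPerm n → ℂ) where
  toFun f x := swapSign a b x * f (swapAct a b x)
  map_add' f g := by ext x; simp [mul_add]
  map_smul' c f := by ext x; simp [mul_left_comm]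

theorem flipOp_apply (a : Fin n) (f : SignedPerm n → ℂ) (x : SignedPerm n) :
    flipOp a f x = f (flipAct a x) := rfl

theorem swapOp_apply (a b : Fin n) (f : SignedPerm n → ℂ) (x : SignedPerm n) :
    swapOp a b f x = swapSign a b x * f (swapAct a b x) := rfl

theorem flipAct_flipAct (a : Fin n) (x : SignedPerm n) : flipAct a (flipAct a x) = x := by
  simp [flipAct]

theorem swapAct_swapAct (a b : Fin n) (x : SignedPerm n) : swapAct a b (swapAct a b x) = x := by
  ext i <;> simp [swapAct]

theorem swapSign_mul_swapSign (a b : Fin n) (x : SignedPerm n) :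
    swapSign a b x * swapSign a b (swapAct a b x) = 1 := by
  simp only [swapSign, swapAct, Function.comp_apply, Equiv.swap_apply_left, Equiv.swap_apply_right]
  cases x.1 a <;> cases x.1 b <;> simp

theorem flipOp_mul_self (a : Fin n) : flipOp a * flipOp a = 1 := by
  refine LinearMap.ext fun f => funext fun x => ?_
  simp only [Module.End.mul_apply, flipOp_apply, flipAct_flipAct, Module.End.one_apply]

theorem swapOp_mul_self (a b : Fin n) : swapOp a b * swapOp a b = 1 := by
  refine LinearMap.ext fun f => funext fun x => ?_
  simp only [Module.End.mul_apply, swapOp_apply, ← mul_assoc, swapSign_mul_swapSign,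
    swapAct_swapAct, one_mul, Module.End.one_apply]

theorem swap_braid {a b c : Fin n} (hab : a ≠ b) (hbc : b ≠ c) (hac : a ≠ c) :
    Equiv.swap a b * Equiv.swap b c * Equiv.swap a b =
      Equiv.swap b c * Equiv.swap a b * Equiv.swap b c := by
  rw [Equiv.swap_mul_swap_mul_swap hab hac, Equiv.swap_comm a b, Equiv.swap_comm b c,
    Equiv.swap_mul_swap_mul_swap hbc.symm hac.symm, Equiv.swap_comm]

theorem swapOp_braid {a b c : Fin n} (hab : a ≠ b) (hbc : b ≠ c) (hac : a ≠ c) :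
    swapOp a b * swapOp b c * swapOp a b = swapOp b c * swapOp a b * swapOp b c := by
  refine LinearMap.ext fun f => funext fun x => ?_
  have hact : swapAct a b (swapAct b c (swapAct a b x)) =
      swapAct b c (swapAct a b (swapAct b c x)) := by
    have h := swap_braid hab hbc hac
    refine Prod.ext (funext fun i => ?_) ?_
    · simpa [swapAct] using congrArg (fun p : Equiv.Perm (Fin n) => x.1 (p i)) h
    · simpa [swapAct, mul_assoc] using congrArg (· * x.2) h
  simp only [Module.End.mul_apply, swapOp_apply, hact, ← mul_assoc]
  congr 1
  simp only [swapSign, swapAct, Function.comp_apply, Equiv.swap_apply_left,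
    Equiv.swap_apply_right, Equiv.swap_apply_of_ne_of_ne hac.symm hbc.symm,
    Equiv.swap_apply_of_ne_of_ne hab hac]
  cases x.1 a <;> cases x.1 b <;> cases x.1 c <;> simp

theorem swapOp_comm {a b c d : Fin n} (hac : a ≠ c) (had : a ≠ d) (hbc : b ≠ c) (hbd : b ≠ d) :
    swapOp a b * swapOp c d = swapOp c d * swapOp a b := by
  refine LinearMap.ext fun f => funext fun x => ?_
  have hcomm : Equiv.swap a b * Equiv.swap c d = Equiv.swap c d * Equiv.swap a b := by
    rw [Equiv.mul_swap_eq_swap_mul, Equiv.swap_apply_of_ne_of_ne hac.symm hbc.symm,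
      Equiv.swap_apply_of_ne_of_ne had.symm hbd.symm]
  have hact : swapAct c d (swapAct a b x) = swapAct a b (swapAct c d x) := by
    refine Prod.ext (funext fun i => ?_) ?_
    · simpa [swapAct] using congrArg (fun p : Equiv.Perm (Fin n) => x.1 (p i)) hcomm
    · simpa [swapAct, mul_assoc] using congrArg (· * x.2) hcomm.symm
  simp only [Module.End.mul_apply, swapOp_apply, hact, ← mul_assoc]
  congr 1
  simp only [swapSign, swapAct, Function.comp_apply,
    Equiv.swap_apply_of_ne_of_ne hac.symm hbc.symm, Equiv.swap_apply_of_ne_of_ne had.symm hbd.symm,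
    Equiv.swap_apply_of_ne_of_ne hac had, Equiv.swap_apply_of_ne_of_ne hbc hbd]
  ring

theorem flipOp_comm_swapOp {a b c : Fin n} (hab : a ≠ b) (hac : a ≠ c) :
    flipOp a * swapOp b c = swapOp b c * flipOp a := by
  refine LinearMap.ext fun f => funext fun x => ?_
  have hact : swapAct b c (flipAct a x) = flipAct a (swapAct b c x) := by
    refine Prod.ext (funext fun i => ?_) rfl
    have : Equiv.swap b c i = a ↔ i = a := by
      rw [Equiv.swap_apply_eq_iff, Equiv.swap_apply_of_ne_of_ne hab hac]
    simp only [swapAct, flipAct, Function.comp_apply, Function.update_apply, this,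
      Equiv.swap_apply_of_ne_of_ne hab hac]
  simp only [Module.End.mul_apply, swapOp_apply, flipOp_apply, hact]
  congr 1
  simp [swapSign, flipAct, hab.symm, hac.symm]

theorem flipOp_swapOp_quat {a b : Fin n} (hab : a ≠ b) :
    (flipOp a * swapOp a b) ^ 4 = -1 := by
  refine LinearMap.ext fun f => funext fun x => ?_
  have hact : swapAct a b (flipAct a (swapAct a b (flipAct a (swapAct a b (flipAct a
      (swapAct a b (flipAct a x))))))) = x := by
    refine Prod.ext (funext fun i => ?_) ?_
    · by_cases hia : i = a
      · subst hia; simp [swapAct, flipAct, hab.symm]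
      by_cases hib : i = b
      · subst hib; simp [swapAct, flipAct, hab.symm]
      · simp [swapAct, flipAct, hia, Equiv.swap_apply_of_ne_of_ne hia hib]
    · simp [swapAct, flipAct]
  simp only [pow_succ, pow_zero, one_mul, Module.End.mul_apply, swapOp_apply, flipOp_apply, hact,
    ← mul_assoc, LinearMap.neg_apply, Module.End.one_apply, Pi.neg_apply, ← neg_one_mul (f x)]
  congr 1
  simp only [swapSign, swapAct, flipAct, Function.comp_apply, Equiv.swap_apply_left,
    Equiv.swap_apply_right, Function.update_self, Function.update_of_ne hab.symm]
  cases x.1 a <;> cases x.1 b <;> simp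

/-- The operator through which `ω_i` acts. -/
def genOp (i : Fin n) : Module.End ℂ (SignedPerm n → ℂ) :=
  if (i : ℕ) = 0 then flipOp i else swapOp ⟨i - 1, by omega⟩ i

theorem genOp_sq (i : Fin n) : genOp i * genOp i = 1 := by
  rw [genOp]
  split_ifs
  exacts [flipOp_mul_self i, swapOp_mul_self _ i]

theorem genOp_comm {i j : Fin n} (hij : (i : ℕ) + 2 ≤ j) :
    genOp i * genOp j = genOp j * genOp i := by
  rw [genOp, genOp, if_neg (show ¬(j : ℕ) = 0 by omega)]
  split_ifs
  · apply flipOp_comm_swapOp <;> simp only [ne_eq, Fin.ext_iff] <;> omega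
  · apply swapOp_comm <;> simp only [ne_eq, Fin.ext_iff] <;> omega

theorem sq_mul_eq_one {B : Type*} [Monoid B] {s t : B} (hs : s * s = 1) (ht : t * t = 1)
    (hst : s * t = t * s) : (s * t) ^ 2 = 1 := by
  rw [(show Commute s t from hst).mul_pow, pow_two, pow_two, hs, ht, one_mul]

/-- The representation of `ℬₙ` on functions on signed permutations. -/
def rep (n : ℕ) : BAlg n →ₐ[ℂ] Module.End ℂ (SignedPerm n → ℂ) :=
  RingQuot.liftAlgHom ℂ ⟨FreeAlgebra.lift ℂ genOp, by
    intro x y hxy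
    induction hxy with
    | sq i => simp [pow_two, genOp_sq]
    | braid i j h1 h2 =>
      simp only [map_pow, map_mul, map_one, FreeAlgebra.lift_ι_apply]
      have hb : genOp i * genOp j * genOp i = genOp j * genOp i * genOp j := by
        have hi : (⟨j - 1, by omega⟩ : Fin n) = i := Fin.ext (by simp; omega)
        rw [genOp, genOp, if_neg (by omega), if_neg (by omega), hi]
        apply swapOp_braid <;> simp only [ne_eq, Fin.ext_iff] <;> omega
      calc (genOp i * genOp j) ^ 3 =
          genOp i * genOp j * genOp i * (genOp j * genOp i * genOp j) := by
            simp only [pow_succ, pow_zero, one_mul, mul_assoc]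
        _ = genOp i * (genOp j * (genOp i * genOp i) * genOp j) * genOp i := by
            rw [← hb]; simp only [mul_assoc]
        _ = 1 := by simp only [genOp_sq, mul_one]
    | far i j h =>
      simp only [map_pow, map_mul, map_one, FreeAlgebra.lift_ι_apply]
      refine sq_mul_eq_one (genOp_sq i) (genOp_sq j) ?_
      rcases h with h | h
      exacts [genOp_comm h, (genOp_comm h).symm]
    | quat h =>
      simp only [map_pow, map_mul, map_one, map_neg, FreeAlgebra.lift_ι_apply]
      exact flipOp_swapOp_quat (by simp)⟩

theorem rep_gen (i : Fin n) : rep n (gen n i) = genOp i := by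
  simp [rep, gen]

theorem flipOp_single (a : Fin n) (x : SignedPerm n) :
    flipOp a (Pi.single x 1) = Pi.single (flipAct a x) 1 := by
  ext y
  have : flipAct a y = x ↔ y = flipAct a x :=
    ⟨fun h => by rw [← h, flipAct_flipAct], fun h => by rw [h, flipAct_flipAct]⟩
  simp only [flipOp_apply, Pi.single_apply, this]

theorem swapOp_single (a b : Fin n) (x : SignedPerm n) :
    swapOp a b (Pi.single x 1) =
      swapSign a b (swapAct a b x) • Pi.single (swapAct a b x) (1 : ℂ) := by
  ext y
  have : swapAct a b y = x ↔ y = swapAct a b x :=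
    ⟨fun h => by rw [← h, swapAct_swapAct], fun h => by rw [h, swapAct_swapAct]⟩
  simp only [swapOp_apply, Pi.single_apply, this, Pi.smul_apply, smul_eq_mul]
  split_ifs with h <;> simp [h]

/-- Signed permutations are generated from the identity by the Coxeter generators. -/
theorem signedPerm_mem {m : ℕ} {R : Set (SignedPerm (m + 1))} (h1 : (fun _ => false, 1) ∈ R)
    (hflip : ∀ x ∈ R, flipAct 0 x ∈ R)
    (hswap : ∀ (i : Fin m), ∀ x ∈ R, swapAct i.castSucc i.succ x ∈ R) (x : SignedPerm (m + 1)) :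
    x ∈ R := by
  have hperm : ∀ p : Equiv.Perm (Fin (m + 1)), ∀ x ∈ R, (x.1 ∘ ⇑p⁻¹, p * x.2) ∈ R := by
    intro p
    have hp : p ∈ Submonoid.closure (Set.range fun i : Fin m => Equiv.swap i.castSucc i.succ) := by
      rw [Equiv.Perm.mclosure_swap_castSucc_succ]; trivial
    induction hp using Submonoid.closure_induction with
    | mem p hp =>
      obtain ⟨i, rfl⟩ := hp
      intro x hx
      simpa [swapAct] using hswap i x hx
    | one => intro x hx; simpa using hx
    | mul p q _ _ ihp ihq =>
      intro x hx
      simpa [mul_assoc, Function.comp_assoc] using ihp _ (ihq x hx)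
  have hflip' : ∀ a, ∀ x ∈ R, flipAct a x ∈ R := by
    intro a x hx
    convert hperm (Equiv.swap 0 a) _ (hflip _ (hperm (Equiv.swap 0 a) x hx)) using 1
    refine Prod.ext (funext fun i => ?_) (by simp [flipAct])
    have : Equiv.swap 0 a i = 0 ↔ i = a := by
      rw [Equiv.swap_apply_eq_iff, Equiv.swap_apply_left]
    simp [flipAct, Function.update_apply, this]
  have hset : ∀ (T : Finset (Fin (m + 1))) (p : Equiv.Perm (Fin (m + 1))),
      (fun i => decide (i ∈ T), p) ∈ R := by
    intro T p
    induction T using Finset.induction_on with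
    | empty => simpa using hperm p _ h1
    | insert a T ha ih =>
      convert hflip' a _ ih using 1
      refine Prod.ext (funext fun i => ?_) rfl
      by_cases hi : i = a <;> simp [flipAct, hi, ha]
  simpa using hset (Finset.univ.filter fun i => x.1 i = true) x.2

theorem le_finrank (m : ℕ) :
    2 ^ (m + 1) * (m + 1).factorial ≤ Module.finrank ℂ (BAlg (m + 1)) := by
  have := (finite_and_finrank_le (m + 1)).1
  let L : BAlg (m + 1) →ₗ[ℂ] (SignedPerm (m + 1) → ℂ) :=
    (LinearMap.applyₗ (Pi.single (fun _ => false, 1) (1 : ℂ))).comp (rep (m + 1)).toLinearMap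
  have hgen : ∀ i, ∀ f ∈ LinearMap.range L, genOp i f ∈ LinearMap.range L := by
    rintro i _ ⟨b, rfl⟩
    exact ⟨gen (m + 1) i * b, by simp [L, rep_gen]⟩
  have hsingle : ∀ x, Pi.single x (1 : ℂ) ∈ LinearMap.range L := by
    refine signedPerm_mem (R := {x | Pi.single x (1 : ℂ) ∈ LinearMap.range L}) ?_ ?_ ?_
    · exact ⟨1, by simp [L]⟩
    · intro x hx
      have := hgen 0 _ hx
      rwa [genOp, if_pos (by simp), flipOp_single] at this
    · intro i x hx
      have := hgen i.succ _ hx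
      rw [genOp, if_neg (by simp)] at this
      change swapOp i.castSucc i.succ _ ∈ _ at this
      rw [swapOp_single] at this
      refine (Submodule.smul_mem_iff _ ?_).1 this
      rw [swapSign]
      split_ifs <;> simp
  have htop : LinearMap.range L = ⊤ := by
    rw [eq_top_iff, ← (Pi.basisFun ℂ (SignedPerm (m + 1))).span_eq, Submodule.span_le]
    rintro _ ⟨x, rfl⟩
    simpa using hsingle x
  have := LinearMap.finrank_le_finrank_of_surjective (LinearMap.range_eq_top.1 htop)
  simpa [Module.finrank_fintype_fun_eq_card, Fintype.card_perm] using this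

end Representation

theorem bAlg_finrank (n : ℕ) (hn : 2 ≤ n) :
    FiniteDimensional ℂ (BAlg n) ∧ Module.finrank ℂ (BAlg n) = 2 ^ n * n.factorial := by
  obtain ⟨m, rfl⟩ : ∃ m, n = m + 1 := ⟨n - 1, by omega⟩
  exact ⟨(finite_and_finrank_le _).1, (finite_and_finrank_le _).2.antisymm (le_finrank m)⟩

end HyperoctahedralAlgebra
end

section
/- Let n ≥ 2. The algebra ℬ_n is isomorphic as a ℂ-algebra to the quotient of the group algebra ℂ[H̃_n] (Mathlib's MonoidAlgebra ℂ H̃_n) by the two-sided ideal generated by 1 + z. -/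
/-!
STATEMENT 11: for `n ≥ 2`, the algebra `ℬₙ` is isomorphic as a ℂ-algebra to
the quotient of the group algebra `ℂ[H̃ₙ]` (Mathlib's `MonoidAlgebra ℂ H̃ₙ`)
by the two-sided ideal generated by `1 + z`.
(Presented algebras and the quotient are realized via `RingQuot`.)
-/

namespace Stmt11

/-! The twisted hyperoctahedral group `H̃ₙ`. -/

inductive HGen (n : ℕ) : Type
  | s : Fin (n - 1) → HGen n
  | a : Fin n → HGen n
  | z : HGen n

variable {n : ℕ}

def S (i : Fin (n - 1)) : FreeGroup (HGen n) := FreeGroup.of (HGen.s i)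
def A (j : Fin n) : FreeGroup (HGen n) := FreeGroup.of (HGen.a j)
def Z : FreeGroup (HGen n) := FreeGroup.of (HGen.z)

def idx1 (i : Fin (n - 1)) : Fin n := ⟨(i : ℕ), by have := i.isLt; omega⟩
def idx2 (i : Fin (n - 1)) : Fin n := ⟨(i : ℕ) + 1, by have := i.isLt; omega⟩

def hRels (n : ℕ) : Set (FreeGroup (HGen n)) :=
  { w | (∃ i : Fin (n - 1), w = Z * S i * Z⁻¹ * (S i)⁻¹)
    ∨ (∃ j : Fin n, w = Z * A j * Z⁻¹ * (A j)⁻¹)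
    ∨ (w = Z ^ 2)
    ∨ (∃ i : Fin (n - 1), w = S i ^ 2)
    ∨ (∃ i j : Fin (n - 1), (j : ℕ) = (i : ℕ) + 1 ∧ w = (S i * S j) ^ 3)
    ∨ (∃ i j : Fin (n - 1), ((i : ℕ) + 2 ≤ (j : ℕ) ∨ (j : ℕ) + 2 ≤ (i : ℕ)) ∧
        w = (S i * S j) ^ 2)
    ∨ (∃ i : Fin (n - 1), w = S i * A (idx1 i) * (S i)⁻¹ * (A (idx2 i))⁻¹)
    ∨ (∃ (i : Fin (n - 1)) (j : Fin n), (j : ℕ) ≠ (i : ℕ) ∧ (j : ℕ) ≠ (i : ℕ) + 1 ∧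
        w = S i * A j * (S i)⁻¹ * (A j)⁻¹)
    ∨ (∃ j : Fin n, w = A j ^ 2 * Z⁻¹)
    ∨ (∃ i j : Fin n, i ≠ j ∧ w = A i * A j * (A i)⁻¹ * (A j)⁻¹ * Z⁻¹) }

abbrev HTilde (n : ℕ) := PresentedGroup (hRels n)

/-! The algebra `ℬₙ`. -/

inductive BRel (n : ℕ) : FreeAlgebra ℂ (Fin n) → FreeAlgebra ℂ (Fin n) → Prop
  | sq (i : Fin n) : BRel n (FreeAlgebra.ι ℂ i ^ 2) 1
  | braid (i j : Fin n) (h1 : 1 ≤ (i : ℕ)) (h2 : (j : ℕ) = (i : ℕ) + 1) :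
      BRel n ((FreeAlgebra.ι ℂ i * FreeAlgebra.ι ℂ j) ^ 3) 1
  | far (i j : Fin n) (h : (i : ℕ) + 2 ≤ (j : ℕ) ∨ (j : ℕ) + 2 ≤ (i : ℕ)) :
      BRel n ((FreeAlgebra.ι ℂ i * FreeAlgebra.ι ℂ j) ^ 2) 1
  | quat (h : 2 ≤ n) :
      BRel n ((FreeAlgebra.ι ℂ (⟨0, by omega⟩ : Fin n) *
        FreeAlgebra.ι ℂ (⟨1, by omega⟩ : Fin n)) ^ 4) (-1)

abbrev BAlg (n : ℕ) := RingQuot (BRel n)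

/-- The relation on `ℂ[H̃ₙ]` identifying `1 + z` with `0`; its `RingQuot` is
the quotient by the two-sided ideal generated by `1 + z`. -/
def QRelH (n : ℕ) :
    MonoidAlgebra ℂ (HTilde n) → MonoidAlgebra ℂ (HTilde n) → Prop :=
  fun x y =>
    x = 1 + MonoidAlgebra.of ℂ (HTilde n) (PresentedGroup.of (HGen.z)) ∧ y = 0

section Relations

variable {R : Type*} [Ring R]

theorem braid_of_mul_pow_three {x y : R} (hx : x * x = 1) (hy : y * y = 1)
    (h : (x * y) ^ 3 = 1) : x * y * x = y * x * y := by
  calc x * y * x = (x * y * x) * (y * (x * (y * y) * x) * y) := by simp [hx, hy]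
    _ = (x * y) ^ 3 * (y * x * y) := by noncomm_ring
    _ = y * x * y := by rw [h, one_mul]

theorem mul_pow_three_of_braid {x y : R} (hx : x * x = 1) (hy : y * y = 1)
    (h : x * y * x = y * x * y) : (x * y) ^ 3 = 1 := by
  calc (x * y) ^ 3 = (x * y * x) * (y * x * y) := by noncomm_ring
    _ = y * (x * (y * y) * x) * y := by rw [h]; noncomm_ring
    _ = 1 := by simp [hx, hy]

theorem commute_of_mul_pow_two {x y : R} (hx : x * x = 1) (hy : y * y = 1)
    (h : (x * y) ^ 2 = 1) : Commute x y := by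
  calc x * y = x * y * (x * (y * y) * x) := by simp [hx, hy]
    _ = (x * y) ^ 2 * (y * x) := by simp only [pow_two, mul_assoc]
    _ = y * x := by rw [h, one_mul]

/-- The elements obtained from `a` by successive conjugation with the involutions `w 1, w 2, …`. -/
def conjSeq (w : ℕ → R) (a : R) : ℕ → R
  | 0 => a
  | k + 1 => w (k + 1) * conjSeq w a k * w (k + 1)

variable {n : ℕ} {w : ℕ → R} {a : R}

theorem conjSeq_mul_self (hw : ∀ k < n, w k * w k = 1) (ha : a * a = -1) :
    ∀ k < n, conjSeq w a k * conjSeq w a k = -1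
  | 0, _ => ha
  | k + 1, hk => by
    have ih := conjSeq_mul_self hw ha k (by omega)
    have h := hw (k + 1) hk
    simp only [conjSeq]
    generalize conjSeq w a k = x at *
    generalize w (k + 1) = t at *
    calc t * x * t * (t * x * t) = t * x * (t * t) * x * t := by noncomm_ring
      _ = t * (x * x) * t := by rw [h]; noncomm_ring
      _ = -1 := by rw [ih, mul_neg_one, neg_mul, h]

theorem commute_conjSeq_of_lt
    (hfar : ∀ i j, i + 2 ≤ j → j < n → Commute (w i) (w j))
    (ha : ∀ j, 2 ≤ j → j < n → Commute (w j) a) :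
    ∀ j i, j + 2 ≤ i → i < n → Commute (w i) (conjSeq w a j)
  | 0, i, h, hi => ha i (by omega) hi
  | j + 1, i, h, hi => by
    have ih := commute_conjSeq_of_lt hfar ha j i (by omega) hi
    have hc := (hfar (j + 1) i (by omega) hi).symm
    exact (hc.mul_right ih).mul_right hc

theorem commute_conjSeq_of_gt
    (hbraid : ∀ i, 1 ≤ i → i + 1 < n → w i * w (i + 1) * w i = w (i + 1) * w i * w (i + 1))
    (hfar : ∀ i j, i + 2 ≤ j → j < n → Commute (w i) (w j))
    (ha : ∀ j, 2 ≤ j → j < n → Commute (w j) a)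
    (i : ℕ) (hi : 1 ≤ i) (j : ℕ) (hij : i + 1 ≤ j) (hj : j < n) :
    Commute (w i) (conjSeq w a j) := by
  induction j, hij using Nat.le_induction with
  | base =>
    obtain ⟨i, rfl⟩ : ∃ k, i = k + 1 := ⟨i - 1, by omega⟩
    have hb := hbraid (i + 1) hi hj
    have hc : w (i + 2) * conjSeq w a i = conjSeq w a i * w (i + 2) :=
      commute_conjSeq_of_lt hfar ha i (i + 2) le_rfl hj
    simp only [conjSeq, Commute, SemiconjBy]
    generalize conjSeq w a i = x at *
    generalize w (i + 1) = s at *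
    change s * w (i + 2) * s = w (i + 2) * s * w (i + 2) at hb
    change s * (w (i + 2) * (s * x * s) * w (i + 2)) = w (i + 2) * (s * x * s) * w (i + 2) * s
    generalize w (i + 2) = t at *
    calc s * (t * (s * x * s) * t) = (s * t * s) * x * (s * t) := by noncomm_ring
      _ = t * s * (t * x) * s * t := by rw [hb]; noncomm_ring
      _ = t * s * x * (t * s * t) := by rw [hc]; noncomm_ring
      _ = t * (s * x * s) * t * s := by rw [← hb]; noncomm_ring
  | succ j hij ih =>
    have hc := hfar i (j + 1) (by omega) hj
    exact (hc.mul_right (ih (by omega))).mul_right hc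

theorem conjSeq_anticomm
    (hbraid : ∀ i, 1 ≤ i → i + 1 < n → w i * w (i + 1) * w i = w (i + 1) * w i * w (i + 1))
    (hfar : ∀ i j, i + 2 ≤ j → j < n → Commute (w i) (w j))
    (ha : ∀ j, 2 ≤ j → j < n → Commute (w j) a)
    (h01 : a * (w 1 * a * w 1) = -(w 1 * a * w 1 * a)) :
    ∀ i j, i < j → j < n → conjSeq w a i * conjSeq w a j = -(conjSeq w a j * conjSeq w a i)
  | 0, j, hij, hj => by
    induction j, hij using Nat.le_induction with
    | base => exact h01
    | succ j hij ih =>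
      have ih := ih (by omega)
      have hc : w (j + 1) * a = a * w (j + 1) := ha (j + 1) (by omega) hj
      simp only [conjSeq] at *
      generalize conjSeq w a j = x at *
      generalize w (j + 1) = t at *
      calc a * (t * x * t) = a * t * x * t := by noncomm_ring
        _ = t * (a * x) * t := by rw [← hc]; noncomm_ring
        _ = -(t * x * (a * t)) := by rw [ih]; noncomm_ring
        _ = -(t * x * t * a) := by rw [← hc]; noncomm_ring
  | i + 1, j, hij, hj => by
    have ih := conjSeq_anticomm hbraid hfar ha h01 i j (by omega) hj
    have hc : w (i + 1) * conjSeq w a j = conjSeq w a j * w (i + 1) :=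
      commute_conjSeq_of_gt hbraid hfar ha (i + 1) (by omega) j hij hj
    simp only [conjSeq]
    generalize conjSeq w a j = x at *
    generalize conjSeq w a i = y at *
    generalize w (i + 1) = t at *
    calc t * y * t * x = t * y * (t * x) := by noncomm_ring
      _ = t * (y * x) * t := by rw [hc]; noncomm_ring
      _ = -((t * x) * y * t) := by rw [ih]; noncomm_ring
      _ = -(x * (t * y * t)) := by rw [hc]; noncomm_ring

end Relations

/-- The sequence `ω` satisfies the defining relations of `ℬₙ` (in positions below `n`). -/
structure IsBFamily {R : Type*} [Ring R] (n : ℕ) (ω : ℕ → R) : Prop where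
  mul_self : ∀ k < n, ω k * ω k = 1
  braid : ∀ i, 1 ≤ i → i + 1 < n → ω i * ω (i + 1) * ω i = ω (i + 1) * ω i * ω (i + 1)
  commute : ∀ i j, i + 2 ≤ j → j < n → Commute (ω i) (ω j)
  quat : (ω 0 * ω 1) ^ 4 = -1

section BAlg

variable {R : Type*} [Ring R] [Algebra ℂ R] {n : ℕ}

/-- The generator `ω_k` of `ℬₙ`, extended by `1` to all natural numbers. -/
noncomputable def omega (n k : ℕ) : BAlg n :=
  if h : k < n then RingQuot.mkAlgHom ℂ (BRel n) (FreeAlgebra.ι ℂ ⟨k, h⟩) else 1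

theorem omega_of_lt {k : ℕ} (h : k < n) :
    omega n k = RingQuot.mkAlgHom ℂ (BRel n) (FreeAlgebra.ι ℂ ⟨k, h⟩) := dif_pos h

theorem isBFamily_map_omega (hn : 2 ≤ n) (f : BAlg n →ₐ[ℂ] R) :
    IsBFamily n (fun k => f (omega n k)) := by
  have rel {x y} (h : BRel n x y) : (f.comp (RingQuot.mkAlgHom ℂ (BRel n))) x =
      (f.comp (RingQuot.mkAlgHom ℂ (BRel n))) y :=
    congrArg f (RingQuot.mkAlgHom_rel ℂ h)
  have gen {k : ℕ} (h : k < n) : f (omega n k) =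
      (f.comp (RingQuot.mkAlgHom ℂ (BRel n))) (FreeAlgebra.ι ℂ ⟨k, h⟩) := by
    rw [omega_of_lt h, AlgHom.comp_apply]
  have sq (k : ℕ) (h : k < n) : f (omega n k) * f (omega n k) = 1 := by
    simpa only [gen h, map_pow, map_mul, map_one, pow_two] using rel (.sq ⟨k, h⟩)
  refine ⟨sq, fun i hi hn => ?_, fun i j h hj => ?_, ?_⟩
  · refine braid_of_mul_pow_three (sq _ (by omega)) (sq _ hn) ?_
    simpa only [gen hn, gen (by omega : i < n), map_pow, map_mul, map_one] using
      rel (.braid ⟨i, by omega⟩ ⟨i + 1, hn⟩ hi rfl)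
  · refine commute_of_mul_pow_two (sq _ (by omega)) (sq _ hj) ?_
    simpa only [gen hj, gen (by omega : i < n), map_pow, map_mul, map_one] using
      rel (.far ⟨i, by omega⟩ ⟨j, hj⟩ (Or.inl h))
  · simpa only [gen (by omega : 0 < n), gen (by omega : 1 < n), map_pow, map_mul, map_neg,
      map_one] using rel (.quat hn)

/-- The algebra map out of `ℬₙ` given by a family satisfying its relations. -/
noncomputable def bAlgLift {ω : ℕ → R} (h : IsBFamily n ω) : BAlg n →ₐ[ℂ] R :=
  RingQuot.liftAlgHom ℂ ⟨FreeAlgebra.lift ℂ (fun i : Fin n => ω i), by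
    rintro _ _ (i | ⟨i, j, h1, h2⟩ | ⟨i, j, hij⟩ | hn)
    · simpa [pow_two] using h.mul_self i i.isLt
    · have hj := j.isLt
      simpa [h2] using mul_pow_three_of_braid (h.mul_self i i.isLt)
        (h.mul_self (i + 1) (by omega)) (h.braid i h1 (by omega))
    · have hc : Commute (ω i) (ω j) := by
        rcases hij with hij | hij
        · exact h.commute _ _ hij j.isLt
        · exact (h.commute _ _ hij i.isLt).symm
      rw [map_pow, map_mul, map_one, FreeAlgebra.lift_ι_apply, FreeAlgebra.lift_ι_apply,
        hc.mul_pow, pow_two, pow_two, h.mul_self i i.isLt, h.mul_self j j.isLt, one_mul]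
    · simpa using h.quat⟩

theorem bAlgLift_omega {ω : ℕ → R} (h : IsBFamily n ω) {k : ℕ} (hk : k < n) :
    bAlgLift h (omega n k) = ω k := by
  rw [omega_of_lt hk, bAlgLift, RingQuot.liftAlgHom_mkAlgHom_apply, FreeAlgebra.lift_ι_apply]

end BAlg

namespace IsBFamily

variable {R : Type*} [Ring R] [Algebra ℂ R] {n : ℕ} {ω : ℕ → R}

/-- The images of the generators `a_{k+1}` of `H̃ₙ` attached to a family `ω`. -/
noncomputable def alpha (ω : ℕ → R) : ℕ → R :=
  conjSeq ω (-Complex.I • ω 0)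

theorem alpha_succ (ω : ℕ → R) (k : ℕ) :
    alpha ω (k + 1) = ω (k + 1) * alpha ω k * ω (k + 1) := rfl

theorem alpha_mul_self (h : IsBFamily n ω) {k : ℕ} (hk : k < n) :
    alpha ω k * alpha ω k = -1 := by
  refine conjSeq_mul_self h.mul_self ?_ k hk
  simp [h.mul_self 0 (by omega), smul_smul]

theorem commute_smul_zero (h : IsBFamily n ω) (c : ℂ) (j : ℕ) (hj : 2 ≤ j) (hn : j < n) :
    Commute (ω j) (c • ω 0) :=
  ((h.commute 0 j hj hn).symm).smul_right c

theorem commute_alpha (h : IsBFamily n ω) {i j : ℕ} (hi : i + 1 < n) (hj : j < n) (hne : j ≠ i)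
    (hne' : j ≠ i + 1) : Commute (ω (i + 1)) (alpha ω j) := by
  rcases lt_or_gt_of_ne hne with hlt | hlt
  · exact commute_conjSeq_of_lt h.commute (h.commute_smul_zero _) j (i + 1) (by omega) hi
  · exact commute_conjSeq_of_gt h.braid h.commute (h.commute_smul_zero _) (i + 1) (by omega) j
      (by omega) hj

theorem alpha_anticomm (h : IsBFamily n ω) {i j : ℕ} (hi : i < n) (hj : j < n) (hij : i ≠ j) :
    alpha ω i * alpha ω j = -(alpha ω j * alpha ω i) := by
  wlog hlt : i < j generalizing i j
  · rw [this hj hi hij.symm (by omega), neg_neg]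
  refine conjSeq_anticomm h.braid h.commute (h.commute_smul_zero _) ?_ i j hlt hj
  have h4 := h.quat
  have h0 := h.mul_self 0 (by omega)
  have h1 := h.mul_self 1 (by omega)
  generalize ω 0 = x at *
  generalize ω 1 = y at *
  have key : x * (y * x * y) = -(y * x * y * x) := by
    calc x * (y * x * y) = x * y * x * y * (x * (y * (x * (y * y) * x) * y) * x) := by
          simp [h0, h1, mul_assoc]
      _ = (x * y) ^ 4 * (y * x * y * x) := by noncomm_ring
      _ = -(y * x * y * x) := by rw [h4, neg_one_mul]
  simp only [mul_smul_comm, smul_mul_assoc, key, smul_neg]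

/-- The units assigned to the generators of `H̃ₙ`. -/
noncomputable def genUnit (h : IsBFamily n ω) : HGen n → Rˣ
  | .s i => ⟨ω (i + 1), ω (i + 1), h.mul_self _ (by omega), h.mul_self _ (by omega)⟩
  | .a j => ⟨alpha ω j, -alpha ω j, by simp [h.alpha_mul_self], by simp [h.alpha_mul_self]⟩
  | .z => -1

theorem lift_genUnit_eq_one (h : IsBFamily n ω) (w : FreeGroup (HGen n)) (hw : w ∈ hRels n) :
    FreeGroup.lift h.genUnit w = 1 := by
  rcases hw with ⟨i, rfl⟩ | ⟨j, rfl⟩ | rfl | ⟨i, rfl⟩ | ⟨i, j, hij, rfl⟩ | ⟨i, j, hij, rfl⟩ |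
    ⟨i, rfl⟩ | ⟨i, j, hne, hne', rfl⟩ | ⟨j, rfl⟩ | ⟨i, j, hij, rfl⟩ <;>
    simp only [S, A, Z, map_mul, map_pow, map_inv, FreeGroup.lift_apply_of]
  · rw [mul_inv_eq_one, mul_inv_eq_iff_eq_mul]
    simp [genUnit]
  · rw [mul_inv_eq_one, mul_inv_eq_iff_eq_mul]
    simp [genUnit]
  · simp [genUnit]
  · ext
    simp [genUnit, pow_two, h.mul_self (i + 1) (by omega)]
  · ext
    simp only [genUnit, Units.val_pow_eq_pow_val, Units.val_mul, Units.val_one, hij]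
    exact mul_pow_three_of_braid (h.mul_self _ (by omega)) (h.mul_self _ (by omega))
      (h.braid _ (by omega) (by omega))
  · ext
    simp only [genUnit, Units.val_pow_eq_pow_val, Units.val_mul, Units.val_one]
    have hc : Commute (ω (i + 1)) (ω (j + 1)) := by
      rcases hij with hij | hij
      · exact h.commute _ _ (by omega) (by omega)
      · exact (h.commute _ _ (by omega) (by omega)).symm
    rw [hc.mul_pow, pow_two, pow_two, h.mul_self _ (by omega), h.mul_self _ (by omega), one_mul]
  · rw [mul_inv_eq_one, mul_inv_eq_iff_eq_mul]
    ext
    simp only [genUnit, Units.val_mul, idx1, idx2, alpha_succ]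
    rw [mul_assoc _ _ (ω _), h.mul_self _ (by omega), mul_one]
  · rw [mul_inv_eq_one, mul_inv_eq_iff_eq_mul]
    ext
    exact h.commute_alpha (by omega) j.isLt hne hne'
  · rw [mul_inv_eq_one]
    ext
    simp [genUnit, pow_two, h.alpha_mul_self]
  · rw [mul_inv_eq_one, mul_inv_eq_iff_eq_mul, mul_inv_eq_iff_eq_mul]
    ext
    simp only [genUnit, Units.val_mul, neg_mul, one_mul, Units.val_neg]
    exact h.alpha_anticomm i.isLt j.isLt (by simpa [Fin.ext_iff] using hij)

end IsBFamily

section GroupQuot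

variable {R : Type*} [Ring R] [Algebra ℂ R] {n : ℕ}

/-- The algebra map out of the quotient of `ℂ[H̃ₙ]` given by a family satisfying the relations
of `ℬₙ`. -/
noncomputable def groupQuotLift {ω : ℕ → R} (h : IsBFamily n ω) :
    RingQuot (QRelH n) →ₐ[ℂ] R :=
  RingQuot.liftAlgHom ℂ ⟨MonoidAlgebra.lift ℂ R (HTilde n)
    ((Units.coeHom R).comp (PresentedGroup.toGroup h.lift_genUnit_eq_one)), by
      rintro _ _ ⟨rfl, rfl⟩
      simp [IsBFamily.genUnit]⟩

/-- The canonical map from `H̃ₙ` to the quotient of its group algebra. -/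
noncomputable def groupQuotMk (n : ℕ) : HTilde n →* RingQuot (QRelH n) :=
  (RingQuot.mkAlgHom ℂ (QRelH n) : MonoidAlgebra ℂ (HTilde n) →* RingQuot (QRelH n)).comp
    (MonoidAlgebra.of ℂ (HTilde n))

theorem groupQuotLift_mk_of {ω : ℕ → R} (h : IsBFamily n ω) (x : HGen n) :
    groupQuotLift h (groupQuotMk n (PresentedGroup.of x)) = h.genUnit x := by
  change groupQuotLift h (RingQuot.mkAlgHom ℂ (QRelH n) _) = _
  rw [groupQuotLift, RingQuot.liftAlgHom_mkAlgHom_apply, MonoidAlgebra.lift_of]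
  simp

theorem one_add_groupQuotMk_z :
    1 + groupQuotMk n (PresentedGroup.of .z) = 0 := by
  have := RingQuot.mkAlgHom_rel ℂ (show QRelH n _ _ from ⟨rfl, rfl⟩)
  rwa [map_add, map_one, map_zero] at this

/-- The generator `s_{k+1}` of `H̃ₙ`, extended by `1` to all natural numbers. -/
def sGen (n k : ℕ) : HTilde n :=
  if h : k < n - 1 then PresentedGroup.of (.s ⟨k, h⟩) else 1

/-- The generator `a_{k+1}` of `H̃ₙ`, extended by `1` to all natural numbers. -/
def aGen (n k : ℕ) : HTilde n :=
  if h : k < n then PresentedGroup.of (.a ⟨k, h⟩) else 1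

theorem sGen_of_lt {k : ℕ} (h : k < n - 1) : sGen n k = PresentedGroup.of (.s ⟨k, h⟩) :=
  dif_pos h

theorem aGen_of_lt {k : ℕ} (h : k < n) : aGen n k = PresentedGroup.of (.a ⟨k, h⟩) :=
  dif_pos h

theorem z_sq : (PresentedGroup.of .z : HTilde n) ^ 2 = 1 :=
  PresentedGroup.one_of_mem (rels := hRels n) (x := Z ^ 2) (by right; right; left; rfl)

theorem sGen_sq {k : ℕ} (h : k < n - 1) : sGen n k ^ 2 = 1 := by
  rw [sGen_of_lt h]
  exact PresentedGroup.one_of_mem (rels := hRels n) (x := S ⟨k, h⟩ ^ 2)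
    (by right; right; right; left; exact ⟨_, rfl⟩)

theorem sGen_braid {k : ℕ} (h : k + 1 < n - 1) : (sGen n k * sGen n (k + 1)) ^ 3 = 1 := by
  rw [sGen_of_lt h, sGen_of_lt (by omega : k < n - 1)]
  exact PresentedGroup.one_of_mem (rels := hRels n) (x := (S ⟨k, by omega⟩ * S ⟨k + 1, h⟩) ^ 3)
    (by right; right; right; right; left; exact ⟨_, _, rfl, rfl⟩)

theorem sGen_far {i j : ℕ} (h : i + 2 ≤ j) (hj : j < n - 1) : (sGen n i * sGen n j) ^ 2 = 1 := by
  rw [sGen_of_lt hj, sGen_of_lt (by omega : i < n - 1)]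
  exact PresentedGroup.one_of_mem (rels := hRels n) (x := (S ⟨i, by omega⟩ * S ⟨j, hj⟩) ^ 2)
    (by right; right; right; right; right; left; exact ⟨_, _, Or.inl h, rfl⟩)

theorem sGen_mul_aGen_mul_inv {k : ℕ} (h : k < n - 1) :
    sGen n k * aGen n k * (sGen n k)⁻¹ = aGen n (k + 1) := by
  rw [← mul_inv_eq_one, sGen_of_lt h, aGen_of_lt (by omega : k < n),
    aGen_of_lt (by omega : k + 1 < n)]
  exact PresentedGroup.one_of_mem (rels := hRels n)
    (x := S ⟨k, h⟩ * A (idx1 ⟨k, h⟩) * (S ⟨k, h⟩)⁻¹ * (A (idx2 ⟨k, h⟩))⁻¹)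
    (by right; right; right; right; right; right; left; exact ⟨_, rfl⟩)

theorem sGen_mul_aGen_comm {i j : ℕ} (hi : i < n - 1) (hj : j < n) (hne : j ≠ i)
    (hne' : j ≠ i + 1) : sGen n i * aGen n j = aGen n j * sGen n i := by
  rw [← mul_inv_eq_iff_eq_mul, ← mul_inv_eq_one, sGen_of_lt hi, aGen_of_lt hj]
  exact PresentedGroup.one_of_mem (rels := hRels n)
    (x := S ⟨i, hi⟩ * A ⟨j, hj⟩ * (S ⟨i, hi⟩)⁻¹ * (A ⟨j, hj⟩)⁻¹)
    (by right; right; right; right; right; right; right; left; exact ⟨_, _, hne, hne', rfl⟩)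

theorem aGen_sq {k : ℕ} (h : k < n) : aGen n k ^ 2 = PresentedGroup.of .z := by
  rw [← mul_inv_eq_one, aGen_of_lt h]
  exact PresentedGroup.one_of_mem (rels := hRels n) (x := A ⟨k, h⟩ ^ 2 * Z⁻¹)
    (by right; right; right; right; right; right; right; right; left; exact ⟨_, rfl⟩)

theorem aGen_mul_aGen {i j : ℕ} (hi : i < n) (hj : j < n) (hij : i ≠ j) :
    aGen n i * aGen n j = PresentedGroup.of .z * aGen n j * aGen n i := by
  rw [← mul_inv_eq_iff_eq_mul, ← mul_inv_eq_iff_eq_mul, ← mul_inv_eq_one, aGen_of_lt hi,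
    aGen_of_lt hj]
  exact PresentedGroup.one_of_mem (rels := hRels n)
    (x := A ⟨i, hi⟩ * A ⟨j, hj⟩ * (A ⟨i, hi⟩)⁻¹ * (A ⟨j, hj⟩)⁻¹ * Z⁻¹)
    (by right; right; right; right; right; right; right; right; right
        exact ⟨_, _, by simpa [Fin.ext_iff] using hij, rfl⟩)

/-- The family attached to a homomorphism `φ` from `H̃ₙ` to the multiplicative monoid of an
algebra. -/
noncomputable def groupFamily {R : Type*} [Semiring R] [Algebra ℂ R] (φ : HTilde n →* R) : ℕ → R
  | 0 => Complex.I • φ (aGen n 0)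
  | k + 1 => φ (sGen n k)

theorem isBFamily_groupFamily (hn : 2 ≤ n) (φ : HTilde n →* R)
    (hz : 1 + φ (PresentedGroup.of .z) = 0) : IsBFamily n (groupFamily φ) := by
  have hz : φ (PresentedGroup.of .z) = -1 := (neg_eq_of_add_eq_zero_right hz).symm
  have hs {k : ℕ} (hk : k < n - 1) : φ (sGen n k) * φ (sGen n k) = 1 := by
    rw [← map_mul, ← pow_two, sGen_sq hk, map_one]
  have ha : φ (aGen n 0) * φ (aGen n 0) = -1 := by
    rw [← map_mul, ← pow_two, aGen_sq (by omega), hz]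
  refine ⟨?_, ?_, ?_, ?_⟩
  · rintro (_ | k) hk
    · simp [groupFamily, ha, smul_smul]
    · exact hs (by omega)
  · rintro (_ | i) h1 hi
    · omega
    · refine braid_of_mul_pow_three (hs (by omega)) (hs (by omega)) ?_
      simp only [groupFamily]
      rw [← map_mul, ← map_pow, sGen_braid (by omega), map_one]
  · rintro (_ | i) (_ | j) h hj
    · omega
    · refine Commute.smul_left ?_ _
      change φ _ * φ _ = φ _ * φ _
      rw [← map_mul, ← map_mul, sGen_mul_aGen_comm (by omega) (by omega) (by omega) (by omega)]
    · omega
    · refine commute_of_mul_pow_two (hs (by omega)) (hs (by omega)) ?_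
      simp only [groupFamily]
      rw [← map_mul, ← map_pow, sGen_far (by omega) (by omega), map_one]
  · have hinv : (sGen n 0)⁻¹ = sGen n 0 :=
      inv_eq_of_mul_eq_one_right (by rw [← pow_two, sGen_sq (by omega)])
    have h1 := sGen_mul_aGen_mul_inv (n := n) (k := 0) (by omega)
    rw [hinv] at h1
    have h4 : (aGen n 0 * sGen n 0) ^ 4 = PresentedGroup.of .z := by
      calc (aGen n 0 * sGen n 0) ^ 4 = aGen n 0 * (sGen n 0 * aGen n 0 * sGen n 0) *
            (aGen n 0 * (sGen n 0 * aGen n 0 * sGen n 0)) := by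
            simp only [pow_succ, pow_zero, one_mul, mul_assoc]
        _ = PresentedGroup.of .z * aGen n 1 * aGen n 0 ^ 2 * aGen n 1 := by
            rw [h1]
            nth_rw 1 [aGen_mul_aGen (by omega) (by omega) (by omega)]
            simp only [pow_two, mul_assoc, zero_add]
        _ = (PresentedGroup.of .z * aGen n 1 ^ 2) * aGen n 1 ^ 2 := by
            rw [aGen_sq (by omega), ← aGen_sq (k := 1) (by omega)]
            simp only [pow_two, mul_assoc]
        _ = PresentedGroup.of .z := by
            rw [aGen_sq (by omega), ← pow_two, z_sq, one_mul]
    simp only [groupFamily, smul_mul_assoc, smul_pow, Complex.I_pow_four, one_smul]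
    rw [← map_mul, ← map_pow, h4, hz]

end GroupQuot

theorem isBFamily_omega {n : ℕ} (hn : 2 ≤ n) :
    @IsBFamily (BAlg n) (Algebra.semiringToRing ℂ) n (omega n) :=
  let _ : Ring (BAlg n) := Algebra.semiringToRing ℂ
  isBFamily_map_omega hn (AlgHom.id ℂ (BAlg n))

theorem isBFamily_groupQuot {n : ℕ} (hn : 2 ≤ n) :
    @IsBFamily (RingQuot (QRelH n)) (Algebra.semiringToRing ℂ) n (groupFamily (groupQuotMk n)) :=
  let _ : Ring (RingQuot (QRelH n)) := Algebra.semiringToRing ℂ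
  isBFamily_groupFamily hn (groupQuotMk n) one_add_groupQuotMk_z

/-- The map from `ℬₙ` to the quotient of `ℂ[H̃ₙ]`. -/
noncomputable def toGroupQuot {n : ℕ} (hn : 2 ≤ n) : BAlg n →ₐ[ℂ] RingQuot (QRelH n) :=
  letI : Ring (RingQuot (QRelH n)) := Algebra.semiringToRing ℂ
  bAlgLift (isBFamily_groupQuot hn)

/-- The map from the quotient of `ℂ[H̃ₙ]` to `ℬₙ`. -/
noncomputable def ofGroupQuot {n : ℕ} (hn : 2 ≤ n) : RingQuot (QRelH n) →ₐ[ℂ] BAlg n :=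
  letI : Ring (BAlg n) := Algebra.semiringToRing ℂ
  groupQuotLift (isBFamily_omega hn)

section Equivalence

variable {n : ℕ} (hn : 2 ≤ n)

theorem toGroupQuot_omega {k : ℕ} (hk : k < n) :
    toGroupQuot hn (omega n k) = groupFamily (groupQuotMk n) k :=
  let : Ring (RingQuot (QRelH n)) := Algebra.semiringToRing ℂ
  bAlgLift_omega (isBFamily_groupQuot hn) hk

theorem ofGroupQuot_sGen {k : ℕ} (hk : k < n - 1) :
    ofGroupQuot hn (groupQuotMk n (sGen n k)) = omega n (k + 1) := by
  let : Ring (BAlg n) := Algebra.semiringToRing ℂ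
  rw [sGen_of_lt hk]
  exact groupQuotLift_mk_of (isBFamily_omega hn) _

theorem ofGroupQuot_aGen_zero :
    ofGroupQuot hn (groupQuotMk n (aGen n 0)) = -Complex.I • omega n 0 := by
  let : Ring (BAlg n) := Algebra.semiringToRing ℂ
  rw [aGen_of_lt (by omega)]
  exact groupQuotLift_mk_of (isBFamily_omega hn) _

theorem ofGroupQuot_comp_toGroupQuot :
    (ofGroupQuot hn).comp (toGroupQuot hn) = AlgHom.id ℂ (BAlg n) := by
  refine RingQuot.ringQuot_ext' ℂ _ _ (FreeAlgebra.hom_ext (funext fun ⟨k, hk⟩ => ?_))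
  change ofGroupQuot hn (toGroupQuot hn (RingQuot.mkAlgHom ℂ (BRel n) (FreeAlgebra.ι ℂ ⟨k, hk⟩)))
    = RingQuot.mkAlgHom ℂ (BRel n) (FreeAlgebra.ι ℂ ⟨k, hk⟩)
  rw [← omega_of_lt hk, toGroupQuot_omega hn hk]
  cases k with
  | zero => simp [groupFamily, ofGroupQuot_aGen_zero hn, smul_smul]
  | succ k => exact ofGroupQuot_sGen hn (by omega)

theorem toGroupQuot_ofGroupQuot_sGen {k : ℕ} (hk : k < n - 1) :
    toGroupQuot hn (ofGroupQuot hn (groupQuotMk n (sGen n k))) = groupQuotMk n (sGen n k) := by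
  rw [ofGroupQuot_sGen hn hk, toGroupQuot_omega hn (by omega)]
  rfl

theorem toGroupQuot_ofGroupQuot_aGen {k : ℕ} (hk : k < n) :
    toGroupQuot hn (ofGroupQuot hn (groupQuotMk n (aGen n k))) = groupQuotMk n (aGen n k) := by
  induction k with
  | zero =>
    rw [ofGroupQuot_aGen_zero hn, map_smul, toGroupQuot_omega hn hk]
    simp [groupFamily, smul_smul]
  | succ k ih =>
    have hinv : (sGen n k)⁻¹ = sGen n k :=
      inv_eq_of_mul_eq_one_right (by rw [← pow_two, sGen_sq (by omega)])
    rw [← sGen_mul_aGen_mul_inv (by omega), hinv]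
    simp only [map_mul, ih (by omega), toGroupQuot_ofGroupQuot_sGen hn (by omega : k < n - 1)]

theorem toGroupQuot_comp_ofGroupQuot :
    (toGroupQuot hn).comp (ofGroupQuot hn) = AlgHom.id ℂ (RingQuot (QRelH n)) := by
  refine RingQuot.ringQuot_ext' ℂ _ _ (MonoidAlgebra.algHom_ext (fun g => ?_)
    (Subsingleton.elim _ _))
  change ((toGroupQuot hn : RingQuot _ →* _).comp
    ((ofGroupQuot hn : _ →* BAlg n).comp (groupQuotMk n))) g = groupQuotMk n g
  refine DFunLike.congr_fun (MonoidHom.eq_of_eqOn_dense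
    (PresentedGroup.closure_range_of (hRels n)) (Set.forall_mem_range.2 fun x => ?_)) g
  change toGroupQuot hn (ofGroupQuot hn (groupQuotMk n (PresentedGroup.of x))) =
    groupQuotMk n (PresentedGroup.of x)
  rcases x with ⟨k, hk⟩ | ⟨k, hk⟩ | _
  · rw [← sGen_of_lt hk, toGroupQuot_ofGroupQuot_sGen hn hk]
  · rw [← aGen_of_lt hk, toGroupQuot_ofGroupQuot_aGen hn hk]
  · rw [← aGen_sq (by omega : 0 < n)]
    simp only [map_pow, toGroupQuot_ofGroupQuot_aGen hn (by omega : 0 < n)]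

end Equivalence

theorem bAlg_iso_groupAlgebra_quot (n : ℕ) (hn : 2 ≤ n) :
    Nonempty (BAlg n ≃ₐ[ℂ] RingQuot (QRelH n)) := by
  exact ⟨AlgEquiv.ofAlgHom (toGroupQuot hn) (ofGroupQuot hn)
    (toGroupQuot_comp_ofGroupQuot hn) (ofGroupQuot_comp_toGroupQuot hn)⟩

end Stmt11
end

section
/- Let n ≥ 2. The algebra 𝒜_n is isomorphic as a ℂ-algebra to the quotient of the group algebra ℂ[S̃_n] (Mathlib's MonoidAlgebra ℂ S̃_n) by the two-sided ideal generated by 1 + z; an isomorphism is given on generators by ς_i ↦ (−1)^i t_i. -/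
/-!
STATEMENT 12: for `n ≥ 2`, the algebra `𝒜ₙ` is isomorphic as a ℂ-algebra to
the quotient of the group algebra `ℂ[S̃ₙ]` (Mathlib's `MonoidAlgebra ℂ S̃ₙ`)
by the two-sided ideal generated by `1 + z`, an isomorphism being given on
generators by `ςᵢ ↦ (−1)ⁱ tᵢ`  (`1 ≤ i ≤ n−1`; in the 0-based indexing used
here, the generator with index `i : Fin (n-1)` is `ς_{i+1}`, so it is sent to
`(−1)^(i+1) t_{i+1}`).
(Presented algebras and the quotient are realized via `RingQuot`.)
-/

namespace Stmt12

/-! The spin symmetric group `S̃ₙ`. -/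

inductive SGen (n : ℕ) : Type
  | t : Fin (n - 1) → SGen n
  | z : SGen n

variable {n : ℕ}

def T (i : Fin (n - 1)) : FreeGroup (SGen n) := FreeGroup.of (SGen.t i)
def Z : FreeGroup (SGen n) := FreeGroup.of (SGen.z)

def sRels (n : ℕ) : Set (FreeGroup (SGen n)) :=
  { w | (∃ i : Fin (n - 1), w = Z * T i * Z⁻¹ * (T i)⁻¹)
    ∨ (w = Z ^ 2)
    ∨ (∃ i : Fin (n - 1), w = T i ^ 2 * Z⁻¹)
    ∨ (∃ i j : Fin (n - 1), (j : ℕ) = (i : ℕ) + 1 ∧ w = (T i * T j) ^ 3)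
    ∨ (∃ i j : Fin (n - 1), ((i : ℕ) + 2 ≤ (j : ℕ) ∨ (j : ℕ) + 2 ≤ (i : ℕ)) ∧
        w = T i * T j * (T i)⁻¹ * (T j)⁻¹ * Z⁻¹) }

abbrev SpinSym (n : ℕ) := PresentedGroup (sRels n)

/-! The algebra `𝒜ₙ`. -/

inductive ARel (n : ℕ) : FreeAlgebra ℂ (Fin (n - 1)) → FreeAlgebra ℂ (Fin (n - 1)) → Prop
  | sq (i : Fin (n - 1)) : ARel n (FreeAlgebra.ι ℂ i ^ 2) (-1)
  | far (i j : Fin (n - 1)) (h : (i : ℕ) + 2 ≤ (j : ℕ) ∨ (j : ℕ) + 2 ≤ (i : ℕ)) :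
      ARel n ((FreeAlgebra.ι ℂ i * FreeAlgebra.ι ℂ j) ^ 2) (-1)
  | adj (i j : Fin (n - 1)) (h : (j : ℕ) = (i : ℕ) + 1) :
      ARel n ((FreeAlgebra.ι ℂ i * FreeAlgebra.ι ℂ j) ^ 3) (-1)

abbrev AAlg (n : ℕ) := RingQuot (ARel n)

/-- The relation on `ℂ[S̃ₙ]` identifying `1 + z` with `0`; its `RingQuot` is
the quotient by the two-sided ideal generated by `1 + z`. -/
def QRelS (n : ℕ) :
    MonoidAlgebra ℂ (SpinSym n) → MonoidAlgebra ℂ (SpinSym n) → Prop :=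
  fun x y =>
    x = 1 + MonoidAlgebra.of ℂ (SpinSym n) (PresentedGroup.of (SGen.z)) ∧ y = 0

section Ring

variable {A : Type*} [Ring A]

theorem mul_sq_eq_neg_one_iff {a b : A} (ha : a ^ 2 = -1) (hb : b ^ 2 = -1) :
    (a * b) ^ 2 = -1 ↔ a * b = -1 * (b * a) := by
  rw [sq] at ha hb
  have h : b * a * (a * b) = 1 := by
    rw [mul_assoc, ← mul_assoc a, ha, neg_one_mul, mul_neg, hb, neg_neg]
  have h' : a * b * (b * a) = 1 := by
    rw [mul_assoc, ← mul_assoc b, hb, neg_one_mul, mul_neg, ha, neg_neg]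
  rw [sq, neg_one_mul]
  constructor
  · intro hab
    calc a * b = a * b * (a * b * (b * a)) := by rw [h', mul_one]
      _ = -(b * a) := by rw [← mul_assoc, hab, neg_one_mul]
  · intro hab
    nth_rw 1 [hab]
    rw [neg_mul, h]

/-- A square root of `-1` as a unit. -/
def unitOfSq (a : A) (ha : a ^ 2 = -1) : Aˣ where
  val := a
  inv := -a
  val_inv := by rw [mul_neg, ← sq, ha, neg_neg]
  inv_val := by rw [neg_mul, ← sq, ha, neg_neg]

variable (a : Fin (n - 1) → A) (hsq : ∀ i, a i ^ 2 = -1)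

/-- The images of the generators of the spin symmetric group in the units of a ring with
a family of square roots of `-1`. -/
def spinUnit : SGen n → Aˣ
  | .t i => (-1) ^ ((i : ℕ) + 1) * unitOfSq (a i) (hsq i)
  | .z => -1

theorem spinUnit_rels
    (hfar : ∀ i j : Fin (n - 1), ((i : ℕ) + 2 ≤ (j : ℕ) ∨ (j : ℕ) + 2 ≤ (i : ℕ)) →
      (a i * a j) ^ 2 = -1)
    (hadj : ∀ i j : Fin (n - 1), (j : ℕ) = (i : ℕ) + 1 → (a i * a j) ^ 3 = -1)
    (w : FreeGroup (SGen n)) (hw : w ∈ sRels n) :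
    FreeGroup.lift (spinUnit a hsq) w = 1 := by
  rcases hw with ⟨i, rfl⟩ | rfl | ⟨i, rfl⟩ | ⟨i, j, h, rfl⟩ | ⟨i, j, h, rfl⟩
  · simp [Z, T, spinUnit]
  · simp [Z, spinUnit]
  · have hg : unitOfSq (a i) (hsq i) ^ 2 = -1 := Units.ext (by simpa [unitOfSq] using hsq i)
    rw [map_mul, map_inv, mul_inv_eq_one]
    simp only [T, Z, map_pow, FreeGroup.lift_apply_of, spinUnit]
    rw [((Commute.neg_one_left _).pow_left _).mul_pow, hg, ← pow_mul]
    simp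
  · have hg : (unitOfSq (a i) (hsq i) * unitOfSq (a j) (hsq j)) ^ 3 = -1 :=
      Units.ext (by simpa [unitOfSq] using hadj i j h)
    simp only [T, map_pow, map_mul, FreeGroup.lift_apply_of, spinUnit]
    rw [((Commute.neg_one_left _).pow_left _).symm.mul_mul_mul_comm, ← pow_add,
      ((Commute.neg_one_left _).pow_left _).mul_pow, hg, ← pow_mul, ← pow_succ]
    exact Even.neg_one_pow (by rw [h, Nat.even_iff]; omega)
  · have hcomm : unitOfSq (a i) (hsq i) * unitOfSq (a j) (hsq j) =
        -1 * (unitOfSq (a j) (hsq j) * unitOfSq (a i) (hsq i)) :=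
      Units.ext (by
        simpa [unitOfSq] using (mul_sq_eq_neg_one_iff (hsq i) (hsq j)).mp (hfar i j h))
    simp only [T, Z, map_mul, map_inv, FreeGroup.lift_apply_of, spinUnit]
    rw [mul_inv_eq_one, mul_inv_eq_iff_eq_mul, mul_inv_eq_iff_eq_mul,
      ((Commute.neg_one_left _).pow_left _).symm.mul_mul_mul_comm, hcomm,
      mul_assoc (-1 : Aˣ), ((Commute.neg_one_left _).pow_left _).symm.mul_mul_mul_comm,
      ((Commute.refl (-1 : Aˣ)).pow_pow _ _).eq]
    simp

variable
  (hfar : ∀ i j : Fin (n - 1), ((i : ℕ) + 2 ≤ (j : ℕ) ∨ (j : ℕ) + 2 ≤ (i : ℕ)) →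
    (a i * a j) ^ 2 = -1)
  (hadj : ∀ i j : Fin (n - 1), (j : ℕ) = (i : ℕ) + 1 → (a i * a j) ^ 3 = -1)

/-- The homomorphism on the spin symmetric group given by `tᵢ ↦ (-1)ⁱ aᵢ`, `z ↦ -1`. -/
def spinLift : SpinSym n →* A :=
  (Units.coeHom A).comp (PresentedGroup.toGroup (spinUnit_rels a hsq hfar hadj))

theorem spinLift_t [Algebra ℂ A] (i : Fin (n - 1)) :
    spinLift a hsq hfar hadj (PresentedGroup.of (SGen.t i)) = (-1 : ℂ) ^ ((i : ℕ) + 1) • a i := by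
  simp [spinLift, spinUnit, unitOfSq, Algebra.smul_def]

theorem spinLift_z : spinLift a hsq hfar hadj (PresentedGroup.of SGen.z) = -1 := by
  simp [spinLift, spinUnit]

end Ring

namespace AAlg

/-- The image in `𝒜ₙ` of a generator. -/
noncomputable def gen (i : Fin (n - 1)) : AAlg n :=
  RingQuot.mkAlgHom ℂ (ARel n) (FreeAlgebra.ι ℂ i)

theorem gen_sq (i : Fin (n - 1)) : gen i ^ 2 = (-1 : AAlg n) := by
  simpa [gen] using RingQuot.mkAlgHom_rel ℂ (ARel.sq i)

theorem gen_mul_gen_sq (i j : Fin (n - 1))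
    (h : (i : ℕ) + 2 ≤ (j : ℕ) ∨ (j : ℕ) + 2 ≤ (i : ℕ)) :
    (gen i * gen j) ^ 2 = (-1 : AAlg n) := by
  simpa only [gen, map_pow, map_mul, map_neg, map_one] using
    RingQuot.mkAlgHom_rel ℂ (ARel.far i j h)

theorem gen_mul_gen_cube (i j : Fin (n - 1)) (h : (j : ℕ) = (i : ℕ) + 1) :
    (gen i * gen j) ^ 3 = (-1 : AAlg n) := by
  simpa only [gen, map_pow, map_mul, map_neg, map_one] using
    RingQuot.mkAlgHom_rel ℂ (ARel.adj i j h)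

/-- The homomorphism from the spin symmetric group to `𝒜ₙ`. -/
noncomputable def spinHom (n : ℕ) : SpinSym n →* AAlg n :=
  spinLift gen gen_sq gen_mul_gen_sq gen_mul_gen_cube

theorem spinHom_t (i : Fin (n - 1)) :
    spinHom n (PresentedGroup.of (SGen.t i)) = (-1 : ℂ) ^ ((i : ℕ) + 1) • gen i :=
  spinLift_t _ _ _ _ i

theorem spinHom_z : spinHom n (PresentedGroup.of SGen.z) = -1 :=
  spinLift_z _ _ _ _

/-- The homomorphism from the twisted group algebra to `𝒜ₙ`. -/
noncomputable def ofTwisted (n : ℕ) : RingQuot (QRelS n) →ₐ[ℂ] AAlg n :=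
  RingQuot.liftAlgHom ℂ ⟨MonoidAlgebra.lift ℂ (AAlg n) (SpinSym n) (spinHom n), by
    rintro x y ⟨rfl, rfl⟩
    simp [spinHom_z]⟩

end AAlg

/-- The homomorphism from the spin symmetric group to its twisted group algebra. -/
noncomputable def twistedOf (n : ℕ) : SpinSym n →* RingQuot (QRelS n) :=
  (RingQuot.mkAlgHom ℂ (QRelS n) : _ →* _).comp (MonoidAlgebra.of ℂ (SpinSym n))

theorem AAlg.ofTwisted_twistedOf (g : SpinSym n) :
    AAlg.ofTwisted n (twistedOf n g) = AAlg.spinHom n g := by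
  simp [AAlg.ofTwisted, twistedOf]

theorem twistedOf_z : twistedOf n (PresentedGroup.of SGen.z) = -1 := by
  have h := RingQuot.mkAlgHom_rel ℂ (s := QRelS n) ⟨rfl, rfl⟩
  rw [map_add, map_one, map_zero] at h
  exact (neg_eq_of_add_eq_zero_right h).symm

theorem twistedOf_t_sq (i : Fin (n - 1)) :
    twistedOf n (PresentedGroup.of (SGen.t i)) ^ 2 = -1 := by
  have h : (PresentedGroup.of (SGen.t i) : SpinSym n) ^ 2 = PresentedGroup.of SGen.z :=
    mul_inv_eq_one.mp (PresentedGroup.one_of_mem (rels := sRels n)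
      (Or.inr (Or.inr (Or.inl ⟨i, rfl⟩))))
  rw [← map_pow, h, twistedOf_z]

theorem twistedOf_t_mul_t_cube (i j : Fin (n - 1)) (h : (j : ℕ) = (i : ℕ) + 1) :
    (twistedOf n (PresentedGroup.of (SGen.t i)) *
      twistedOf n (PresentedGroup.of (SGen.t j))) ^ 3 = 1 := by
  have h : (PresentedGroup.of (SGen.t i) * PresentedGroup.of (SGen.t j) : SpinSym n) ^ 3 = 1 :=
    PresentedGroup.one_of_mem (rels := sRels n) (Or.inr (Or.inr (Or.inr (Or.inl ⟨i, j, h, rfl⟩))))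
  rw [← map_mul, ← map_pow, h, map_one]

theorem twistedOf_t_mul_t_sq (i j : Fin (n - 1))
    (h : (i : ℕ) + 2 ≤ (j : ℕ) ∨ (j : ℕ) + 2 ≤ (i : ℕ)) :
    (twistedOf n (PresentedGroup.of (SGen.t i)) *
      twistedOf n (PresentedGroup.of (SGen.t j))) ^ 2 = -1 := by
  set a : SpinSym n := PresentedGroup.of (SGen.t i)
  set b : SpinSym n := PresentedGroup.of (SGen.t j)
  have h : a * b * a⁻¹ * b⁻¹ = PresentedGroup.of SGen.z :=
    mul_inv_eq_one.mp (PresentedGroup.one_of_mem (rels := sRels n)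
      (Or.inr (Or.inr (Or.inr (Or.inr ⟨i, j, h, rfl⟩)))))
  rw [mul_inv_eq_iff_eq_mul, mul_inv_eq_iff_eq_mul, mul_assoc] at h
  refine (mul_sq_eq_neg_one_iff (twistedOf_t_sq i) (twistedOf_t_sq j)).mpr ?_
  rw [← map_mul, ← map_mul, ← twistedOf_z, ← map_mul, ← h]

/-- The homomorphism from `𝒜ₙ` to the twisted group algebra. -/
noncomputable def AAlg.toTwisted (n : ℕ) : AAlg n →ₐ[ℂ] RingQuot (QRelS n) :=
  RingQuot.liftAlgHom ℂ ⟨FreeAlgebra.lift ℂ fun i : Fin (n - 1) =>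
      ((-1 : ℂ) ^ ((i : ℕ) + 1)) • twistedOf n (PresentedGroup.of (SGen.t i)), by
    intro x y hxy
    induction hxy with
    | sq i =>
      simp only [map_pow, FreeAlgebra.lift_ι_apply, map_neg, map_one, smul_pow, twistedOf_t_sq]
      rw [← pow_mul, Even.neg_one_pow (by simp), one_smul]
    | far i j h =>
      simp only [map_pow, map_mul, FreeAlgebra.lift_ι_apply, map_neg, map_one, smul_mul_smul_comm,
        smul_pow, twistedOf_t_mul_t_sq i j h]
      rw [← pow_add, ← pow_mul, Even.neg_one_pow (by simp), one_smul]
    | adj i j h =>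
      simp only [map_pow, map_mul, FreeAlgebra.lift_ι_apply, map_neg, map_one, smul_mul_smul_comm,
        smul_pow, twistedOf_t_mul_t_cube i j h]
      rw [← pow_add, ← pow_mul, Odd.neg_one_pow (by rw [h, Nat.odd_iff]; omega), neg_one_smul]⟩

theorem AAlg.toTwisted_gen (i : Fin (n - 1)) :
    AAlg.toTwisted n (AAlg.gen i) =
      ((-1 : ℂ) ^ ((i : ℕ) + 1)) • twistedOf n (PresentedGroup.of (SGen.t i)) := by
  simp [AAlg.toTwisted, AAlg.gen]

theorem AAlg.toTwisted_spinHom (g : SpinSym n) :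
    AAlg.toTwisted n (AAlg.spinHom n g) = twistedOf n g := by
  have h : ((AAlg.toTwisted n : AAlg n →* RingQuot (QRelS n)).comp (AAlg.spinHom n)).toHomUnits =
      (twistedOf n).toHomUnits := by
    refine PresentedGroup.ext fun x => Units.ext ?_
    cases x with
    | t i =>
      simp [AAlg.spinHom_t, AAlg.toTwisted_gen, smul_smul, ← mul_pow]
    | z => simp [AAlg.spinHom_z, twistedOf_z]
  exact congrArg Units.val (DFunLike.congr_fun h g)

theorem aAlg_iso_groupAlgebra_quot (n : ℕ) (hn : 2 ≤ n) :
    ∃ f : AAlg n ≃ₐ[ℂ] RingQuot (QRelS n),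
      ∀ i : Fin (n - 1),
        f (RingQuot.mkAlgHom ℂ (ARel n) (FreeAlgebra.ι ℂ i)) =
          ((-1 : ℂ) ^ ((i : ℕ) + 1)) •
            RingQuot.mkAlgHom ℂ (QRelS n)
              (MonoidAlgebra.of ℂ (SpinSym n) (PresentedGroup.of (SGen.t i))) := by
  refine ⟨AlgEquiv.ofAlgHom (AAlg.toTwisted n) (AAlg.ofTwisted n) ?_ ?_, AAlg.toTwisted_gen⟩
  · refine RingQuot.ringQuot_ext' ℂ _ _
      (MonoidAlgebra.algHom_ext (fun g => ?_) (Subsingleton.elim _ _))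
    exact (congrArg _ (AAlg.ofTwisted_twistedOf g)).trans (AAlg.toTwisted_spinHom g)
  · refine RingQuot.ringQuot_ext' ℂ _ _ (FreeAlgebra.hom_ext (funext fun i => ?_))
    change AAlg.ofTwisted n (AAlg.toTwisted n (AAlg.gen i)) = AAlg.gen i
    rw [AAlg.toTwisted_gen, map_smul, AAlg.ofTwisted_twistedOf, AAlg.spinHom_t, smul_smul,
      ← mul_pow]
    simp

end Stmt12
end

section
/- Let G be a finite group, let χ be the character of a finite-dimensional irreducible complex representation of G, and let ε : G → ℂˣ be a group homomorphism with ε(g)² = 1 for all g ∈ G. If the class function g ↦ ε(g)·χ(g) is not equal to χ, then ∑_{g ∈ G, ε(g) = −1} χ(g)·χ(g⁻¹) = |G|/2 (and likewise ∑_{g ∈ G, ε(g) = 1} χ(g)·χ(g⁻¹) = |G|/2). -/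
open CategoryTheory

/-- The twist of a representation by a linear character. -/
noncomputable def FDRep.twist {k G : Type*} [Field k] [Group G] (V : FDRep k G) (ε : G →* kˣ) :
    FDRep k G :=
  FDRep.of (V := V)
    { toFun := fun g => (ε g : k) • V.ρ g
      map_one' := by simp
      map_mul' := fun g h => by simp [smul_smul, mul_comm] }

theorem FDRep.char_twist {k G : Type*} [Field k] [Group G] (V : FDRep k G) (ε : G →* kˣ) (g : G) :
    (V.twist ε).character g = ε g * V.character g :=
  (LinearMap.trace k V).map_smul (ε g : k) (V.ρ g)

theorem FDRep.simple_twist {k G : Type} [Field k] [IsAlgClosed k] [CharZero k] [Group G]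
    [Fintype G] (V : FDRep k G) [hV : Simple V] (ε : G →* kˣ) : Simple (V.twist ε) := by
  rw [FDRep.simple_iff_char_is_norm_one] at hV ⊢
  rw [← hV]
  refine Finset.sum_congr rfl fun g _ => ?_
  have h : (ε g : k) * (ε g⁻¹ : k) = 1 := by simp
  rw [FDRep.char_twist, FDRep.char_twist]
  linear_combination V.character g * V.character g⁻¹ * h

open scoped Classical in
theorem sum_char_mul_char_inv_of_twist_ne {G : Type} [Group G] [Fintype G]
    (V : FDRep ℂ G) (hV : Simple V) (ε : G →* ℂˣ) (hε : ∀ g : G, ε g ^ 2 = 1)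
    (hne : (fun g : G => ((ε g : ℂ) * V.character g)) ≠ V.character) :
    (∑ g : G, if (ε g : ℂ) = -1 then V.character g * V.character g⁻¹ else 0) =
      (Fintype.card G : ℂ) / 2 ∧
    (∑ g : G, if (ε g : ℂ) = 1 then V.character g * V.character g⁻¹ else 0) =
      (Fintype.card G : ℂ) / 2 := by
  have hW := V.simple_twist ε
  have hcard : (Nat.card G : ℂ) ≠ 0 := Nat.cast_ne_zero.mpr Nat.card_pos.ne'
  let _ : Invertible (Nat.card G : ℂ) := invertibleOfNonzero hcard
  have hnorm : ∑ g : G, V.character g * V.character g⁻¹ = (Fintype.card G : ℂ) := by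
    rw [← Nat.card_eq_fintype_card]
    exact (FDRep.simple_iff_char_is_norm_one V).mp hV
  have horth : ∑ g : G, (ε g : ℂ) * (V.character g * V.character g⁻¹) = 0 := by
    have h := FDRep.char_orthonormal (V.twist ε) V
    rw [if_neg fun ⟨i⟩ => hne (funext fun g => by
      rw [← FDRep.char_twist, FDRep.char_iso i])] at h
    simpa [FDRep.char_twist, mul_assoc] using h
  have hcases (g : G) : (ε g : ℂ) = 1 ∨ (ε g : ℂ) = -1 :=
    sq_eq_one_iff.mp (by rw [← Units.val_pow_eq_pow_val, hε g, Units.val_one])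
  have hneg (g : G) : (if (ε g : ℂ) = -1 then V.character g * V.character g⁻¹ else 0) =
      (V.character g * V.character g⁻¹ - ε g * (V.character g * V.character g⁻¹)) / 2 := by
    rcases hcases g with h | h <;> rw [h] <;> norm_num
  have hpos (g : G) : (if (ε g : ℂ) = 1 then V.character g * V.character g⁻¹ else 0) =
      (V.character g * V.character g⁻¹ + ε g * (V.character g * V.character g⁻¹)) / 2 := by
    rcases hcases g with h | h <;> rw [h] <;> norm_num
  constructor
  · simp_rw [hneg]
    rw [← Finset.sum_div, Finset.sum_sub_distrib, hnorm, horth, sub_zero]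
  · simp_rw [hpos]
    rw [← Finset.sum_div, Finset.sum_add_distrib, hnorm, horth, add_zero]
end

section
/- Let G be a finite group, let (V, ρ) be a finite-dimensional irreducible complex representation of G, and let ε : G → ℂˣ be a group homomorphism with ε(g)² = 1 for all g ∈ G. Suppose the representation ρ is isomorphic to its twist g ↦ ε(g)·ρ(g). Then there exists a ℂ-linear automorphism H of V with H ∘ H = id_V and H ∘ ρ(g) = ε(g) • (ρ(g) ∘ H) for all g ∈ G. -/
/-!
STATEMENT 15: let `G` be a finite group, `(V, ρ)` an irreducible
finite-dimensional complex representation and `ε : G → ℂˣ` a homomorphism with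
`ε(g)² = 1`.  If `ρ` is isomorphic to its twist `g ↦ ε(g)·ρ(g)` (i.e. there is
a ℂ-linear equivalence `e` of `V` with `e ∘ ρ(g) = ε(g) • (ρ(g) ∘ e)` for all
`g`), then there is a ℂ-linear automorphism `H` of `V` with `H ∘ H = id` and
`H ∘ ρ(g) = ε(g) • (ρ(g) ∘ H)` for all `g`.
-/

open CategoryTheory

/-- **Schur's lemma**: a linear endomorphism of a simple representation over an algebraically closed
field that commutes with the group action is a scalar. -/
theorem FDRep.exists_eq_smul_id_of_simple {k : Type*} {G : Type*} [Field k] [IsAlgClosed k]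
    [Monoid G] (V : FDRep k G) [Simple V] (f : V →ₗ[k] V)
    (hf : ∀ g : G, f ∘ₗ V.ρ g = V.ρ g ∘ₗ f) :
    ∃ c : k, f = c • LinearMap.id := by
  let F : V ⟶ V := FDRep.forget₂HomLinearEquiv V V (Rep.ofHom ⟨f, hf⟩)
  obtain ⟨c, hc⟩ := endomorphism_simple_eq_smul_id k F
  exact ⟨c, congrArg (fun φ : V ⟶ V => φ.hom.hom.hom) hc.symm⟩

theorem exists_involutive_intertwiner {G : Type} [Group G] [Fintype G]
    (V : FDRep ℂ G) (hV : Simple V) (ε : G →* ℂˣ) (hε : ∀ g : G, ε g ^ 2 = 1)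
    (hiso : ∃ e : V ≃ₗ[ℂ] V, ∀ g : G,
      (e.toLinearMap ∘ₗ V.ρ g) = (ε g : ℂ) • (V.ρ g ∘ₗ e.toLinearMap)) :
    ∃ H : V →ₗ[ℂ] V, H ∘ₗ H = LinearMap.id ∧
      ∀ g : G, (H ∘ₗ V.ρ g) = (ε g : ℂ) • (V.ρ g ∘ₗ H) := by
  obtain ⟨e, he⟩ := hiso
  obtain ⟨c, hc⟩ := FDRep.exists_eq_smul_id_of_simple V (e.toLinearMap ∘ₗ e.toLinearMap) fun g => by
    have hg : (ε g : ℂ) * (ε g : ℂ) = 1 := by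
      rw [← sq]
      simpa using congrArg Units.val (hε g)
    rw [LinearMap.comp_assoc, he, LinearMap.comp_smul, ← LinearMap.comp_assoc, he,
      LinearMap.smul_comp, smul_smul, hg, one_smul, LinearMap.comp_assoc]
  have hcv (v : V) : e (e v) = c • v := LinearMap.congr_fun hc v
  by_cases hc0 : c = 0
  · have : Subsingleton V :=
      ⟨fun v w => e.injective (e.injective (by rw [hcv, hcv, hc0, zero_smul, zero_smul]))⟩
    exact ⟨LinearMap.id, rfl, fun g => LinearMap.ext fun v => Subsingleton.elim _ _⟩
  · obtain ⟨d, hd⟩ := IsAlgClosed.exists_eq_mul_self c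
    have hd0 : d ≠ 0 := by
      rintro rfl
      exact hc0 (by rw [hd, mul_zero])
    refine ⟨d⁻¹ • e.toLinearMap, ?_, fun g => ?_⟩
    · rw [LinearMap.smul_comp, LinearMap.comp_smul, hc, hd, smul_smul, smul_smul]
      have : d⁻¹ * (d⁻¹ * (d * d)) = 1 := by field_simp
      rw [← mul_assoc] at this
      rw [this, one_smul]
    · rw [LinearMap.smul_comp, he, LinearMap.comp_smul, smul_comm]
end

section
/- Let n ≥ 1 and let Γ be a group. There is a unique group homomorphism π : H̃_n → Perm(Fin n) with π(s_i) = (i, i+1), π(a_j) = 1, and π(z) = 1. Form the semidirect product H̃Γ_n = (Fin n → Γ) ⋊ H̃_n, where H̃_n acts on Fin n → Γ by permuting coordinates via π. Then the element (1, z) is central of order 2 in H̃Γ_n, and the quotient of H̃Γ_n by the subgroup generated by (1, z) is isomorphic to (Fin n → Γ) ⋊ H_n, where H_n = (Fin n → ZMod 2) ⋊ Perm(Fin n) acts on Fin n → Γ by permuting coordinates through its Perm(Fin n)-component. -/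
/-!
STATEMENT 16: for `n ≥ 1` and a group `Γ`, there is a unique homomorphism
`π : H̃ₙ → Perm (Fin n)` with `π(sᵢ) = (i, i+1)`, `π(aⱼ) = 1`, `π(z) = 1`.
Forming `H̃Γₙ = (Fin n → Γ) ⋊ H̃ₙ` (action through `π` by permuting
coordinates), the element `(1, z)` is central of order 2, and the quotient of
`H̃Γₙ` by the subgroup generated by `(1, z)` (which coincides with its normal
closure) is isomorphic to `(Fin n → Γ) ⋊ Hₙ`, where
`Hₙ = (Fin n → ZMod 2) ⋊ Perm (Fin n)` acts through its `Perm (Fin n)`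
component.  (`ZMod 2` is written multiplicatively.)
-/

namespace Stmt16

inductive HGen (n : ℕ) : Type
  | s : Fin (n - 1) → HGen n
  | a : Fin n → HGen n
  | z : HGen n

variable {n : ℕ}

def S (i : Fin (n - 1)) : FreeGroup (HGen n) := FreeGroup.of (HGen.s i)
def A (j : Fin n) : FreeGroup (HGen n) := FreeGroup.of (HGen.a j)
def Z : FreeGroup (HGen n) := FreeGroup.of (HGen.z)

def idx1 (i : Fin (n - 1)) : Fin n := ⟨(i : ℕ), by have := i.isLt; omega⟩
def idx2 (i : Fin (n - 1)) : Fin n := ⟨(i : ℕ) + 1, by have := i.isLt; omega⟩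

def hRels (n : ℕ) : Set (FreeGroup (HGen n)) :=
  { w | (∃ i : Fin (n - 1), w = Z * S i * Z⁻¹ * (S i)⁻¹)
    ∨ (∃ j : Fin n, w = Z * A j * Z⁻¹ * (A j)⁻¹)
    ∨ (w = Z ^ 2)
    ∨ (∃ i : Fin (n - 1), w = S i ^ 2)
    ∨ (∃ i j : Fin (n - 1), (j : ℕ) = (i : ℕ) + 1 ∧ w = (S i * S j) ^ 3)
    ∨ (∃ i j : Fin (n - 1), ((i : ℕ) + 2 ≤ (j : ℕ) ∨ (j : ℕ) + 2 ≤ (i : ℕ)) ∧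
        w = (S i * S j) ^ 2)
    ∨ (∃ i : Fin (n - 1), w = S i * A (idx1 i) * (S i)⁻¹ * (A (idx2 i))⁻¹)
    ∨ (∃ (i : Fin (n - 1)) (j : Fin n), (j : ℕ) ≠ (i : ℕ) ∧ (j : ℕ) ≠ (i : ℕ) + 1 ∧
        w = S i * A j * (S i)⁻¹ * (A j)⁻¹)
    ∨ (∃ j : Fin n, w = A j ^ 2 * Z⁻¹)
    ∨ (∃ i j : Fin n, i ≠ j ∧ w = A i * A j * (A i)⁻¹ * (A j)⁻¹ * Z⁻¹) }

abbrev HTilde (n : ℕ) := PresentedGroup (hRels n)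

/-- The action of `Perm (Fin n)` on `Fin n → M` by permuting the coordinates. -/
def permAut (n : ℕ) (M : Type*) [Group M] : Equiv.Perm (Fin n) →* MulAut (Fin n → M) where
  toFun σ := { Equiv.arrowCongr σ (Equiv.refl M) with map_mul' := fun _ _ => rfl }
  map_one' := rfl
  map_mul' := fun _ _ => rfl

/-- The hyperoctahedral group `Hₙ = (Fin n → ZMod 2) ⋊ Perm (Fin n)`. -/
abbrev HOcta (n : ℕ) :=
  SemidirectProduct (Fin n → Multiplicative (ZMod 2)) (Equiv.Perm (Fin n))
    (permAut n (Multiplicative (ZMod 2)))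

/-- The property characterizing `π : H̃ₙ → Perm (Fin n)`. -/
def IsProj (n : ℕ) (π : HTilde n →* Equiv.Perm (Fin n)) : Prop :=
  (∀ i : Fin (n - 1), π (PresentedGroup.of (HGen.s i)) = Equiv.swap (idx1 i) (idx2 i)) ∧
  (∀ j : Fin n, π (PresentedGroup.of (HGen.a j)) = 1) ∧
  π (PresentedGroup.of (HGen.z)) = 1

/-- The wreath-like semidirect product `H̃Γₙ = (Fin n → Γ) ⋊ H̃ₙ`. -/
abbrev HWr (n : ℕ) (Γ : Type*) [Group Γ] (π : HTilde n →* Equiv.Perm (Fin n)) :=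
  SemidirectProduct (Fin n → Γ) (HTilde n) ((permAut n Γ).comp π)

/-- The element `(1, z)` of `H̃Γₙ`. -/
def zElt (n : ℕ) (Γ : Type*) [Group Γ] (π : HTilde n →* Equiv.Perm (Fin n)) :
    HWr n Γ π :=
  SemidirectProduct.inr (PresentedGroup.of (HGen.z))

/-- The group `(Fin n → Γ) ⋊ Hₙ`, where `Hₙ` acts through its
`Perm (Fin n)`-component by permuting coordinates. -/
abbrev HOctaWr (n : ℕ) (Γ : Type*) [Group Γ] :=
  SemidirectProduct (Fin n → Γ) (HOcta n) ((permAut n Γ).comp SemidirectProduct.rightHom)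

theorem closure_range_swap_idx (n : ℕ) :
    Subgroup.closure (Set.range fun i : Fin (n - 1) => Equiv.swap (idx1 i) (idx2 i)) = ⊤ := by
  rcases n with _ | m
  · exact Subsingleton.elim _ _
  · rw [eq_top_iff, ← Subgroup.toSubmonoid_le, Subgroup.top_toSubmonoid,
      ← Equiv.Perm.mclosure_swap_castSucc_succ m]
    exact Subgroup.le_closure_toSubmonoid _

/-- A family of elements of a group satisfying the Coxeter relations of type `A_m`. -/
structure IsCoxeterFamily {G : Type*} [Group G] (s : ℕ → G) (m : ℕ) : Prop where
  mul_self : ∀ i < m, s i * s i = 1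
  braid : ∀ i, i + 1 < m → s (i + 1) * (s i * s (i + 1)) = s i * (s (i + 1) * s i)
  comm : ∀ i j, i + 2 ≤ j → j < m → s i * s j = s j * s i

namespace IsCoxeterFamily

variable {G : Type*} [Group G] {s : ℕ → G} {m : ℕ}

theorem mono {m' : ℕ} (h : IsCoxeterFamily s m) (hm : m' ≤ m) : IsCoxeterFamily s m' where
  mul_self i hi := h.mul_self i (by omega)
  braid i hi := h.braid i (by omega)
  comm i j hij hj := h.comm i j hij (by omega)

theorem mul_chain_of_lt (h : IsCoxeterFamily s m) {c : ℕ → G} (hc : c m = 1)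
    (hcs : ∀ k < m, c k = s k * c (k + 1)) {j k : ℕ} (hjk : j + 1 < k) (hk : k ≤ m) :
    s j * c k = c k * s j := by
  induction hk using Nat.decreasingInduction with
  | self => simp [hc]
  | of_succ k hk ih =>
    rw [hcs k hk, ← mul_assoc, h.comm j k hjk hk, mul_assoc, ih (by omega), mul_assoc]

theorem mul_chain_of_le (h : IsCoxeterFamily s m) {c : ℕ → G} (hc : c m = 1)
    (hcs : ∀ k < m, c k = s k * c (k + 1)) {j k : ℕ} (hjk : k ≤ j) (hj : j + 1 < m) :
    s (j + 1) * c k = c k * s j := by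
  induction hjk using Nat.decreasingInduction with
  | self =>
    have hcomm := h.mul_chain_of_lt hc hcs (j := j) (k := j + 2) (by omega) (by omega)
    rw [hcs j (by omega), hcs (j + 1) hj, ← mul_assoc (s j), ← mul_assoc, h.braid j hj]
    simp only [mul_assoc, hcomm]
  | of_succ k hk ih =>
    rw [hcs k (by omega), ← mul_assoc, ← h.comm k (j + 1) (by omega) hj, mul_assoc, ih,
      mul_assoc]

/-- The words in a Coxeter family of type `A_m` take at most `(m + 1)!` values. -/
theorem exists_finset (h : IsCoxeterFamily s m) :
    ∃ T : Finset G, T.card ≤ (m + 1).factorial ∧ 1 ∈ T ∧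
      ∀ i < m, ∀ x ∈ T, s i * x ∈ T := by
  classical
  induction m with
  | zero => exact ⟨{1}, by simp⟩
  | succ m ih =>
    obtain ⟨T, hcard, hone, hmul⟩ := ih (h.mono (Nat.le_succ m))
    obtain ⟨c, hc, hcs⟩ : ∃ c : ℕ → G, c (m + 1) = 1 ∧ ∀ k < m + 1, c k = s k * c (k + 1) := by
      refine ⟨fun k => ((List.range' k (m + 1 - k)).map s).prod, by simp, fun k hk => ?_⟩
      obtain ⟨d, hd⟩ : ∃ d, m + 1 - k = d + 1 := ⟨m - k, by omega⟩
      have hd' : m + 1 - (k + 1) = d := by omega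
      simp only [hd, hd', List.range'_succ, List.map_cons, List.prod_cons]
    refine ⟨(Finset.range (m + 2) ×ˢ T).image fun p => c p.1 * p.2, ?_, ?_, ?_⟩
    · refine Finset.card_image_le.trans ?_
      rw [Finset.card_product, Finset.card_range, Nat.factorial_succ (m + 1)]
      exact Nat.mul_le_mul_left _ hcard
    · exact Finset.mem_image.2 ⟨(m + 1, 1), by simp [hone], by simp [hc]⟩
    · intro j hj x hx
      obtain ⟨⟨k, t⟩, hkt, rfl⟩ := Finset.mem_image.1 hx
      obtain ⟨hk, ht⟩ : k < m + 2 ∧ t ∈ T := by simpa using hkt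
      have key : ∀ k' < m + 2, ∀ t' ∈ T, s j * (c k * t) = c k' * t' →
          s j * (c k * t) ∈ (Finset.range (m + 2) ×ˢ T).image fun p => c p.1 * p.2 := by
        intro k' hk' t' ht' heq
        exact Finset.mem_image.2 ⟨(k', t'), by simp [hk', ht'], heq.symm⟩
      rcases lt_trichotomy j k with hjk | rfl | hjk
      · rcases Nat.eq_or_lt_of_le (Nat.succ_le_of_lt hjk) with rfl | hjk'
        · exact key j (by omega) t ht (by rw [hcs j hj, mul_assoc])
        · refine key k hk (s j * t) (hmul j (by omega) t ht) ?_
          rw [← mul_assoc, h.mul_chain_of_lt hc hcs hjk' (by omega), mul_assoc]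
      · refine key (j + 1) (by omega) t ht ?_
        rw [hcs j hj, ← mul_assoc, ← mul_assoc, h.mul_self j hj, one_mul]
      · obtain ⟨j, rfl⟩ : ∃ i, j = i + 1 := ⟨j - 1, by omega⟩
        refine key k hk (s j * t) (hmul j (by omega) t ht) ?_
        rw [← mul_assoc, h.mul_chain_of_le hc hcs (by omega) hj, mul_assoc]

theorem finite_closure_and_card_le (h : IsCoxeterFamily s m) :
    Finite (Subgroup.closure (s '' Set.Iio m)) ∧
      Nat.card (Subgroup.closure (s '' Set.Iio m)) ≤ (m + 1).factorial := by
  obtain ⟨T, hcard, hone, hmul⟩ := h.exists_finset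
  have hsub : (Subgroup.closure (s '' Set.Iio m) : Set G) ⊆ T := by
    intro x hx
    induction hx using Subgroup.closure_induction_left with
    | one => exact hone
    | mul_left y hy x _ ih =>
      obtain ⟨i, hi, rfl⟩ := hy
      exact hmul i hi x ih
    | inv_mul_cancel y hy x _ ih =>
      obtain ⟨i, hi, rfl⟩ := hy
      rw [inv_eq_of_mul_eq_one_left (h.mul_self i hi)]
      exact hmul i hi x ih
  refine ⟨T.finite_toSet.subset hsub, le_trans ?_ hcard⟩
  have := Set.ncard_le_ncard hsub T.finite_toSet
  rwa [Set.ncard_coe_finset] at this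

end IsCoxeterFamily

theorem swap_idx_mul_pow_three {i j : Fin (n - 1)} (hij : (j : ℕ) = i + 1) :
    (Equiv.swap (idx1 i) (idx2 i) * Equiv.swap (idx1 j) (idx2 j)) ^ 3 = 1 := by
  have hj : idx1 j = idx2 i := Fin.ext hij
  rw [hj, Equiv.swap_comm (idx1 i)]
  have h3 := Equiv.Perm.isThreeCycle_swap_mul_swap_same (a := idx2 i) (b := idx1 i) (c := idx2 j)
    (by simp [idx1, idx2]) (by simp [idx2]; omega) (by simp [idx1, idx2]; omega)
  rw [← h3.orderOf, pow_orderOf_eq_one]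

theorem swap_idx_mul_sq {i j : Fin (n - 1)}
    (hij : (i : ℕ) + 2 ≤ j ∨ (j : ℕ) + 2 ≤ i) :
    (Equiv.swap (idx1 i) (idx2 i) * Equiv.swap (idx1 j) (idx2 j)) ^ 2 = 1 := by
  have hd : Equiv.Perm.Disjoint (Equiv.swap (idx1 i) (idx2 i)) (Equiv.swap (idx1 j) (idx2 j)) := by
    intro x
    by_contra! hx
    obtain ⟨h1, h2⟩ := hx
    have h1' := Equiv.swap_apply_ne_self_iff.1 h1
    have h2' := Equiv.swap_apply_ne_self_iff.1 h2
    simp only [idx1, idx2, Fin.ext_iff] at h1' h2'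
    omega
  rw [hd.commute.mul_pow]
  simp [sq]

/-- A homomorphism out of `H̃ₙ` from a homomorphism out of `Perm (Fin n)` and a compatible family
of pairwise anticommuting elements. -/
theorem exists_hom {G : Type*} [Group G] (P : Equiv.Perm (Fin n) →* G) (a : Fin n → G) (z : G)
    (hzP : ∀ σ, z * P σ = P σ * z) (hza : ∀ j, z * a j = a j * z) (hz : z ^ 2 = 1)
    (hPa : ∀ σ j, P σ * a j = a (σ j) * P σ) (ha : ∀ j, a j ^ 2 = z)
    (haa : ∀ i j, i ≠ j → a i * a j = z * (a j * a i)) :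
    ∃ f : HTilde n →* G,
      (∀ i, f (PresentedGroup.of (HGen.s i)) = P (Equiv.swap (idx1 i) (idx2 i))) ∧
      (∀ j, f (PresentedGroup.of (HGen.a j)) = a j) ∧ f (PresentedGroup.of HGen.z) = z := by
  let g : HGen n → G := fun
    | .s i => P (Equiv.swap (idx1 i) (idx2 i))
    | .a j => a j
    | .z => z
  have hS (i) : FreeGroup.lift g (S i) = P (Equiv.swap (idx1 i) (idx2 i)) := FreeGroup.lift_apply_of
  have hA (j) : FreeGroup.lift g (A j) = a j := FreeGroup.lift_apply_of
  have hZ : FreeGroup.lift g (Z : FreeGroup (HGen n)) = z := FreeGroup.lift_apply_of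
  have hg : ∀ r ∈ hRels n, FreeGroup.lift g r = 1 := by
    rintro r (⟨i, rfl⟩ | ⟨j, rfl⟩ | rfl | ⟨i, rfl⟩ | ⟨i, j, hij, rfl⟩ | ⟨i, j, hij, rfl⟩ |
      ⟨i, rfl⟩ | ⟨i, j, h1, h2, rfl⟩ | ⟨j, rfl⟩ | ⟨i, j, hij, rfl⟩) <;>
      simp only [map_mul, map_pow, map_inv, hS, hA, hZ]
    · rw [hzP]; group
    · rw [hza]; group
    · exact hz
    · rw [← map_pow]; simp [sq]
    · rw [← map_mul, ← map_pow, swap_idx_mul_pow_three hij, map_one]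
    · rw [← map_mul, ← map_pow, swap_idx_mul_sq hij, map_one]
    · rw [hPa, Equiv.swap_apply_left]; group
    · rw [hPa, Equiv.swap_apply_of_ne_of_ne (by simpa [idx1, Fin.ext_iff] using h1)
        (by simpa [idx2, Fin.ext_iff] using h2)]
      group
    · rw [ha, mul_inv_cancel]
    · rw [haa i j hij]; group
  exact ⟨PresentedGroup.toGroup hg, fun i => PresentedGroup.toGroup.of hg,
    fun j => PresentedGroup.toGroup.of hg, PresentedGroup.toGroup.of hg⟩

/-- The negative definite form `-∑ xᵢ²`. -/
noncomputable abbrev negSumSquares (n : ℕ) : QuadraticForm ℝ (Fin n → ℝ) :=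
  QuadraticMap.weightedSumSquares ℝ fun _ : Fin n => (-1 : ℝ)

/-- Permutations of the coordinates are isometries of `-∑ xᵢ²`. -/
noncomputable def permIsometry (σ : Equiv.Perm (Fin n)) :
    (negSumSquares n).Isometry (negSumSquares n) where
  toLinearMap := LinearMap.funLeft ℝ ℝ σ.symm
  map_app' v := by
    simp only [QuadraticMap.weightedSumSquares_apply]
    exact Equiv.sum_comp σ.symm fun i => (-1 : ℝ) • (v i * v i)

theorem permIsometry_single (σ : Equiv.Perm (Fin n)) (j : Fin n) :
    permIsometry σ (Pi.single j 1) = Pi.single (σ j) 1 := by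
  ext i
  change (Pi.single j 1 : Fin n → ℝ) (σ.symm i) = _
  simp [Pi.single_apply, Equiv.symm_apply_eq]

/-- `Perm (Fin n)` acts on the Clifford algebra of `-∑ xᵢ²`. -/
noncomputable def permClifford (n : ℕ) :
    Equiv.Perm (Fin n) →* Module.End ℝ (CliffordAlgebra (negSumSquares n)) where
  toFun σ := (CliffordAlgebra.map (permIsometry σ)).toLinearMap
  map_one' := by
    have : permIsometry (1 : Equiv.Perm (Fin n)) = QuadraticMap.Isometry.id _ := rfl
    rw [this, CliffordAlgebra.map_id]
    rfl
  map_mul' σ τ := by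
    have : permIsometry (σ * τ) = (permIsometry σ).comp (permIsometry τ) := rfl
    rw [this, ← CliffordAlgebra.map_comp_map]
    rfl

theorem ι_single_mul_self (j : Fin n) :
    CliffordAlgebra.ι (negSumSquares n) (Pi.single j 1) *
      CliffordAlgebra.ι (negSumSquares n) (Pi.single j 1) = -1 := by
  rw [CliffordAlgebra.ι_sq_scalar, QuadraticMap.weightedSumSquares_apply]
  simp [Pi.single_apply]

theorem ι_single_mul_ι_single {i j : Fin n} (hij : i ≠ j) :
    CliffordAlgebra.ι (negSumSquares n) (Pi.single i 1) *
      CliffordAlgebra.ι (negSumSquares n) (Pi.single j 1) =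
    -(CliffordAlgebra.ι (negSumSquares n) (Pi.single j 1) *
      CliffordAlgebra.ι (negSumSquares n) (Pi.single i 1)) := by
  apply CliffordAlgebra.ι_mul_ι_comm_of_isOrtho
  rw [QuadraticMap.isOrtho_def]
  simp only [QuadraticMap.weightedSumSquares_apply, ← Finset.sum_add_distrib]
  refine Finset.sum_congr rfl fun k _ => ?_
  by_cases hk : k = i
  · subst hk; simp [hij]
  · simp [hk]

/-- A representation of `H̃ₙ` in a ring with `z` acting as `-1`. -/
theorem exists_hom_units {R : Type*} [Ring R] (P : Equiv.Perm (Fin n) →* R) (a : Fin n → R)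
    (hPa : ∀ σ j, P σ * a j = a (σ j) * P σ) (ha : ∀ j, a j * a j = -1)
    (haa : ∀ i j, i ≠ j → a i * a j = -(a j * a i)) :
    ∃ f : HTilde n →* Rˣ, f (PresentedGroup.of HGen.z) = -1 := by
  let u : Fin n → Rˣ := fun j => ⟨a j, -a j, by simp [ha], by simp [ha]⟩
  obtain ⟨f, -, -, hf⟩ := exists_hom P.toHomUnits u (-1) (by simp) (by simp) (by simp)
    (fun σ j => Units.ext (hPa σ j))
    (fun j => Units.ext (by simpa [u, sq] using ha j))
    (fun i j hij => Units.ext (by simpa [u] using haa i j hij))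
  exact ⟨f, hf⟩

theorem of_z_ne_one (n : ℕ) : (PresentedGroup.of HGen.z : HTilde n) ≠ 1 := by
  obtain ⟨f, hf⟩ := exists_hom_units (permClifford n)
    (fun j => Algebra.lmul ℝ _ (CliffordAlgebra.ι (negSumSquares n) (Pi.single j 1)))
    (by
      intro σ j
      refine LinearMap.ext fun x => ?_
      change CliffordAlgebra.map (permIsometry σ) (CliffordAlgebra.ι _ (Pi.single j 1) * x) =
        CliffordAlgebra.ι _ (Pi.single (σ j) 1) * CliffordAlgebra.map (permIsometry σ) x
      rw [map_mul, CliffordAlgebra.map_apply_ι, permIsometry_single])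
    (by
      intro j
      rw [← map_mul, ι_single_mul_self, map_neg, map_one])
    (by
      intro i j hij
      rw [← map_mul, ι_single_mul_ι_single hij, map_neg, map_mul])
  intro hz
  rw [hz, map_one] at hf
  have h1 : (1 : CliffordAlgebra (negSumSquares n)) = -1 :=
    congrArg (fun w : (Module.End ℝ (CliffordAlgebra (negSumSquares n)))ˣ =>
      (w : Module.End ℝ (CliffordAlgebra (negSumSquares n))) 1) hf
  have : CharZero (CliffordAlgebra (negSumSquares n)) :=
    charZero_of_injective_algebraMap (algebraMap ℝ _).injective
  have h2 : (2 : CliffordAlgebra (negSumSquares n)) = 0 := by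
    rw [← one_add_one_eq_two, add_eq_zero_iff_eq_neg, ← h1]
  exact two_ne_zero h2

theorem normal_of_le_center {G : Type*} [Group G] {H : Subgroup G} (h : H ≤ Subgroup.center G) :
    H.Normal where
  conj_mem x hx g := by rwa [Subgroup.mem_center_iff.1 (h hx) g, mul_inv_cancel_right]

/-- The generator `sᵢ` of `H̃ₙ`. -/
abbrev gs (i : Fin (n - 1)) : HTilde n := PresentedGroup.of (HGen.s i)

/-- The generator `aⱼ` of `H̃ₙ`. -/
abbrev ga (j : Fin n) : HTilde n := PresentedGroup.of (HGen.a j)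

/-- The generator `z` of `H̃ₙ`. -/
abbrev gz (n : ℕ) : HTilde n := PresentedGroup.of HGen.z

theorem gz_mul_gs (i : Fin (n - 1)) : gz n * gs i = gs i * gz n := by
  have h : gz n * gs i * (gz n)⁻¹ * (gs i)⁻¹ = 1 :=
    PresentedGroup.one_of_mem (x := Z * S i * Z⁻¹ * (S i)⁻¹) (Or.inl ⟨i, rfl⟩)
  rwa [mul_inv_eq_one, mul_inv_eq_iff_eq_mul] at h

theorem gz_mul_ga (j : Fin n) : gz n * ga j = ga j * gz n := by
  have h : gz n * ga j * (gz n)⁻¹ * (ga j)⁻¹ = 1 :=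
    PresentedGroup.one_of_mem (x := Z * A j * Z⁻¹ * (A j)⁻¹) (Or.inr (Or.inl ⟨j, rfl⟩))
  rwa [mul_inv_eq_one, mul_inv_eq_iff_eq_mul] at h

theorem gz_sq : gz n ^ 2 = 1 :=
  PresentedGroup.one_of_mem (x := Z ^ 2) (Or.inr (Or.inr (Or.inl rfl)))

theorem gs_mul_self (i : Fin (n - 1)) : gs i * gs i = 1 := by
  rw [← sq]
  exact PresentedGroup.one_of_mem (x := S i ^ 2) (Or.inr (Or.inr (Or.inr (Or.inl ⟨i, rfl⟩))))

theorem gs_inv (i : Fin (n - 1)) : (gs i)⁻¹ = gs i :=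
  inv_eq_of_mul_eq_one_left (gs_mul_self i)

theorem gs_braid {i j : Fin (n - 1)} (hij : (j : ℕ) = i + 1) :
    gs j * (gs i * gs j) = gs i * (gs j * gs i) := by
  have h : (gs i * gs j) ^ 3 = 1 := PresentedGroup.one_of_mem (x := (S i * S j) ^ 3)
    (Or.inr (Or.inr (Or.inr (Or.inr (Or.inl ⟨i, j, hij, rfl⟩)))))
  have h' : gs i * (gs j * gs i) * (gs j * (gs i * gs j)) = 1 := by
    rw [← h]; simp only [pow_succ, pow_zero, one_mul, mul_assoc]
  rw [eq_inv_of_mul_eq_one_left h']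
  simp only [mul_inv_rev, gs_inv, mul_assoc]

theorem gs_comm {i j : Fin (n - 1)} (hij : (i : ℕ) + 2 ≤ j) : gs i * gs j = gs j * gs i := by
  have h : (gs i * gs j) ^ 2 = 1 := PresentedGroup.one_of_mem (x := (S i * S j) ^ 2)
    (Or.inr (Or.inr (Or.inr (Or.inr (Or.inr (Or.inl ⟨i, j, Or.inl hij, rfl⟩))))))
  rw [sq] at h
  rw [eq_inv_of_mul_eq_one_left h, mul_inv_rev, gs_inv, gs_inv]

theorem gs_mul_ga_idx1 (i : Fin (n - 1)) : gs i * ga (idx1 i) = ga (idx2 i) * gs i := by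
  have h : gs i * ga (idx1 i) * (gs i)⁻¹ * (ga (idx2 i))⁻¹ = 1 :=
    PresentedGroup.one_of_mem (x := S i * A (idx1 i) * (S i)⁻¹ * (A (idx2 i))⁻¹)
      (Or.inr (Or.inr (Or.inr (Or.inr (Or.inr (Or.inr (Or.inl ⟨i, rfl⟩)))))))
  rwa [mul_inv_eq_one, mul_inv_eq_iff_eq_mul] at h

theorem gs_mul_ga_idx2 (i : Fin (n - 1)) : gs i * ga (idx2 i) = ga (idx1 i) * gs i := by
  rw [← mul_inv_eq_iff_eq_mul, gs_inv, mul_assoc, ← gs_mul_ga_idx1, ← mul_assoc, gs_mul_self,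
    one_mul]

theorem gs_mul_ga_of_ne {i : Fin (n - 1)} {j : Fin n} (h1 : j ≠ idx1 i) (h2 : j ≠ idx2 i) :
    gs i * ga j = ga j * gs i := by
  have h : gs i * ga j * (gs i)⁻¹ * (ga j)⁻¹ = 1 :=
    PresentedGroup.one_of_mem (x := S i * A j * (S i)⁻¹ * (A j)⁻¹)
      (Or.inr (Or.inr (Or.inr (Or.inr (Or.inr (Or.inr (Or.inr (Or.inl
        ⟨i, j, fun h => h1 (Fin.ext h), fun h => h2 (Fin.ext h), rfl⟩))))))))
  rwa [mul_inv_eq_one, mul_inv_eq_iff_eq_mul] at h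

theorem gs_mul_ga (i : Fin (n - 1)) (j : Fin n) :
    gs i * ga j = ga (Equiv.swap (idx1 i) (idx2 i) j) * gs i := by
  by_cases h1 : j = idx1 i
  · rw [h1, Equiv.swap_apply_left, gs_mul_ga_idx1]
  by_cases h2 : j = idx2 i
  · rw [h2, Equiv.swap_apply_right, gs_mul_ga_idx2]
  rw [Equiv.swap_apply_of_ne_of_ne h1 h2, gs_mul_ga_of_ne h1 h2]

theorem ga_mul_self (j : Fin n) : ga j * ga j = gz n := by
  have h : ga j ^ 2 * (gz n)⁻¹ = 1 :=
    PresentedGroup.one_of_mem (x := A j ^ 2 * Z⁻¹)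
      (Or.inr (Or.inr (Or.inr (Or.inr (Or.inr (Or.inr (Or.inr (Or.inr (Or.inl ⟨j, rfl⟩)))))))))
  rwa [mul_inv_eq_one, sq] at h

theorem ga_mul_ga {i j : Fin n} (hij : i ≠ j) : ga i * ga j = gz n * (ga j * ga i) := by
  have h : ga i * ga j * (ga i)⁻¹ * (ga j)⁻¹ * (gz n)⁻¹ = 1 :=
    PresentedGroup.one_of_mem (x := A i * A j * (A i)⁻¹ * (A j)⁻¹ * Z⁻¹)
      (Or.inr (Or.inr (Or.inr (Or.inr (Or.inr (Or.inr (Or.inr (Or.inr (Or.inr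
        ⟨i, j, hij, rfl⟩)))))))))
  rw [mul_inv_eq_one, mul_inv_eq_iff_eq_mul, mul_inv_eq_iff_eq_mul] at h
  rw [h, mul_assoc]

theorem gz_mem_center (n : ℕ) : gz n ∈ Subgroup.center (HTilde n) := by
  have h (x : HTilde n) : x ∈ Subgroup.centralizer {gz n} := by
    refine PresentedGroup.generated_by _ _ (fun g => ?_) x
    rw [Subgroup.mem_centralizer_singleton_iff]
    cases g with
    | s i => exact (gz_mul_gs i).symm
    | a j => exact (gz_mul_ga j).symm
    | z => rfl
  exact Subgroup.mem_center_iff.2 fun x => Subgroup.mem_centralizer_singleton_iff.1 (h x)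

/-- The generators `sᵢ` of `H̃ₙ` extended by `1` to a family indexed by `ℕ`. -/
def gsSeq (n i : ℕ) : HTilde n := if h : i < n - 1 then gs ⟨i, h⟩ else 1

theorem gsSeq_of_lt {i : ℕ} (h : i < n - 1) : gsSeq n i = gs ⟨i, h⟩ := dif_pos h

theorem isCoxeterFamily_gsSeq (n : ℕ) : IsCoxeterFamily (gsSeq n) (n - 1) where
  mul_self i hi := by rw [gsSeq_of_lt hi, gs_mul_self]
  braid i hi := by rw [gsSeq_of_lt hi, gsSeq_of_lt (by omega : i < n - 1), gs_braid rfl]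
  comm i j hij hj := by rw [gsSeq_of_lt hj, gsSeq_of_lt (by omega : i < n - 1), gs_comm hij]

/-- The Coxeter presentation of the symmetric group provides a section of `H̃ₙ → Perm (Fin n)`. -/
theorem exists_section {π : HTilde n →* Equiv.Perm (Fin n)} (hπ : IsProj n π) :
    ∃ F : Equiv.Perm (Fin n) →* HTilde n, ∀ i, F (Equiv.swap (idx1 i) (idx2 i)) = gs i := by
  let H := Subgroup.closure (gsSeq n '' Set.Iio (n - 1))
  have hmem (i : Fin (n - 1)) : gs i ∈ H :=
    Subgroup.subset_closure ⟨i, i.isLt, gsSeq_of_lt i.isLt⟩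
  obtain ⟨hfin, hcard⟩ := (isCoxeterFamily_gsSeq n).finite_closure_and_card_le
  have hfact : (n - 1 + 1).factorial = n.factorial := by cases n <;> rfl
  let ρ : H →* Equiv.Perm (Fin n) := π.comp H.subtype
  have hρ (i) : ρ ⟨gs i, hmem i⟩ = Equiv.swap (idx1 i) (idx2 i) := hπ.1 i
  have hsurj : Function.Surjective ρ := by
    rw [← MonoidHom.range_eq_top, eq_top_iff, ← closure_range_swap_idx, Subgroup.closure_le]
    rintro _ ⟨i, rfl⟩
    exact ⟨_, hρ i⟩
  have hbij : Function.Bijective ρ := hsurj.bijective_of_nat_card_le <| by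
    rwa [Nat.card_eq_fintype_card (α := Equiv.Perm (Fin n)), Fintype.card_perm, Fintype.card_fin,
      ← hfact]
  let E := MulEquiv.ofBijective ρ hbij
  refine ⟨H.subtype.comp E.symm.toMonoidHom, fun i => ?_⟩
  have : E.symm (Equiv.swap (idx1 i) (idx2 i)) = ⟨gs i, hmem i⟩ := by
    rw [MulEquiv.symm_apply_eq]
    exact (hρ i).symm
  exact congrArg Subtype.val this

theorem section_mul_ga {F : Equiv.Perm (Fin n) →* HTilde n}
    (hF : ∀ i, F (Equiv.swap (idx1 i) (idx2 i)) = gs i) (σ : Equiv.Perm (Fin n)) (j : Fin n) :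
    F σ * ga j = ga (σ j) * F σ := by
  have hσ : σ ∈ Subgroup.closure
      (Set.range fun i : Fin (n - 1) => Equiv.swap (idx1 i) (idx2 i)) := by
    rw [closure_range_swap_idx]; trivial
  induction hσ using Subgroup.closure_induction generalizing j with
  | mem _ h =>
    obtain ⟨i, rfl⟩ := h
    rw [hF, gs_mul_ga]
  | one => simp
  | mul σ τ _ _ hσ hτ => rw [map_mul, mul_assoc, hτ, ← mul_assoc, hσ, mul_assoc]; rfl
  | inv σ _ hσ =>
    have := hσ (σ⁻¹ j)
    rw [show σ (σ⁻¹ j) = j from σ.apply_symm_apply j] at this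
    rw [map_inv, inv_mul_eq_iff_eq_mul, ← mul_assoc, this, mul_inv_cancel_right]

theorem permAut_mulSingle {M : Type*} [Group M] (σ : Equiv.Perm (Fin n)) (j : Fin n) (x : M) :
    permAut n M σ (Pi.mulSingle j x) = Pi.mulSingle (σ j) x := by
  ext i
  change (Pi.mulSingle j x : Fin n → M) (σ.symm i) = _
  simp [Pi.mulSingle_apply, Equiv.symm_apply_eq]

/-- The generator of the `j`-th copy of `ZMod 2` in `Hₙ`. -/
def signFlip (j : Fin n) : HOcta n :=
  SemidirectProduct.inl (Pi.mulSingle j (Multiplicative.ofAdd 1))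

theorem multiplicative_zmod_two_cases (x : Multiplicative (ZMod 2)) :
    x = 1 ∨ x = Multiplicative.ofAdd 1 := by
  revert x; decide

theorem exists_hom_zmod_two {G : Type*} [Group G] {g : G} (hg : g * g = 1) :
    ∃ f : Multiplicative (ZMod 2) →* G, f (Multiplicative.ofAdd 1) = g := by
  have h10 : (Multiplicative.ofAdd 1 : Multiplicative (ZMod 2)) ≠ 1 := by decide
  have h11 : (Multiplicative.ofAdd 1 * Multiplicative.ofAdd 1 : Multiplicative (ZMod 2)) = 1 := by
    decide
  let f : Multiplicative (ZMod 2) → G := fun x => if x = 1 then 1 else g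
  have hf1 : f 1 = 1 := if_pos rfl
  have hfg : f (Multiplicative.ofAdd 1) = g := if_neg h10
  refine ⟨⟨⟨f, hf1⟩, fun x y => ?_⟩, hfg⟩
  change f (x * y) = f x * f y
  rcases multiplicative_zmod_two_cases x with rfl | rfl <;>
    rcases multiplicative_zmod_two_cases y with rfl | rfl <;> simp [hf1, hfg, h11, hg]

/-- The universal property of `Hₙ`. -/
theorem exists_hom_hOcta {G : Type*} [Group G] (F : Equiv.Perm (Fin n) →* G) (b : Fin n → G)
    (hb : ∀ j, b j * b j = 1) (hbb : ∀ i j, Commute (b i) (b j))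
    (hFb : ∀ σ j, F σ * b j = b (σ j) * F σ) :
    ∃ g : HOcta n →* G, (∀ σ, g (SemidirectProduct.inr σ) = F σ) ∧ ∀ j, g (signFlip j) = b j := by
  choose f hf using fun j => exists_hom_zmod_two (hb j)
  have hcomm : Pairwise fun i j => ∀ x y, Commute (f i x) (f j y) := by
    intro i j _ x y
    rcases multiplicative_zmod_two_cases x with rfl | rfl <;>
      rcases multiplicative_zmod_two_cases y with rfl | rfl <;> simp [hf, hbb]
  let B : (Fin n → Multiplicative (ZMod 2)) →* G := MonoidHom.noncommPiCoprod f hcomm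
  have hB (j x) : B (Pi.mulSingle j x) = f j x := MonoidHom.noncommPiCoprod_mulSingle ..
  refine ⟨SemidirectProduct.lift B F fun σ => ?_, fun σ => SemidirectProduct.lift_inr .., ?_⟩
  · refine MonoidHom.ext fun v => ?_
    refine Subgroup.pi_mem_of_mulSingle_mem (H := MonoidHom.eqLocus _ _) v fun j => ?_
    generalize v j = x
    change B (permAut n _ σ (Pi.mulSingle j x)) = F σ * B (Pi.mulSingle j x) * (F σ)⁻¹
    rw [permAut_mulSingle, hB, hB, eq_mul_inv_iff_mul_eq]
    rcases multiplicative_zmod_two_cases x with rfl | rfl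
    · simp
    · rw [hf, hf, hFb]
  · intro j
    rw [signFlip, SemidirectProduct.lift_inl, hB, hf]

theorem inr_mul_signFlip (σ : Equiv.Perm (Fin n)) (j : Fin n) :
    (SemidirectProduct.inr σ : HOcta n) * signFlip j =
      signFlip (σ j) * SemidirectProduct.inr σ := by
  rw [signFlip, signFlip, ← permAut_mulSingle, SemidirectProduct.inl_aut, map_inv,
    inv_mul_cancel_right]

/-- The projection `H̃ₙ → Hₙ`. -/
theorem exists_hom_hTilde_hOcta (n : ℕ) :
    ∃ ψ : HTilde n →* HOcta n,
      (∀ i, ψ (gs i) = SemidirectProduct.inr (Equiv.swap (idx1 i) (idx2 i))) ∧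
      (∀ j, ψ (ga j) = signFlip j) ∧ ψ (gz n) = 1 := by
  refine exists_hom SemidirectProduct.inr signFlip 1 (by simp) (by simp) (by simp)
    inr_mul_signFlip (fun j => ?_) (fun i j _ => ?_)
  · rw [signFlip, ← map_pow, ← Pi.mulSingle_pow]
    have : (Multiplicative.ofAdd 1 : Multiplicative (ZMod 2)) ^ 2 = 1 := by decide
    rw [this, Pi.mulSingle_one, map_one]
  · rw [one_mul, signFlip, signFlip, ← map_mul, mul_comm, map_mul]

theorem IsProj.eq {π π' : HTilde n →* Equiv.Perm (Fin n)} (h : IsProj n π) (h' : IsProj n π') :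
    π = π' := by
  refine PresentedGroup.ext fun g => ?_
  cases g with
  | s i => rw [h.1, h'.1]
  | a j => rw [h.2.1, h'.2.1]
  | z => rw [h.2.2, h'.2.2]

theorem isProj_rightHom_comp {ψ : HTilde n →* HOcta n}
    (hs : ∀ i, ψ (gs i) = SemidirectProduct.inr (Equiv.swap (idx1 i) (idx2 i)))
    (ha : ∀ j, ψ (ga j) = signFlip j) (hz : ψ (gz n) = 1) :
    IsProj n (SemidirectProduct.rightHom.comp ψ) := by
  refine ⟨fun i => ?_, fun j => ?_, ?_⟩
  · rw [MonoidHom.comp_apply, hs, SemidirectProduct.rightHom_inr]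
  · rw [MonoidHom.comp_apply, ha, signFlip, SemidirectProduct.rightHom_inl]
  · rw [MonoidHom.comp_apply, hz, map_one]

theorem hTilde_hOcta_surjective {ψ : HTilde n →* HOcta n}
    (hs : ∀ i, ψ (gs i) = SemidirectProduct.inr (Equiv.swap (idx1 i) (idx2 i)))
    (ha : ∀ j, ψ (ga j) = signFlip j) : Function.Surjective ψ := by
  have hr : ψ.range.comap SemidirectProduct.inr = ⊤ := by
    rw [eq_top_iff, ← closure_range_swap_idx, Subgroup.closure_le]
    rintro _ ⟨i, rfl⟩
    exact ⟨_, hs i⟩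
  have hl (v) : v ∈ ψ.range.comap SemidirectProduct.inl := by
    refine Subgroup.pi_mem_of_mulSingle_mem v fun j => ?_
    rcases multiplicative_zmod_two_cases (v j) with h | h <;> rw [h]
    · rw [Pi.mulSingle_one]
      exact one_mem _
    · exact ⟨_, ha j⟩
  intro x
  rw [← SemidirectProduct.inl_left_mul_inr_right x]
  exact ψ.range.mul_mem (hl x.left) (show x.right ∈ ψ.range.comap _ by rw [hr]; trivial)

theorem mem_zpowers_of_hTilde_hOcta_eq_one {ψ : HTilde n →* HOcta n}
    (hs : ∀ i, ψ (gs i) = SemidirectProduct.inr (Equiv.swap (idx1 i) (idx2 i)))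
    (ha : ∀ j, ψ (ga j) = signFlip j) (hz : ψ (gz n) = 1) {x : HTilde n} (hx : ψ x = 1) :
    x ∈ Subgroup.zpowers (gz n) := by
  have hN : (Subgroup.zpowers (gz n)).Normal :=
    normal_of_le_center (by simpa using gz_mem_center n)
  let q := QuotientGroup.mk' (Subgroup.zpowers (gz n))
  have hqz : q (gz n) = 1 := (QuotientGroup.eq_one_iff _).2 (Subgroup.mem_zpowers _)
  obtain ⟨F, hF⟩ := exists_section (isProj_rightHom_comp hs ha hz)
  obtain ⟨g, hgr, hgl⟩ := exists_hom_hOcta (q.comp F) (fun j => q (ga j))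
    (fun j => by rw [← map_mul, ga_mul_self, hqz])
    (fun i j => by
      rcases eq_or_ne i j with rfl | hij
      · exact Commute.refl _
      · rw [commute_iff_eq, ← map_mul, ga_mul_ga hij, map_mul, hqz, one_mul, map_mul])
    (fun σ j => by
      rw [MonoidHom.comp_apply, ← map_mul, section_mul_ga hF, map_mul])
  have hgψ : g.comp ψ = q := by
    refine PresentedGroup.ext fun y => ?_
    rw [MonoidHom.comp_apply]
    cases y with
    | s i => rw [hs, hgr, MonoidHom.comp_apply, hF]
    | a j => rw [ha, hgl]
    | z => rw [hz, map_one, hqz]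
  rw [← QuotientGroup.eq_one_iff]
  change q x = 1
  rw [← hgψ, MonoidHom.comp_apply, hx, map_one]

section Wreath

variable {Γ : Type*} [Group Γ] {π : HTilde n →* Equiv.Perm (Fin n)}

theorem zElt_mem_center (hπ : IsProj n π) : zElt n Γ π ∈ Subgroup.center (HWr n Γ π) := by
  refine Subgroup.mem_center_iff.2 fun x => ?_
  have hx := Subgroup.mem_center_iff.1 (gz_mem_center n) x.right
  ext1
  · simp [zElt, hπ.2.2]
  · simpa [zElt] using hx

theorem orderOf_zElt : orderOf (zElt n Γ π) = 2 := by
  rw [zElt, orderOf_injective _ SemidirectProduct.inr_injective]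
  exact orderOf_eq_prime gz_sq (of_z_ne_one n)

theorem normalClosure_zElt (hπ : IsProj n π) :
    Subgroup.normalClosure {zElt n Γ π} = Subgroup.closure {zElt n Γ π} := by
  have : (Subgroup.closure {zElt n Γ π}).Normal := normal_of_le_center <| by
    simpa using zElt_mem_center hπ
  exact le_antisymm (Subgroup.normalClosure_le_normal Subgroup.subset_closure)
    Subgroup.closure_le_normalClosure

theorem nonempty_quotient_mulEquiv (hπ : IsProj n π) :
    Nonempty ((HWr n Γ π ⧸ Subgroup.normalClosure {zElt n Γ π}) ≃* HOctaWr n Γ) := by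
  obtain ⟨ψ, hs, ha, hz⟩ := exists_hom_hTilde_hOcta n
  obtain rfl := hπ.eq (isProj_rightHom_comp hs ha hz)
  let Φ : HWr n Γ (SemidirectProduct.rightHom.comp ψ) →* HOctaWr n Γ :=
    SemidirectProduct.map (MonoidHom.id _) ψ fun _ => rfl
  have hsurj : Function.Surjective Φ := by
    intro x
    obtain ⟨y, hy⟩ := hTilde_hOcta_surjective hs ha x.right
    exact ⟨⟨x.left, y⟩, SemidirectProduct.ext rfl hy⟩
  have hker : Subgroup.normalClosure {zElt n Γ (SemidirectProduct.rightHom.comp ψ)} = Φ.ker := by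
    rw [normalClosure_zElt hπ, ← Subgroup.zpowers_eq_closure]
    refine le_antisymm ?_ fun x hx => ?_
    · rw [Subgroup.zpowers_le, MonoidHom.mem_ker, zElt, SemidirectProduct.map_inr, hz, map_one]
    · have hx' : Φ x = 1 := hx
      have hl : x.left = 1 := congrArg SemidirectProduct.left hx'
      obtain ⟨k, hk⟩ := mem_zpowers_of_hTilde_hOcta_eq_one hs ha hz
        (congrArg SemidirectProduct.right hx' : ψ x.right = 1)
      refine ⟨k, ?_⟩
      change SemidirectProduct.inr (gz n) ^ k = x
      change gz n ^ k = x.right at hk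
      rw [← map_zpow, hk, ← SemidirectProduct.inl_left_mul_inr_right x, hl]
      simp
  exact ⟨(QuotientGroup.quotientMulEquivOfEq hker).trans
    (QuotientGroup.quotientKerEquivOfSurjective Φ hsurj)⟩

end Wreath

theorem hwr_center_order_quotient (n : ℕ) (hn : 1 ≤ n) (Γ : Type) [Group Γ] :
    (∃! π : HTilde n →* Equiv.Perm (Fin n), IsProj n π) ∧
    (∀ π : HTilde n →* Equiv.Perm (Fin n), IsProj n π →
      zElt n Γ π ∈ Subgroup.center (HWr n Γ π) ∧
      orderOf (zElt n Γ π) = 2 ∧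
      Subgroup.normalClosure {zElt n Γ π} = Subgroup.closure {zElt n Γ π} ∧
      Nonempty ((HWr n Γ π ⧸ Subgroup.normalClosure {zElt n Γ π}) ≃* HOctaWr n Γ)) := by
  obtain ⟨ψ, hs, ha, hz⟩ := exists_hom_hTilde_hOcta n
  exact ⟨⟨_, isProj_rightHom_comp hs ha hz, fun π hπ => hπ.eq (isProj_rightHom_comp hs ha hz)⟩,
    fun π hπ => ⟨zElt_mem_center hπ, orderOf_zElt, normalClosure_zElt hπ,
      nonempty_quotient_mulEquiv hπ⟩⟩

end Stmt16
end

section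
/- Let G be a finite group and n ≥ 1. The number of conjugacy classes of the wreath product G ≀ S_n := (Fin n → G) ⋊ Perm(Fin n), where Perm(Fin n) acts by permuting coordinates, equals the number of functions f from the set of conjugacy classes of G to the set of integer partitions such that the sum over all conjugacy classes c of the size |f(c)| equals n. -/
/-!
STATEMENT 17: for a finite group `G` and `n ≥ 1`, the number of conjugacy
classes of the wreath product `G ≀ Sₙ = (Fin n → G) ⋊ Perm (Fin n)` equals the
number of functions `f` from the conjugacy classes of `G` to integer
partitions with total weight `∑ c |f c| = n`.
-/

namespace Stmt17

/-- The action of `Perm (Fin n)` on `Fin n → G` by permuting the coordinates. -/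
def permAut (n : ℕ) (M : Type*) [Group M] : Equiv.Perm (Fin n) →* MulAut (Fin n → M) where
  toFun σ := { Equiv.arrowCongr σ (Equiv.refl M) with map_mul' := fun _ _ => rfl }
  map_one' := rfl
  map_mul' := fun _ _ => rfl

/-- The wreath product `G ≀ Sₙ = (Fin n → G) ⋊ Perm (Fin n)`. -/
abbrev WreathProduct (G : Type*) [Group G] (n : ℕ) :=
  SemidirectProduct (Fin n → G) (Equiv.Perm (Fin n)) (permAut n G)

section

open Function

variable {G : Type} [Group G] {n : ℕ}

theorem permAut_apply (σ : Equiv.Perm (Fin n)) (f : Fin n → G) (x : Fin n) :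
    permAut n G σ f x = f (σ⁻¹ x) := rfl

theorem WreathProduct.pow_right (w : WreathProduct G n) (k : ℕ) :
    (w ^ k).right = w.right ^ k :=
  map_pow SemidirectProduct.rightHom w k

/-- The product of the `G`-components of `w` along the first `k` steps of the orbit of `x`. -/
def cocycle (w : WreathProduct G n) (x : Fin n) (k : ℕ) : G :=
  (w ^ k).left ((w.right ^ k) x)

@[simp]
theorem cocycle_zero (w : WreathProduct G n) (x : Fin n) : cocycle w x 0 = 1 := by
  simp [cocycle]

theorem cocycle_succ (w : WreathProduct G n) (x : Fin n) (k : ℕ) :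
    cocycle w x (k + 1) = w.left ((w.right ^ (k + 1)) x) * cocycle w x k := by
  simp [cocycle, pow_succ', permAut_apply]

theorem WreathProduct.conj_left_apply (w u : WreathProduct G n) (x : Fin n) :
    (u * w * u⁻¹).left (u.right x) =
      u.left (u.right x) * w.left x * (u.left (u.right (w.right⁻¹ x)))⁻¹ := by
  simp only [SemidirectProduct.mul_left, SemidirectProduct.mul_right, SemidirectProduct.inv_left,
    Pi.mul_apply, Pi.inv_apply, permAut_apply, mul_inv_rev, Equiv.Perm.mul_apply,
    Equiv.Perm.inv_def, Equiv.symm_apply_apply, Equiv.symm_symm]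

theorem conj_pow_apply {α : Type*} (σ π : Equiv.Perm α) (x : α) (k : ℕ) :
    ((π * σ * π⁻¹) ^ k) (π x) = π ((σ ^ k) x) := by
  rw [conj_pow, Equiv.Perm.mul_apply, Equiv.Perm.mul_apply, Equiv.Perm.inv_def,
    Equiv.symm_apply_apply]

theorem cocycle_conj (w u : WreathProduct G n) (x : Fin n) (k : ℕ) :
    cocycle (u * w * u⁻¹) (u.right x) k =
      u.left (u.right ((w.right ^ k) x)) * cocycle w x k * (u.left (u.right x))⁻¹ := by
  induction k with
  | zero => simp
  | succ k ih =>
    have hk : ((u * w * u⁻¹).right ^ (k + 1)) (u.right x) = u.right ((w.right ^ (k + 1)) x) :=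
      conj_pow_apply w.right u.right x (k + 1)
    have hw : w.right⁻¹ ((w.right ^ (k + 1)) x) = (w.right ^ k) x := by
      rw [pow_succ', Equiv.Perm.mul_apply, Equiv.Perm.inv_def, Equiv.symm_apply_apply]
    rw [cocycle_succ, ih, cocycle_succ, hk, WreathProduct.conj_left_apply, hw]
    group

/-- The conjugacy class of the cycle product through `x`, with the length of the cycle. -/
noncomputable def cycleInvariant (w : WreathProduct G n) (x : Fin n) : ConjClasses G × ℕ :=
  (ConjClasses.mk (cocycle w x (minimalPeriod w.right x)), minimalPeriod w.right x)

theorem minimalPeriod_conj {α : Type*} (σ π : Equiv.Perm α) (x : α) :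
    minimalPeriod (π * σ * π⁻¹ : Equiv.Perm α) (π x) = minimalPeriod σ x := by
  rw [minimalPeriod_eq_minimalPeriod_iff]
  intro k
  rw [IsPeriodicPt, IsFixedPt, IsPeriodicPt, IsFixedPt, Equiv.Perm.iterate_eq_pow,
    Equiv.Perm.iterate_eq_pow, conj_pow_apply, π.apply_eq_iff_eq]

theorem pow_minimalPeriod_apply {α : Type*} (σ : Equiv.Perm α) (x : α) :
    (σ ^ minimalPeriod σ x) x = x := by
  rw [← Equiv.Perm.iterate_eq_pow]
  exact iterate_minimalPeriod

theorem cycleInvariant_conj (w u : WreathProduct G n) (x : Fin n) :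
    cycleInvariant (u * w * u⁻¹) (u.right x) = cycleInvariant w x := by
  have h : minimalPeriod (u * w * u⁻¹).right (u.right x) = minimalPeriod w.right x :=
    minimalPeriod_conj w.right u.right x
  rw [cycleInvariant, cycleInvariant, h, Prod.mk.injEq]
  refine ⟨?_, rfl⟩
  rw [ConjClasses.mk_eq_mk_iff_isConj, cocycle_conj, pow_minimalPeriod_apply]
  exact (isConj_iff.2 ⟨_, rfl⟩).symm

theorem cycleInvariant_pow_apply (w : WreathProduct G n) (x : Fin n) (k : ℕ) :
    cycleInvariant w ((w.right ^ k) x) = cycleInvariant w x := by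
  have h := cycleInvariant_conj w (w ^ k) x
  rwa [(Commute.pow_self w k).eq, mul_inv_cancel_right, WreathProduct.pow_right] at h

/-- The number of points of `Fin n` with a given cycle invariant. -/
noncomputable def cycleCount (w : WreathProduct G n) (q : ConjClasses G × ℕ) : ℕ :=
  Nat.card {x // cycleInvariant w x = q}

theorem cycleCount_eq_of_isConj {w w' : WreathProduct G n} (h : IsConj w w') :
    cycleCount w = cycleCount w' := by
  obtain ⟨u, rfl⟩ := isConj_iff.1 h
  funext q
  exact Nat.card_congr (u.right.subtypeEquiv fun x => by rw [cycleInvariant_conj])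

/-- `r` and `ℓ` give base points and lengths for the cycles of `σ`, fixed points included. -/
structure IsCycleSystem {α ι : Type*} (σ : Equiv.Perm α) (r : ι → α) (ℓ : ι → ℕ) : Prop where
  pos : ∀ o, 0 < ℓ o
  pow_apply : ∀ o, (σ ^ ℓ o) (r o) = r o
  bijective : Bijective fun s : Σ o, Fin (ℓ o) => (σ ^ (s.2 : ℕ)) (r s.1)

namespace IsCycleSystem

variable {α ι ι' : Type*} {σ : Equiv.Perm α} {r : ι → α} {ℓ : ι → ℕ}

theorem minimalPeriod_eq (h : IsCycleSystem σ r ℓ) (o : ι) : minimalPeriod σ (r o) = ℓ o := by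
  have hp : IsPeriodicPt σ (ℓ o) (r o) := by
    rw [IsPeriodicPt, IsFixedPt, Equiv.Perm.iterate_eq_pow, h.pow_apply]
  refine (hp.minimalPeriod_le (h.pos o)).antisymm (le_of_not_gt fun hlt => ?_)
  have := @h.bijective.1 ⟨o, ⟨_, hlt⟩⟩ ⟨o, ⟨0, h.pos o⟩⟩ (by simp [pow_minimalPeriod_apply])
  simp only [Sigma.mk.injEq, heq_eq_eq, Fin.mk.injEq, true_and] at this
  exact (hp.minimalPeriod_pos (h.pos o)).ne' this

theorem comp_equiv (h : IsCycleSystem σ r ℓ) (e : ι' ≃ ι) : IsCycleSystem σ (r ∘ e) (ℓ ∘ e) where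
  pos o := h.pos (e o)
  pow_apply o := h.pow_apply (e o)
  bijective := h.bijective.comp (Equiv.sigmaCongrLeft (β := fun o => Fin (ℓ o)) e).bijective

theorem exists_of_finite {α : Type} [Finite α] (σ : Equiv.Perm α) :
    ∃ (ι : Type) (_ : Fintype ι) (r : ι → α) (ℓ : ι → ℕ), IsCycleSystem σ r ℓ := by
  have hpos (x : α) : 0 < minimalPeriod σ x :=
    minimalPeriod_pos_of_mem_periodicPts
      (mk_mem_periodicPts (orderOf_pos σ) (by
        rw [IsPeriodicPt, IsFixedPt, Equiv.Perm.iterate_eq_pow, pow_orderOf_eq_one]; rfl))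
  refine ⟨Quotient (Equiv.Perm.SameCycle.setoid σ), Fintype.ofFinite _, Quotient.out,
    fun o => minimalPeriod σ o.out, fun o => hpos _, fun o => pow_minimalPeriod_apply _ _, ?_, ?_⟩
  · rintro ⟨o, k⟩ ⟨o', k'⟩ h
    have hk (o : Quotient (Equiv.Perm.SameCycle.setoid σ)) (k : ℕ) :
        (Quotient.mk (Equiv.Perm.SameCycle.setoid σ) ((σ ^ k) o.out)) = o := by
      conv_rhs => rw [← o.out_eq]
      exact Quotient.sound (Equiv.Perm.sameCycle_pow_left.2 (Equiv.Perm.SameCycle.refl _ _))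
    obtain rfl : o = o' := by
      rw [← hk o k, ← hk o' k']
      exact congrArg _ h
    congr 1
    refine Fin.ext ((iterate_eq_iterate_iff_of_lt_minimalPeriod k.2 k'.2).1 ?_)
    rw [Equiv.Perm.iterate_eq_pow, Equiv.Perm.iterate_eq_pow]
    exact h
  · intro x
    obtain ⟨k, hk⟩ := Equiv.Perm.SameCycle.exists_nat_pow_eq
      (Quotient.exact (Quotient.out_eq (Quotient.mk (Equiv.Perm.SameCycle.setoid σ) x)))
    refine ⟨⟨Quotient.mk _ x, ⟨k % minimalPeriod σ _, Nat.mod_lt _ (hpos _)⟩⟩, ?_⟩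
    refine Eq.trans ?_ hk
    simp only [← Equiv.Perm.iterate_eq_pow, iterate_mod_minimalPeriod_eq]

theorem sum_eq_card [Fintype ι] [Finite α] (h : IsCycleSystem σ r ℓ) :
    ∑ o, ℓ o = Nat.card α := by
  simp [← Nat.card_congr (Equiv.ofBijective _ h.bijective)]

variable {w w' : WreathProduct G n} {r r' : ι → Fin n}

theorem cycleInvariant_eq (h : IsCycleSystem w.right r ℓ) (o : ι) :
    cycleInvariant w (r o) = (ConjClasses.mk (cocycle w (r o) (ℓ o)), ℓ o) := by
  rw [cycleInvariant, h.minimalPeriod_eq]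

theorem cycleCount_eq [Finite ι] (h : IsCycleSystem w.right r ℓ) (c : ConjClasses G) (m : ℕ) :
    cycleCount w (c, m) = Nat.card {o // cycleInvariant w (r o) = (c, m)} * m := by
  have := Fintype.ofFinite ι
  classical
  rw [cycleCount, ← Nat.card_congr ((Equiv.ofBijective _ h.bijective).subtypeEquiv
    (p := fun s => cycleInvariant w (r s.1) = (c, m))
    fun s => by simp [cycleInvariant_pow_apply]),
    Nat.card_congr (Equiv.subtypeSigmaEquiv (fun o => Fin (ℓ o))
      (fun o => cycleInvariant w (r o) = (c, m))), Nat.card_sigma,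
    Finset.sum_congr rfl (g := fun _ => m)]
  · simp
  · rintro ⟨o, ho⟩ -
    rw [h.cycleInvariant_eq, Prod.mk.injEq] at ho
    simp [ho.2]

theorem isConj (h : IsCycleSystem w.right r ℓ) (h' : IsCycleSystem w'.right r' ℓ)
    (hc : ∀ o, IsConj (cocycle w (r o) (ℓ o)) (cocycle w' (r' o) (ℓ o))) : IsConj w w' := by
  choose a ha using fun o => isConj_iff.1 (hc o)
  let E := Equiv.ofBijective _ h.bijective
  let E' := Equiv.ofBijective _ h'.bijective
  let π : Equiv.Perm (Fin n) := E.symm.trans E'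
  let b : Fin n → G := fun x => cocycle w' (r' (E'.symm x).1) (E'.symm x).2 *
    a (E'.symm x).1 * (cocycle w (r (E'.symm x).1) (E'.symm x).2)⁻¹
  have hπ (o : ι) (k : ℕ) (hk : k ≤ ℓ o) :
      π ((w.right ^ k) (r o)) = (w'.right ^ k) (r' o) := by
    have key (k : ℕ) (hk : k < ℓ o) :
        π ((w.right ^ k) (r o)) = (w'.right ^ k) (r' o) := by
      have : (w.right ^ k) (r o) = E ⟨o, ⟨k, hk⟩⟩ := rfl
      rw [this, Equiv.trans_apply, Equiv.symm_apply_apply]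
      rfl
    rcases hk.lt_or_eq with hk | rfl
    · exact key k hk
    · rw [h.pow_apply, h'.pow_apply]
      exact key 0 (h.pos o)
  have hb (o : ι) (k : ℕ) (hk : k ≤ ℓ o) :
      b ((w'.right ^ k) (r' o)) = cocycle w' (r' o) k * a o * (cocycle w (r o) k)⁻¹ := by
    have key (k : ℕ) (hk : k < ℓ o) :
        b ((w'.right ^ k) (r' o)) = cocycle w' (r' o) k * a o * (cocycle w (r o) k)⁻¹ := by
      have : E'.symm ((w'.right ^ k) (r' o)) = ⟨o, ⟨k, hk⟩⟩ := E'.symm_apply_eq.2 rfl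
      simp only [b]
      rw [this]
    rcases hk.lt_or_eq with hk | rfl
    · exact key k hk
    · rw [h'.pow_apply, ← ha o]
      simpa using key 0 (h.pos o)
  refine isConj_iff.2 ⟨⟨b, π⟩, mul_inv_eq_iff_eq_mul.2 (SemidirectProduct.ext ?_ ?_)⟩
  · funext x
    obtain ⟨⟨o, k⟩, rfl⟩ := (E'.trans w'.right).surjective x
    have hx : (E'.trans w'.right) ⟨o, k⟩ = (w'.right ^ (k + 1 : ℕ)) (r' o) := by
      simp [E', pow_succ']
    have hx' : w'.right⁻¹ ((w'.right ^ (k + 1 : ℕ)) (r' o)) = (w'.right ^ (k : ℕ)) (r' o) := by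
      simp [pow_succ']
    have hx'' : π⁻¹ ((w'.right ^ (k + 1 : ℕ)) (r' o)) = (w.right ^ (k + 1 : ℕ)) (r o) :=
      Equiv.Perm.inv_eq_iff_eq.2 (hπ o _ k.2).symm
    simp only [SemidirectProduct.mul_left, Pi.mul_apply, permAut_apply, hx, hx', hx'']
    rw [hb o _ k.2, hb o _ k.2.le, cocycle_succ, cocycle_succ]
    group
  · ext1 x
    obtain ⟨⟨o, k⟩, rfl⟩ := E.surjective x
    have h₁ := hπ o (k + 1) k.2
    have h₂ := hπ o k k.2.le
    simp only [pow_succ', Equiv.Perm.mul_apply] at h₁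
    change π (w.right ((w.right ^ (k : ℕ)) (r o))) = w'.right (π ((w.right ^ (k : ℕ)) (r o)))
    rw [h₁, h₂]

end IsCycleSystem

theorem exists_equiv_of_card_fiber_eq {ι ι' β : Type*} [Finite ι] [Finite ι'] (a : ι → β)
    (b : ι' → β) (h : ∀ q, Nat.card {o // a o = q} = Nat.card {o // b o = q}) :
    ∃ e : ι ≃ ι', ∀ o, b (e o) = a o := by
  let e q := Classical.choice (Finite.card_eq.1 (h q))
  refine ⟨(Equiv.sigmaFiberEquiv a).symm.trans
    ((Equiv.sigmaCongrRight e).trans (Equiv.sigmaFiberEquiv b)), fun o => ?_⟩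
  exact (e (a o) ⟨o, rfl⟩).2

theorem isConj_iff_cycleCount_eq {w w' : WreathProduct G n} :
    IsConj w w' ↔ cycleCount w = cycleCount w' := by
  refine ⟨cycleCount_eq_of_isConj, fun hww' => ?_⟩
  obtain ⟨ι, _, r, ℓ, h⟩ := IsCycleSystem.exists_of_finite w.right
  obtain ⟨ι', _, r', ℓ', h'⟩ := IsCycleSystem.exists_of_finite w'.right
  obtain ⟨e, he⟩ := exists_equiv_of_card_fiber_eq (fun o => cycleInvariant w (r o))
    (fun o => cycleInvariant w' (r' o)) fun ⟨c, m⟩ => by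
      rcases m.eq_zero_or_pos with rfl | hm
      · have h₁ (o : ι) : cycleInvariant w (r o) ≠ (c, 0) := fun ho =>
          (h.pos o).ne' (congrArg Prod.snd ((h.cycleInvariant_eq o).symm.trans ho))
        have h₂ (o : ι') : cycleInvariant w' (r' o) ≠ (c, 0) := fun ho =>
          (h'.pos o).ne' (congrArg Prod.snd ((h'.cycleInvariant_eq o).symm.trans ho))
        simp [h₁, h₂]
      · have := congrFun hww' (c, m)
        rw [h.cycleCount_eq, h'.cycleCount_eq] at this
        exact Nat.eq_of_mul_eq_mul_right hm this
  simp only [h.cycleInvariant_eq, h'.cycleInvariant_eq, Prod.mk.injEq,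
    ConjClasses.mk_eq_mk_iff_isConj] at he
  obtain rfl : ℓ' ∘ e = ℓ := funext fun o => (he o).2
  exact h.isConj (h'.comp_equiv e) fun o => (he o).1.symm

theorem finRotate_mk_of_lt {l k : ℕ} (h : k + 1 < l) :
    finRotate l ⟨k, k.lt_succ_self.trans h⟩ = ⟨k + 1, h⟩ := by
  obtain ⟨m, rfl⟩ := Nat.exists_eq_succ_of_ne_zero (Nat.ne_zero_of_lt h)
  exact finRotate_of_lt (by lia)

theorem finRotate_mk_of_eq {l m : ℕ} (h : l = m + 1) :
    finRotate l ⟨m, by lia⟩ = ⟨0, by lia⟩ := by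
  subst h
  exact finRotate_last'

theorem exists_isCycleSystem_cocycle_eq {ι : Type} [Fintype ι] (ℓ : ι → ℕ) (hpos : ∀ o, 0 < ℓ o)
    (hsum : ∑ o, ℓ o = n) (g : ι → G) :
    ∃ (w : WreathProduct G n) (r : ι → Fin n), IsCycleSystem w.right r ℓ ∧
      ∀ o, cocycle w (r o) (ℓ o) = g o := by
  let E : (Σ o, Fin (ℓ o)) ≃ Fin n := Fintype.equivFinOfCardEq (by simp [hsum])
  let σ : Equiv.Perm (Fin n) := E.permCongr (Equiv.sigmaCongrRight fun o => finRotate (ℓ o))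
  let w : WreathProduct G n :=
    ⟨fun x => if ((E.symm x).2 : ℕ) = 0 then g (E.symm x).1 else 1, σ⟩
  let r : ι → Fin n := fun o => E ⟨o, ⟨0, hpos o⟩⟩
  have hσ (o : ι) (k : Fin (ℓ o)) : σ (E ⟨o, k⟩) = E ⟨o, finRotate _ k⟩ := by
    simp [σ, Equiv.permCongr_apply]
  have hlt (o : ι) (k : ℕ) (hk : k < ℓ o) : (σ ^ k) (r o) = E ⟨o, ⟨k, hk⟩⟩ := by
    induction k with
    | zero => rfl
    | succ k ih =>
      rw [pow_succ', Equiv.Perm.mul_apply, ih (by lia), hσ, finRotate_mk_of_lt hk]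
  have hper (o : ι) : (σ ^ ℓ o) (r o) = r o := by
    obtain ⟨m, hm⟩ := Nat.exists_eq_succ_of_ne_zero (hpos o).ne'
    have hm' : m < ℓ o := by lia
    rw [hm, pow_succ', Equiv.Perm.mul_apply, hlt o m hm', hσ, finRotate_mk_of_eq hm]
  refine ⟨w, r, ⟨hpos, hper, ?_⟩, fun o => ?_⟩
  · convert E.bijective using 1
    funext s
    exact hlt s.1 s.2 s.2.2
  · have hone (k : ℕ) (hk : k < ℓ o) : cocycle w (r o) k = 1 := by
      induction k with
      | zero => simp
      | succ k ih =>
        rw [cocycle_succ, ih (by lia), mul_one]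
        change w.left ((σ ^ (k + 1)) (r o)) = 1
        rw [hlt o _ hk]
        change (if ((E.symm (E _)).2 : ℕ) = 0 then _ else _) = _
        rw [E.symm_apply_apply, if_neg k.succ_ne_zero]
    obtain ⟨m, hm⟩ := Nat.exists_eq_succ_of_ne_zero (hpos o).ne'
    have hm' : m < ℓ o := by lia
    have hw : w.left (r o) = g o := by
      change (if ((E.symm (E _)).2 : ℕ) = 0 then g (E.symm (E _)).1 else _) = _
      rw [E.symm_apply_apply, if_pos rfl]
    rw [hm, Nat.succ_eq_add_one, cocycle_succ, hone m hm', mul_one, ← Nat.succ_eq_add_one, ← hm]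
    change w.left ((σ ^ ℓ o) (r o)) = _
    rw [hper, hw]

/-- `f` records, for each class `c`, the lengths of the cycles of `w` with cycle product in `c`. -/
def HasCyclePartitions (w : WreathProduct G n) (f : ConjClasses G → Σ m : ℕ, m.Partition) : Prop :=
  ∀ c m, cycleCount w (c, m) = (f c).2.parts.count m * m

theorem sigma_partition_ext {p q : Σ m : ℕ, m.Partition} (h : p.2.parts = q.2.parts) : p = q := by
  obtain ⟨m, p⟩ := p
  obtain ⟨m', q⟩ := q
  obtain rfl : m = m' := by rw [← p.parts_sum, ← q.parts_sum]; exact congrArg _ h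
  exact congrArg _ (Nat.Partition.ext h)

theorem HasCyclePartitions.eq_iff {w w' : WreathProduct G n}
    {f f' : ConjClasses G → Σ m : ℕ, m.Partition} (h : HasCyclePartitions w f)
    (h' : HasCyclePartitions w' f') : f = f' ↔ IsConj w w' := by
  rw [isConj_iff_cycleCount_eq]
  constructor
  · rintro rfl
    funext ⟨c, m⟩
    rw [h, h']
  · intro hww'
    funext c
    refine sigma_partition_ext (Multiset.ext.2 fun m => ?_)
    rcases m.eq_zero_or_pos with rfl | hm
    · rw [Multiset.count_eq_zero_of_notMem fun h0 => ((f c).2.parts_pos h0).ne' rfl,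
        Multiset.count_eq_zero_of_notMem fun h0 => ((f' c).2.parts_pos h0).ne' rfl]
    · exact Nat.eq_of_mul_eq_mul_right hm (by rw [← h, ← h', hww'])

theorem IsCycleSystem.hasCyclePartitions {w : WreathProduct G n} {ι : Type} [Fintype ι]
    {r : ι → Fin n} {ℓ : ι → ℕ} (h : IsCycleSystem w.right r ℓ)
    {f : ConjClasses G → Σ m : ℕ, m.Partition}
    (hf : ∀ c m, (f c).2.parts.count m =
      Nat.card {o // ConjClasses.mk (cocycle w (r o) (ℓ o)) = c ∧ ℓ o = m}) :
    HasCyclePartitions w f := by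
  intro c m
  rw [h.cycleCount_eq, hf]
  simp only [h.cycleInvariant_eq, Prod.mk.injEq]

theorem exists_hasCyclePartitions [Finite G] (w : WreathProduct G n) :
    ∃ f : ConjClasses G → Σ m : ℕ, m.Partition,
      ∑ᶠ c, (f c).1 = n ∧ HasCyclePartitions w f := by
  classical
  have := Fintype.ofFinite (ConjClasses G)
  obtain ⟨ι, _, r, ℓ, h⟩ := IsCycleSystem.exists_of_finite w.right
  let s : ConjClasses G → Finset ι := fun c =>
    {o | ConjClasses.mk (cocycle w (r o) (ℓ o)) = c}
  refine ⟨fun c => ⟨∑ o ∈ s c, ℓ o, (s c).val.map ℓ, fun hi => ?_, rfl⟩, ?_,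
    h.hasCyclePartitions fun c m => ?_⟩
  · obtain ⟨o, -, rfl⟩ := Multiset.mem_map.1 hi
    exact h.pos o
  · rw [finsum_eq_sum_of_fintype]
    exact (Finset.sum_fiberwise _ _ _).trans (h.sum_eq_card.trans (Nat.card_fin n))
  · rw [Multiset.count_map, Nat.card_eq_fintype_card, Fintype.card_subtype, Finset.card_def,
      ← Finset.filter_val, Finset.filter_filter]
    simp only [eq_comm]

theorem exists_hasCyclePartitions_of_finsum_eq [Finite G]
    (f : ConjClasses G → Σ m : ℕ, m.Partition) (hf : ∑ᶠ c, (f c).1 = n) :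
    ∃ w : WreathProduct G n, HasCyclePartitions w f := by
  classical
  have := Fintype.ofFinite (ConjClasses G)
  choose rep hrep using ConjClasses.exists_rep (α := G)
  obtain ⟨w, r, h, hg⟩ := exists_isCycleSystem_cocycle_eq (n := n)
    (ι := Σ c, (f c).2.parts.ToType) (fun o => o.2.1)
    (fun o => (f o.1).2.parts_pos Multiset.coe_mem) (by
      rw [Fintype.sum_sigma, ← hf, finsum_eq_sum_of_fintype]
      refine Finset.sum_congr rfl fun c _ => ?_
      rw [← Multiset.sum_eq_sum_coe, (f c).2.parts_sum]) (fun o => rep o.1)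
  refine ⟨w, h.hasCyclePartitions fun c m => ?_⟩
  simp only [hg, hrep]
  refine (Nat.card_fin _).symm.trans (Nat.card_congr ?_)
  exact
    { toFun i := ⟨⟨c, m, i⟩, rfl, rfl⟩
      invFun := fun | ⟨⟨_, _, i⟩, rfl, rfl⟩ => i
      left_inv _ := rfl
      right_inv := by rintro ⟨⟨_, _, i⟩, rfl, rfl⟩; rfl }

end

theorem card_conjClasses_wreathProduct (G : Type) [Group G] [Finite G]
    (n : ℕ) (hn : 1 ≤ n) :
    Nat.card (ConjClasses (WreathProduct G n)) =
      Nat.card {f : ConjClasses G → Σ m : ℕ, m.Partition //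
        ∑ᶠ c : ConjClasses G, (f c).1 = n} := by
  choose F hsum hF using exists_hasCyclePartitions (G := G) (n := n)
  refine Nat.card_congr (Equiv.ofBijective
    (Quotient.lift (fun w => ⟨F w, hsum w⟩) fun w w' h =>
      Subtype.ext (((hF w).eq_iff (hF w')).2 h)) ⟨?_, ?_⟩)
  · rintro ⟨w⟩ ⟨w'⟩ h
    exact Quotient.sound (((hF w).eq_iff (hF w')).1 (congrArg Subtype.val h))
  · rintro ⟨f, hf⟩
    obtain ⟨w, hw⟩ := exists_hasCyclePartitions_of_finsum_eq f hf
    exact ⟨ConjClasses.mk w, Subtype.ext (((hF w).eq_iff hw).2 (IsConj.refl w))⟩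

end Stmt17
end
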